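/- Let T be a Calderón–Zygmund operator on ℝⁿ with standard kernel K and let T** be its maximal truncated operator. Then for every Banach function space X over (ℝⁿ,dx) and every f∈L¹(ℝⁿ), ‖T**f‖_X ≤ C·sup_{D,S} ‖A_{D,S}|f|‖_X, where the supremum is over all dyadic grids D in ℝⁿ and all sparse families S⊆D, and C depends only on T and n. -/

import Mathlib

open MeasureTheory Set Filter
open scoped ENNReal NNReal Topology

noncomputable section

namespace SparseCZ

/-- Euclidean space `ℝⁿ`. -/
abbrev Rn (n : ℕ) := EuclideanSpace ℝ (Fin n)

/-- An axis-parallel (half-open) cube in `ℝⁿ`, recorded by its lower corner and sidelength. -/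
structure Cube (n : ℕ) where
  corner : Fin n → ℝ
  side : ℝ
  side_pos : 0 < side

namespace Cube

variable {n : ℕ}

/-- The set of points of a cube. -/
def toSet (Q : Cube n) : Set (Rn n) :=
  {x | ∀ i, Q.corner i ≤ x i ∧ x i < Q.corner i + Q.side}

/-- `2^m Q`: the cube concentric with `Q` of sidelength `2^m · ℓ_Q`. -/
def dilatePow (Q : Cube n) (m : ℕ) : Cube n where
  corner := fun i => Q.corner i + Q.side / 2 - 2 ^ m * Q.side / 2
  side := 2 ^ m * Q.side
  side_pos := by have := Q.side_pos; positivity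

end Cube

variable {n : ℕ}

/-- A dyadic grid in `ℝⁿ`: cubes of sidelengths `2^k`, pairwise intersections are one of the two
cubes or empty, and the cubes of each fixed sidelength partition `ℝⁿ`. -/
def IsDyadicGrid (D : Set (Cube n)) : Prop :=
  (∀ Q ∈ D, ∃ k : ℤ, Q.side = 2 ^ k) ∧
  (∀ Q ∈ D, ∀ R ∈ D,
    Q.toSet ∩ R.toSet = Q.toSet ∨ Q.toSet ∩ R.toSet = R.toSet ∨ Q.toSet ∩ R.toSet = ∅) ∧
  (∀ k : ℤ, ∀ x : Rn n, ∃! Q : Cube n, Q ∈ D ∧ Q.side = 2 ^ k ∧ x ∈ Q.toSet)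

/-- A sparse family of cubes. -/
def IsSparse (S : Set (Cube n)) : Prop :=
  ∀ Q ∈ S, volume (⋃ P ∈ {P | P ∈ S ∧ P.toSet ⊂ Q.toSet}, Cube.toSet P) ≤ volume Q.toSet / 2

/-- Average `|s|⁻¹ ∫_s f` of an `ℝ≥0∞`-valued function. -/
def avgE (s : Set (Rn n)) (f : Rn n → ℝ≥0∞) : ℝ≥0∞ :=
  (volume s)⁻¹ * ∫⁻ x in s, f x

/-- The Hardy–Littlewood maximal operator over (axis-parallel) cubes. -/
def hlMax (f : Rn n → ℝ≥0∞) (x : Rn n) : ℝ≥0∞ :=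
  ⨆ (Q : Cube n) (_ : x ∈ Q.toSet), avgE Q.toSet f

/-- Sparse operator `A_{D,S} f = Σ_{Q∈S} f_Q χ_Q`. -/
def sparseOp (S : Set (Cube n)) (f : Rn n → ℝ≥0∞) (x : Rn n) : ℝ≥0∞ :=
  ∑' Q : S, Set.indicator (Q.1.toSet) (fun _ => avgE Q.1.toSet f) x

/-- Shifted sparse operator `T_{S,m} f = Σ_{Q∈S} f_{2^m Q} χ_Q`. -/
def sparseOpShift (S : Set (Cube n)) (m : ℕ) (f : Rn n → ℝ≥0∞) (x : Rn n) : ℝ≥0∞ :=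
  ∑' Q : S, Set.indicator (Q.1.toSet) (fun _ => avgE (Q.1.dilatePow m).toSet f) x

/-- The median `m_Q(g)` of a function over a cube. -/
def median (g : Rn n → ℝ) (Q : Cube n) : ℝ :=
  sSup {l : ℝ | volume {x ∈ Q.toSet | l < g x} ≤ volume Q.toSet / 2 ∧
                volume {x ∈ Q.toSet | g x < l} ≤ volume Q.toSet / 2}

/-- A weight: a positive, measurable, locally integrable function. -/
def IsWeight (w : Rn n → ℝ) : Prop :=
  Measurable w ∧ (∀ x, 0 < w x) ∧ LocallyIntegrable w volume

/-- `w(s) = ∫_s w`. -/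
def wInt (w : Rn n → ℝ) (s : Set (Rn n)) : ℝ≥0∞ :=
  ∫⁻ x in s, ENNReal.ofReal (w x)

/-- The measure `w·dx`. -/
def wMeasure (w : Rn n → ℝ) : Measure (Rn n) :=
  volume.withDensity fun x => ENNReal.ofReal (w x)

/-- The Muckenhoupt `A_p` characteristic `[w]_{A_p}`. -/
def ApConst (n : ℕ) (p : ℝ) (w : Rn n → ℝ) : ℝ≥0∞ :=
  ⨆ Q : Cube n,
    avgE Q.toSet (fun x => ENNReal.ofReal (w x)) *
      (avgE Q.toSet fun x => ENNReal.ofReal (w x ^ (1 - p / (p - 1)))) ^ (p - 1)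

/-- The Fujii–Wilson `A_∞` characteristic `[w]_{A_∞}`. -/
def AinftyConst (n : ℕ) (w : Rn n → ℝ) : ℝ≥0∞ :=
  ⨆ Q : Cube n,
    (wInt w Q.toSet)⁻¹ *
      ∫⁻ x in Q.toSet, hlMax (fun y => ENNReal.ofReal (Set.indicator Q.toSet w y)) x

/-- The weighted dyadic maximal operator `M^D_w`. -/
def dyadicMaxW (D : Set (Cube n)) (w : Rn n → ℝ) (f : Rn n → ℝ≥0∞) (x : Rn n) : ℝ≥0∞ :=
  ⨆ (Q : Cube n) (_ : Q ∈ D) (_ : x ∈ Q.toSet),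
    (wInt w Q.toSet)⁻¹ * ∫⁻ y in Q.toSet, f y * ENNReal.ofReal (w y)

/-- A Calderón–Zygmund operator `T` with standard kernel `K` (constant `c`, smoothness `δ`). -/
structure IsCZO (n : ℕ) (T : (Rn n → ℝ) → Rn n → ℝ)
    (K : Rn n → Rn n → ℝ) (c δ : ℝ) : Prop where
  c_pos : 0 < c
  delta_pos : 0 < δ
  delta_le_one : δ ≤ 1
  size : ∀ x y, x ≠ y → |K x y| ≤ c / dist x y ^ n
  smooth : ∀ x x' y : Rn n, x ≠ y → dist x x' ≤ dist x y / 2 →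
    |K x y - K x' y| + |K y x - K y x'| ≤ c * dist x x' ^ δ / dist x y ^ ((n : ℝ) + δ)
  linear : IsLinearMap ℝ T
  l2_bounded : ∃ A : ℝ≥0∞, A ≠ ⊤ ∧ ∀ f, eLpNorm (T f) 2 volume ≤ A * eLpNorm f 2 volume
  repr : ∀ f : Rn n → ℝ, Integrable f volume → ∀ x ∉ tsupport f, T f x = ∫ y, K x y * f y

/-- The maximal truncated operator `T**` associated with a kernel `K`. -/
def maxTrunc (K : Rn n → Rn n → ℝ) (f : Rn n → ℝ) (x : Rn n) : ℝ :=
  ⨆ e : {e : ℝ × ℝ // 0 < e.1 ∧ e.1 < e.2},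
    |∫ y in {y | e.1.1 < dist x y ∧ dist x y < e.1.2}, K x y * f y|

/-- The `L¹ → L^{1,∞}` operator (quasi-)norm `sup {λ·|{|Uf|>λ}| : λ>0, ‖f‖₁ ≤ 1}`. -/
def weakNorm11 (U : (Rn n → ℝ) → Rn n → ℝ) : ℝ≥0∞ :=
  ⨆ (f : Rn n → ℝ) (_ : eLpNorm f 1 volume ≤ 1) (l : {l : ℝ // 0 < l}),
    ENNReal.ofReal l.1 * volume {x | l.1 < |U f x|}

/-- A Banach function space over `(ℝⁿ, dx)` (rearrangement invariance not required),
described by its function norm `ρ` acting on nonnegative (`ℝ≥0∞`-valued) functions. -/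
structure BFS (n : ℕ) where
  ρ : (Rn n → ℝ≥0∞) → ℝ≥0∞
  zero_iff : ∀ f, ρ f = 0 ↔ f =ᵐ[volume] 0
  add_le : ∀ f g, ρ (fun x => f x + g x) ≤ ρ f + ρ g
  smul_eq : ∀ (a : ℝ≥0) (f), ρ (fun x => (a : ℝ≥0∞) * f x) = a * ρ f
  mono : ∀ f g, f ≤ᵐ[volume] g → ρ f ≤ ρ g
  fatou : ∀ f : ℕ → Rn n → ℝ≥0∞, Monotone f → ρ (fun x => ⨆ k, f k x) = ⨆ k, ρ (f k)
  indicator_lt_top : ∀ E : Set (Rn n), MeasurableSet E → volume E < ⊤ → ρ (E.indicator 1) < ⊤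
  setIntegral_le : ∀ E : Set (Rn n), MeasurableSet E → volume E < ⊤ →
    ∃ C : ℝ≥0∞, C ≠ ⊤ ∧ ∀ f, ∫⁻ x in E, f x ≤ C * ρ f

/-- The decreasing rearrangement of `f` with respect to the measure `μ`. -/
def rearr {α : Type*} [MeasurableSpace α] (μ : Measure α) (f : α → ℝ≥0∞) (t : ℝ) : ℝ≥0∞ :=
  sInf {l : ℝ≥0∞ | μ {x | l < f x} ≤ ENNReal.ofReal t}

/-- Lebesgue measure on `(0,∞)`. -/
def lebPos : Measure ℝ := volume.restrict (Set.Ioi 0)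

/-- A rearrangement invariant quasi-Banach function space, given (via the Luxemburg
representation) by its function quasi-norm `ρ` over `(ℝ⁺, dt)`; the (weighted) norm of a
function on `ℝⁿ` is `ρ` applied to its decreasing rearrangement. -/
structure RIQBFS where
  ρ : (ℝ → ℝ≥0∞) → ℝ≥0∞
  quasi_triangle : ∃ Cq : ℝ≥0∞, 1 ≤ Cq ∧ Cq ≠ ⊤ ∧
    ∀ f g, ρ (fun t => f t + g t) ≤ Cq * (ρ f + ρ g)
  smul_eq : ∀ (a : ℝ≥0) (f), ρ (fun t => (a : ℝ≥0∞) * f t) = a * ρ f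
  zero_iff : ∀ f, ρ f = 0 ↔ f =ᵐ[lebPos] 0
  mono : ∀ f g, f ≤ᵐ[lebPos] g → ρ f ≤ ρ g
  fatou : ∀ f : ℕ → ℝ → ℝ≥0∞, Monotone f → ρ (fun t => ⨆ k, f k t) = ⨆ k, ρ (f k)
  rearr_invariant : ∀ f g,
    (∀ l : ℝ≥0∞, lebPos {t | l < f t} = lebPos {t | l < g t}) → ρ f = ρ g

namespace RIQBFS

/-- The norm of `X(w)`: `‖f‖_{X(w)} = ρ(f*_w)`. -/
def normW (X : RIQBFS) {n : ℕ} (w : Rn n → ℝ) (f : Rn n → ℝ≥0∞) : ℝ≥0∞ :=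
  X.ρ (rearr (wMeasure w) f)

/-- The (unweighted) norm of `X`: `‖f‖_X = ρ(f*)`. -/
def normV (X : RIQBFS) {n : ℕ} (f : Rn n → ℝ≥0∞) : ℝ≥0∞ :=
  X.ρ (rearr (volume : Measure (Rn n)) f)

/-- `h_X(t)`: the operator norm of the dilation `D_t f(s) = f(s/t)` on `X̄`. -/
def dilNorm (X : RIQBFS) (t : ℝ) : ℝ≥0∞ :=
  ⨆ (f : ℝ → ℝ≥0∞) (_ : X.ρ f ≤ 1), X.ρ fun s => f (s / t)

/-- The lower Boyd index `p_X = sup_{1<t<∞} log t / log h_X(t)`. -/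
def boydLower (X : RIQBFS) : ℝ :=
  ⨆ t : {t : ℝ // 1 < t}, Real.log t.1 / Real.log (X.dilNorm t.1).toReal

/-- The upper Boyd index `q_X = inf_{0<t<1} log t / log h_X(t)`. -/
def boydUpper (X : RIQBFS) : ℝ :=
  ⨅ t : {t : ℝ // 0 < t ∧ t < 1}, Real.log t.1 / Real.log (X.dilNorm t.1).toReal

/-- `p`-convexity of `X` (as a space of functions on `ℝⁿ`). -/
def pConvex (X : RIQBFS) (n : ℕ) (p : ℝ) : Prop :=
  ∃ C : ℝ≥0∞, C ≠ ⊤ ∧ ∀ (N : ℕ) (f : Fin N → Rn n → ℝ≥0∞),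
    X.normV (fun x : Rn n => (∑ j, f j x ^ p) ^ (1 / p)) ≤
      C * (∑ j, X.normV (f j) ^ p) ^ (1 / p)

end RIQBFS

/-- A rearrangement invariant Banach function space: an RIQBFS whose quasi-norm is an actual
norm satisfying the Banach function space axioms. -/
structure RIBFS extends RIQBFS where
  add_le : ∀ f g, ρ (fun t => f t + g t) ≤ ρ f + ρ g
  indicator_lt_top : ∀ E : Set ℝ, MeasurableSet E → lebPos E < ⊤ → ρ (E.indicator 1) < ⊤
  setIntegral_le : ∀ E : Set ℝ, MeasurableSet E → lebPos E < ⊤ →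
    ∃ C : ℝ≥0∞, C ≠ ⊤ ∧ ∀ f, ∫⁻ t in E, f t ∂lebPos ≤ C * ρ f

/-- The class `Φ`: nonnegative increasing functions on `[0,∞)` with `φ(0⁺)=0`, `φ(∞)=∞`. -/
def PhiClass (φ : ℝ → ℝ) : Prop :=
  (∀ ⦃s t : ℝ⦄, 0 ≤ s → s ≤ t → φ s ≤ φ t) ∧ (∀ t, 0 ≤ t → 0 ≤ φ t) ∧
  Tendsto φ (nhdsWithin 0 (Set.Ioi 0)) (nhds 0) ∧ Tendsto φ atTop atTop

/-- Quasi-convexity: `ψ(t) ≤ φ(t) ≤ a·ψ(a·t)` for some convex `ψ` and `a ≥ 1`. -/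
def QuasiConvexPhi (φ : ℝ → ℝ) : Prop :=
  ∃ (ψ : ℝ → ℝ) (a : ℝ), 1 ≤ a ∧ ConvexOn ℝ (Set.Ici 0) ψ ∧
    ∀ t, 0 ≤ t → ψ t ≤ φ t ∧ φ t ≤ a * ψ (a * t)

/-- `h_φ(t) = sup_{s>0} φ(st)/φ(s)`. -/
def hphi (φ : ℝ → ℝ) (t : ℝ) : ℝ :=
  ⨆ s : {s : ℝ // 0 < s}, φ (s.1 * t) / φ s.1

/-- The lower dilation index `i_φ = sup_{0<t<1} log h_φ(t)/log t`. -/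
def iphi (φ : ℝ → ℝ) : ℝ :=
  ⨆ t : {t : ℝ // 0 < t ∧ t < 1}, Real.log (hphi φ t.1) / Real.log t.1

/-- The upper dilation index `I_φ = inf_{1<t} log h_φ(t)/log t`. -/
def IphiUpper (φ : ℝ → ℝ) : ℝ :=
  ⨅ t : {t : ℝ // 1 < t}, Real.log (hphi φ t.1) / Real.log t.1

/-- An `N`-function. -/
def IsNFunction (φ : ℝ → ℝ) : Prop :=
  ConvexOn ℝ (Set.Ici 0) φ ∧ (∀ ⦃s t : ℝ⦄, 0 ≤ s → s ≤ t → φ s ≤ φ t) ∧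
  (∀ t, 0 ≤ t → 0 ≤ φ t) ∧ φ 0 = 0 ∧
  Tendsto (fun t => φ t / t) (nhdsWithin 0 (Set.Ioi 0)) (nhds 0) ∧
  Tendsto (fun t => φ t / t) atTop atTop

/-- The complementary (Young conjugate) function `φ̄(s) = sup_{t>0} (st − φ(t))`. -/
def complementary (φ : ℝ → ℝ) (s : ℝ) : ℝ :=
  ⨆ t : {t : ℝ // 0 < t}, (s * t.1 - φ t.1)

/-- The modular `ρ_w^φ(g) = ∫ φ(g(x)) w(x) dx` for a nonnegative (`ℝ≥0∞`-valued) `g`. -/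
def modularE (φ : ℝ → ℝ) (w : Rn n → ℝ) (g : Rn n → ℝ≥0∞) : ℝ≥0∞ :=
  ∫⁻ x, ENNReal.ofReal (φ (g x).toReal) * ENNReal.ofReal (w x)

end SparseCZ

namespace SparseCZ
variable {n : ℕ}

/-! ### Section A: dyadic grids -/

/-- The cube of sidelength `2^k` containing `x` in the grid with shift `α`. -/
def gc (α : Fin n → ℝ) (k : ℤ) (x : Rn n) : Cube n where
  corner := fun i => 2 ^ k * ((⌊x i / 2 ^ k - (-1) ^ k * α i⌋ : ℝ) + (-1) ^ k * α i)
  side := 2 ^ k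
  side_pos := by positivity

theorem gc_side (α : Fin n → ℝ) (k : ℤ) (x : Rn n) : (gc α k x).side = 2 ^ k := rfl

theorem mem_gc_iff (α : Fin n → ℝ) (k : ℤ) (x y : Rn n) :
    y ∈ (gc α k x).toSet ↔
      ∀ i, ⌊y i / 2 ^ k - (-1) ^ k * α i⌋ = ⌊x i / 2 ^ k - (-1) ^ k * α i⌋ := by
  have h2 : (0 : ℝ) < 2 ^ k := by positivity
  simp only [Cube.toSet, gc, mem_ofPred_eq]
  refine forall_congr' fun i => ?_
  rw [Int.floor_eq_iff]
  have e : y i = 2 ^ k * (y i / 2 ^ k) := by field_simp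
  constructor
  · rintro ⟨h, h'⟩
    have h1 := (div_le_div_iff_of_pos_right h2).2 h
    have h3 := (div_lt_div_iff_of_pos_right h2).2 h'
    rw [mul_div_cancel_left₀ _ h2.ne'] at h1
    rw [add_div, mul_div_cancel_left₀ _ h2.ne', div_self h2.ne'] at h3
    constructor <;> linarith
  · rintro ⟨h, h'⟩
    constructor
    · rw [e]; exact mul_le_mul_of_nonneg_left (by linarith) h2.le
    · calc y i = 2 ^ k * (y i / 2 ^ k) := e
        _ < 2 ^ k * ((⌊x i / 2 ^ k - (-1) ^ k * α i⌋ : ℝ) + (-1) ^ k * α i + 1) :=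
          mul_lt_mul_of_pos_left (by linarith) h2
        _ = _ := by ring

theorem mem_gc (α : Fin n → ℝ) (k : ℤ) (x : Rn n) : x ∈ (gc α k x).toSet :=
  (mem_gc_iff _ _ _ _).2 fun _ => rfl

theorem gc_eq_of_mem {α : Fin n → ℝ} {k : ℤ} {x y : Rn n} (h : y ∈ (gc α k x).toSet) :
    gc α k y = gc α k x := by
  have := (mem_gc_iff _ _ _ _).1 h
  simp only [gc, this]

/-- admissible shifts -/
def Adm (α : Fin n → ℝ) : Prop := ∀ i, ∃ m : ℤ, 3 * α i = m

theorem gc_subset_succ {α : Fin n → ℝ} (hα : Adm α) (k : ℤ) (x : Rn n) :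
    (gc α k x).toSet ⊆ (gc α (k + 1) x).toSet := by
  intro y hy
  rw [mem_gc_iff] at hy ⊢
  intro i
  obtain ⟨m, hm⟩ := hα i
  have h2 : (0 : ℝ) < 2 ^ k := by positivity
  obtain ⟨m', hm'⟩ : ∃ m' : ℤ, (-1 : ℝ) ^ k * (3 * α i) = m' := by
    rcases Int.even_or_odd k with h | h
    · exact ⟨m, by rw [h.neg_one_zpow, one_mul, hm]⟩
    · exact ⟨-m, by rw [h.neg_one_zpow, hm]; push_cast; ring⟩
  have key : ∀ z : ℝ, ⌊z / 2 ^ (k + 1) - (-1) ^ (k + 1) * α i⌋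
      = (⌊z / 2 ^ k - (-1) ^ k * α i⌋ + m') / 2 := by
    intro z
    have : z / 2 ^ (k + 1) - (-1) ^ (k + 1) * α i
        = ((z / 2 ^ k - (-1) ^ k * α i) + (m' : ℤ)) / (2 : ℕ) := by
      rw [← hm', zpow_add_one₀ (by norm_num), zpow_add_one₀ (by norm_num)]
      push_cast
      field_simp
      ring
    rw [this, Int.floor_div_natCast, Int.floor_add_intCast]
    norm_num
  rw [key, key, hy i]

theorem gc_subset {α : Fin n → ℝ} (hα : Adm α) {k k' : ℤ} (h : k ≤ k') (x : Rn n) :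
    (gc α k x).toSet ⊆ (gc α k' x).toSet := by
  induction k', h using Int.leInduction with
  | base => exact Subset.rfl
  | succ m _ ih => exact ih.trans (gc_subset_succ hα m x)

/-- the grid -/
def grid (α : Fin n → ℝ) : Set (Cube n) := {Q | ∃ k x, Q = gc α k x}

theorem two_zpow_inj {k k' : ℤ} (h : (2 : ℝ) ^ k = 2 ^ k') : k = k' :=
  zpow_right_injective₀ (by norm_num) (by norm_num) h

theorem grid_eq {α : Fin n → ℝ} {Q : Cube n} (hQ : Q ∈ grid α) {k : ℤ} (hk : Q.side = 2 ^ k)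
    {x : Rn n} (hx : x ∈ Q.toSet) : Q = gc α k x := by
  obtain ⟨k', z, rfl⟩ := hQ
  obtain rfl := two_zpow_inj hk
  exact (gc_eq_of_mem hx).symm

theorem grid_nested {α : Fin n → ℝ} (hα : Adm α) {Q R : Cube n} (hQ : Q ∈ grid α)
    (hR : R ∈ grid α) (hs : Q.side ≤ R.side) {x : Rn n} (hx : x ∈ Q.toSet) (hx' : x ∈ R.toSet) :
    Q.toSet ⊆ R.toSet := by
  obtain ⟨k, z, rfl⟩ := hQ
  obtain ⟨k', z', rfl⟩ := hR
  rw [← gc_eq_of_mem hx, ← gc_eq_of_mem hx']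
  exact gc_subset hα ((zpow_le_zpow_iff_right₀ (by norm_num : (1:ℝ) < 2)).1 hs) x

theorem isDyadicGrid_grid {α : Fin n → ℝ} (hα : Adm α) : IsDyadicGrid (grid α) := by
  refine ⟨?_, ?_, ?_⟩
  · rintro Q ⟨k, x, rfl⟩; exact ⟨k, rfl⟩
  · intro Q hQ R hR
    rcases eq_empty_or_nonempty (Q.toSet ∩ R.toSet) with h | ⟨x, hx, hx'⟩
    · exact Or.inr (Or.inr h)
    · rcases le_total Q.side R.side with h | h
      · exact Or.inl (inter_eq_left.2 (grid_nested hα hQ hR h hx hx'))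
      · exact Or.inr (Or.inl (inter_eq_right.2 (grid_nested hα hR hQ h hx' hx)))
  · intro k x
    refine ⟨gc α k x, ⟨⟨k, x, rfl⟩, rfl, mem_gc _ _ _⟩, ?_⟩
    rintro Q ⟨hQ, hs, hx⟩
    exact grid_eq hQ hs hx

theorem toSet_eq_pre (Q : Cube n) :
    Q.toSet = (MeasurableEquiv.toLp 2 (Fin n → ℝ)).symm ⁻¹'
      (Set.pi univ fun i => Ico (Q.corner i) (Q.corner i + Q.side)) := by
  ext x; simp [Cube.toSet]

theorem Cube.measurableSet (Q : Cube n) : MeasurableSet Q.toSet := by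
  rw [toSet_eq_pre]
  exact (MeasurableEquiv.measurable _) (MeasurableSet.univ_pi fun i => measurableSet_Ico)

theorem Cube.volume_eq (Q : Cube n) : volume Q.toSet = ENNReal.ofReal (Q.side ^ n) := by
  rw [toSet_eq_pre, (EuclideanSpace.volume_preserving_symm_measurableEquiv_toLp
    (Fin n)).measure_preimage (MeasurableSet.univ_pi fun i => measurableSet_Ico).nullMeasurableSet,
    Real.volume_pi_Ico]
  simp [ENNReal.ofReal_pow Q.side_pos.le]

theorem dist_le_of_coord {x y : Rn n} {s : ℝ} (hs : 0 ≤ s) (h : ∀ i, |x i - y i| ≤ s) :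
    dist x y ≤ n * s := by
  rw [EuclideanSpace.dist_eq]
  refine Real.sqrt_le_iff.2 ⟨by positivity, ?_⟩
  calc ∑ i, dist (x i) (y i) ^ 2 ≤ ∑ i : Fin n, s ^ 2 := by
        refine Finset.sum_le_sum fun i _ => ?_
        rw [Real.dist_eq]; gcongr; exact h i
    _ = n * s ^ 2 := by simp
    _ ≤ (n * s) ^ 2 := by
        rw [mul_pow]; gcongr
        rcases Nat.eq_zero_or_pos n with h | h
        · simp [h]
        · have : (1 : ℝ) ≤ n := by exact_mod_cast h
          nlinarith

theorem Cube.dist_le (Q : Cube n) {x y : Rn n} (hx : x ∈ Q.toSet) (hy : y ∈ Q.toSet) :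
    dist x y ≤ n * Q.side := by
  refine dist_le_of_coord Q.side_pos.le fun i => ?_
  have := hx i; have := hy i
  rw [abs_le]; constructor <;> linarith

/-- the corner as a point of `Rn n`. -/
def Cube.pt (Q : Cube n) : Rn n := WithLp.toLp 2 Q.corner

theorem Cube.pt_mem (Q : Cube n) : Q.pt ∈ Q.toSet := by
  intro i; simp [Cube.pt, Q.side_pos]

/-- shift from Booleans -/
def shiftB (a : Fin n → Bool) : Fin n → ℝ := fun i => if a i then 1 / 3 else 0

theorem adm_shiftB (a : Fin n → Bool) : Adm (shiftB a) := by
  intro i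
  by_cases h : a i
  · exact ⟨1, by simp [shiftB, h]⟩
  · exact ⟨0, by simp [shiftB, h]⟩

theorem coord_le_dist (x y : Rn n) (i : Fin n) : |x i - y i| ≤ dist x y := by
  have := PiLp.norm_apply_le (x - y) i
  rw [dist_eq_norm]; simpa using this

theorem third_one (t s : ℝ) (hs : s = 1 ∨ s = -1) : ∃ b : Bool, ∀ u : ℝ, |u - t| < 1 / 6 →
    ⌊u - s * (if b then 1 / 3 else 0)⌋ = ⌊t - s * (if b then 1 / 3 else 0)⌋ := by
  by_cases h : ∀ u : ℝ, |u - t| < 1 / 6 → ⌊u⌋ = ⌊t⌋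
  · exact ⟨false, by simpa using h⟩
  · refine ⟨true, ?_⟩
    -- there is an integer m within 1/6 of t
    push Not at h
    obtain ⟨u, hu, hne⟩ := h
    obtain ⟨m, hm⟩ : ∃ m : ℤ, |t - m| < 1 / 6 := by
      rw [abs_lt] at hu
      rcases lt_or_gt_of_ne hne with h | h
      · refine ⟨⌊t⌋, ?_⟩
        have h1 : u < ⌊t⌋ := Int.floor_lt.1 h
        have h2 := Int.floor_le t
        rw [abs_lt]; constructor <;> linarith
      · refine ⟨⌊u⌋, ?_⟩
        have h1 : t < ⌊u⌋ := Int.floor_lt.1 h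
        have h2 := Int.floor_le u
        rw [abs_lt]; constructor <;> linarith
    intro v hv
    rw [abs_lt] at hv hm
    rcases hs with rfl | rfl
    · have e : ∀ w : ℝ, |w - m| < 1 / 3 → ⌊w - 1 * (if true then 1 / 3 else 0)⌋ = m - 1 := by
        intro w hw
        rw [abs_lt] at hw
        rw [Int.floor_eq_iff]; push_cast; simp; constructor <;> linarith
      rw [e v (by rw [abs_lt]; constructor <;> linarith), e t (by rw [abs_lt]; constructor <;> linarith)]
    · have e : ∀ w : ℝ, |w - m| < 1 / 3 → ⌊w - (-1) * (if true then 1 / 3 else 0)⌋ = m := by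
        intro w hw
        rw [abs_lt] at hw
        rw [Int.floor_eq_iff]; simp; constructor <;> linarith
      rw [e v (by rw [abs_lt]; constructor <;> linarith), e t (by rw [abs_lt]; constructor <;> linarith)]

theorem one_third (k : ℤ) (x : Rn n) : ∃ a : Fin n → Bool, ∀ y, dist x y < 2 ^ k / 6 →
    y ∈ (gc (shiftB a) k x).toSet := by
  have h2 : (0 : ℝ) < 2 ^ k := by positivity
  have hs : (-1 : ℝ) ^ k = 1 ∨ (-1 : ℝ) ^ k = -1 := by
    rcases Int.even_or_odd k with h | h
    · exact Or.inl h.neg_one_zpow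
    · exact Or.inr h.neg_one_zpow
  choose a ha using fun i : Fin n => third_one (x i / 2 ^ k) ((-1) ^ k) hs
  refine ⟨a, fun y hy => (mem_gc_iff _ _ _ _).2 fun i => ?_⟩
  refine ha i _ ?_
  rw [← sub_div, abs_div, abs_of_pos h2, div_lt_iff₀ h2]
  have := coord_le_dist x y i
  rw [abs_sub_comm] at this
  linarith

theorem finite_gc (α : Fin n → ℝ) (k : ℤ) (R : ℝ) :
    {Q : Cube n | ∃ x : Rn n, ‖x‖ ≤ R ∧ Q = gc α k x}.Finite := by
  let F : (Fin n → ℤ) → Cube n := fun m =>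
    { corner := fun i => 2 ^ k * ((m i : ℝ) + (-1) ^ k * α i)
      side := 2 ^ k
      side_pos := by positivity }
  have h2 : (0 : ℝ) < 2 ^ k := by positivity
  let lo : Fin n → ℤ := fun i => ⌊-R / 2 ^ k - (-1) ^ k * α i⌋
  let hi : Fin n → ℤ := fun i => ⌊R / 2 ^ k - (-1) ^ k * α i⌋
  refine ((Set.finite_Icc lo hi).image F).subset ?_
  rintro Q ⟨x, hx, rfl⟩
  refine ⟨fun i => ⌊x i / 2 ^ k - (-1) ^ k * α i⌋, ?_, rfl⟩
  have hxi : ∀ i, |x i| ≤ R := fun i => (by simpa using (PiLp.norm_apply_le x i).trans hx)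
  constructor
  · intro i
    refine Int.floor_le_floor ?_
    have := (abs_le.1 (hxi i)).1
    gcongr
  · intro i
    refine Int.floor_le_floor ?_
    have := (abs_le.1 (hxi i)).2
    gcongr

/-- the base shift -/
def a0 : Fin n → ℝ := shiftB fun _ => true

theorem adm_a0 : Adm (a0 : Fin n → ℝ) := adm_shiftB _

theorem ball_subset_gc_a0 (k : ℤ) (x : Rn n) (hx : ‖x‖ < 2 ^ k / 3) :
    x ∈ (gc a0 k (0 : Rn n)).toSet := by
  have h2 : (0 : ℝ) < 2 ^ k := by positivity
  rw [mem_gc_iff]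
  intro i
  have hxi : |x i| ≤ ‖x‖ := by simpa using (PiLp.norm_apply_le x i)
  have h3 : |x i / 2 ^ k| < 1 / 3 := by
    rw [abs_div, abs_of_pos h2, div_lt_iff₀ h2]; linarith
  rw [abs_lt] at h3
  rcases Int.even_or_odd k with h | h
  · rw [h.neg_one_zpow]
    have e : ∀ w : ℝ, |w| < 1 / 3 → ⌊w - 1 * a0 i⌋ = -1 := by
      intro w hw
      rw [abs_lt] at hw
      rw [Int.floor_eq_iff]; simp [a0, shiftB]; constructor <;> linarith
    rw [e _ (abs_lt.2 h3), e _ (by simp)]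
  · rw [h.neg_one_zpow]
    have e : ∀ w : ℝ, |w| < 1 / 3 → ⌊w - (-1) * a0 i⌋ = 0 := by
      intro w hw
      rw [abs_lt] at hw
      rw [Int.floor_eq_iff]; simp [a0, shiftB]; constructor <;> linarith
    rw [e _ (abs_lt.2 h3), e _ (by simp)]

end SparseCZ

namespace SparseCZ
variable {n : ℕ}

/-! ### Section B: splitting a Carleson family into sparse families -/

open Classical in
/-- depth of a cube in a finite family -/
def depth (G : Finset (Cube n)) (R : Cube n) : ℕ := (G.filter fun R' => R.toSet ⊂ R'.toSet).card

/-- depth class -/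
def cls (G : Finset (Cube n)) (N i : ℕ) : Set (Cube n) := {R | R ∈ G ∧ depth G R % N = i}

theorem depth_gap {α : Fin n → ℝ} (hα : Adm α) {G : Finset (Cube n)} (hG : ∀ R ∈ G, R ∈ grid α)
    {N i : ℕ} {P Q : Cube n} (hP : P ∈ cls G N i) (hQ : Q ∈ cls G N i) (h : P.toSet ⊂ Q.toSet)
    {x : Rn n} (hx : x ∈ P.toSet) [DecidablePred fun R : Cube n => R.toSet ⊆ Q.toSet ∧ x ∈ R.toSet] :
    N ≤ (G.filter fun R => R.toSet ⊆ Q.toSet ∧ x ∈ R.toSet).card := by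
  classical
  set A := G.filter fun R' => P.toSet ⊂ R'.toSet with hA
  set B := G.filter fun R' => Q.toSet ⊂ R'.toSet with hB
  have hBA : B ⊆ A := by
    intro R hR
    simp only [hA, hB, Finset.mem_filter] at hR ⊢
    exact ⟨hR.1, h.trans hR.2⟩
  have h1 : (A \ B).card = depth G P - depth G Q := by
    rw [Finset.card_sdiff_of_subset hBA]; rfl
  have h2 : 0 < (A \ B).card := by
    refine Finset.card_pos.2 ⟨Q, ?_⟩
    simp [hA, hB, h, hQ.1]
  have h3 : N ∣ depth G P - depth G Q := by
    refine (Nat.modEq_iff_dvd' (by omega)).1 ?_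
    rw [Nat.ModEq, hP.2, hQ.2]
  have h4 : N ≤ (A \ B).card := by
    rw [h1]; exact Nat.le_of_dvd (by omega) h3
  refine h4.trans (Finset.card_le_card ?_)
  intro R hR
  simp only [hA, hB, Finset.mem_sdiff, Finset.mem_filter, not_and] at hR ⊢
  refine ⟨hR.1.1, ?_, hR.1.2.subset hx⟩
  have hn := hR.2 hR.1.1
  rcases le_total R.side Q.side with hs | hs
  · exact grid_nested hα (hG _ hR.1.1) (hG _ hQ.1) hs (hR.1.2.subset hx) (h.subset hx)
  · have := grid_nested hα (hG _ hQ.1) (hG _ hR.1.1) hs (h.subset hx) (hR.1.2.subset hx)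
    by_contra hc
    exact hn ⟨this, hc⟩

open Classical in
theorem isSparse_cls {α : Fin n → ℝ} (hα : Adm α) {G : Finset (Cube n)}
    (hG : ∀ R ∈ G, R ∈ grid α) (L : ℕ) (hL : 0 < L)
    (hC : ∀ R ∈ G, ∑ R' ∈ G, (if R'.toSet ⊆ R.toSet then volume R'.toSet else 0)
      ≤ L * volume R.toSet) (i : ℕ) : IsSparse (cls G (2 * L) i) := by
  classical
  intro Q hQ
  set W : Rn n → ℝ≥0∞ := fun x => ∑ R ∈ G, if R.toSet ⊆ Q.toSet then R.toSet.indicator 1 x else 0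
    with hW
  have hWm : Measurable W := by
    refine Finset.measurable_sum _ fun R _ => ?_
    split_ifs
    · exact measurable_one.indicator R.measurableSet
    · exact measurable_const
  have hWint : ∫⁻ x, W x ≤ L * volume Q.toSet := by
    rw [hW, lintegral_finsetSum]
    · refine le_trans (Finset.sum_le_sum fun R _ => ?_) (hC Q hQ.1)
      split_ifs with h
      · rw [lintegral_indicator_one R.measurableSet]
      · simp
    · intro R _
      split_ifs
      · exact measurable_one.indicator R.measurableSet
      · exact measurable_const
  have hsub : (⋃ P ∈ {P | P ∈ cls G (2 * L) i ∧ P.toSet ⊂ Q.toSet}, Cube.toSet P) ⊆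
      {x | ((2 * L : ℕ) : ℝ≥0∞) ≤ W x} := by
    intro x hx
    simp only [mem_iUnion, mem_ofPred_eq, exists_prop] at hx
    obtain ⟨P, ⟨hP, hPQ⟩, hxP⟩ := hx
    have h := depth_gap hα hG hP hQ hPQ hxP
    have e : W x = ((G.filter fun R => R.toSet ⊆ Q.toSet ∧ x ∈ R.toSet).card : ℝ≥0∞) := by
      rw [hW, Finset.card_filter]
      push_cast
      refine Finset.sum_congr rfl fun R _ => ?_
      by_cases h1 : R.toSet ⊆ Q.toSet <;> by_cases h2 : x ∈ R.toSet <;> simp [h1, h2]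
    rw [mem_ofPred_eq, e]
    exact_mod_cast h
  have h1 := mul_meas_ge_le_lintegral (μ := volume) hWm ((2 * L : ℕ) : ℝ≥0∞)
  have h2 : ((2 * L : ℕ) : ℝ≥0∞) * volume
      (⋃ P ∈ {P | P ∈ cls G (2 * L) i ∧ P.toSet ⊂ Q.toSet}, Cube.toSet P) ≤ L * volume Q.toSet :=
    le_trans (by gcongr) (h1.trans hWint)
  have hL0 : (L : ℝ≥0∞) ≠ 0 := by simpa using hL.ne'
  push_cast at h2
  rw [mul_comm (2 : ℝ≥0∞), mul_assoc] at h2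
  rw [ENNReal.mul_le_mul_iff_right hL0 (by simp)] at h2
  rw [ENNReal.le_div_iff_mul_le (by simp) (by simp), mul_comm]
  exact h2

theorem sparseOp_finset (G : Finset (Cube n)) (f : Rn n → ℝ≥0∞) (x : Rn n) :
    sparseOp (↑G : Set (Cube n)) f x
      = ∑ Q ∈ G, Set.indicator (Q.toSet) (fun _ => avgE Q.toSet f) x := by
  rw [sparseOp]
  exact Finset.tsum_subtype G (fun Q => Set.indicator (Q.toSet) (fun _ => avgE Q.toSet f) x)

theorem sum_le_cls (G : Finset (Cube n)) (N : ℕ) (hN : 0 < N) (f : Rn n → ℝ≥0∞) (x : Rn n) :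
    ∑ Q ∈ G, Set.indicator (Q.toSet) (fun _ => avgE Q.toSet f) x
      ≤ ∑ i ∈ Finset.range N, sparseOp (cls G N i) f x := by
  classical
  have h : ∀ i, sparseOp (cls G N i) f x
      = ∑ Q ∈ G.filter (fun R => depth G R % N = i),
        Set.indicator (Q.toSet) (fun _ => avgE Q.toSet f) x := by
    intro i
    rw [← sparseOp_finset]
    congr 1
    ext R; simp [cls]
  simp_rw [h]
  refine le_of_eq (Finset.sum_fiberwise_of_maps_to ?_ _).symm
  intro R _
  simpa using Nat.mod_lt _ hN

end SparseCZ

namespace SparseCZ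
variable {n : ℕ}

/-! ### Section C: smoothly truncated kernels -/

/-- piecewise linear cutoff -/
def cut (t : ℝ) : ℝ := max 0 (min 1 t)

theorem cut_nonneg (t : ℝ) : 0 ≤ cut t := le_max_left _ _
theorem cut_le_one (t : ℝ) : cut t ≤ 1 := max_le zero_le_one (min_le_left _ _)
theorem cut_of_nonpos {t : ℝ} (h : t ≤ 0) : cut t = 0 := by
  rw [cut, min_eq_right (by linarith), max_eq_left h]
theorem cut_of_one_le {t : ℝ} (h : 1 ≤ t) : cut t = 1 := by
  rw [cut, min_eq_left h, max_eq_right zero_le_one]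
theorem cut_lip (s t : ℝ) : |cut s - cut t| ≤ |s - t| := by
  unfold cut
  have h1 := abs_max_sub_max_le_abs (min 1 s) (min 1 t) 0
  have h2 := abs_min_sub_min_le_max 1 s 1 t
  rw [max_comm 0, max_comm 0]
  refine h1.trans (h2.trans ?_)
  simp

/-- smooth truncation of a kernel at scale `ε` -/
def kt (K : Rn n → Rn n → ℝ) (ε : ℝ) (x y : Rn n) : ℝ := K x y * cut (dist x y / ε - 1)

/-- kernel estimates at scale `ε` -/
structure SK (n : ℕ) (k : Rn n → Rn n → ℝ) (B δ ε : ℝ) : Prop where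
  B_pos : 0 < B
  eps_pos : 0 < ε
  delta_pos : 0 < δ
  delta_le : δ ≤ 1
  size : ∀ x y, |k x y| ≤ B / (ε + dist x y) ^ n
  sm1 : ∀ x x' y, dist x x' ≤ (ε + dist x y) / 4 →
    |k x y - k x' y| ≤ B * dist x x' ^ δ / (ε + dist x y) ^ ((n : ℝ) + δ)
  sm2 : ∀ x x' y, dist x x' ≤ (ε + dist x y) / 4 →
    |k y x - k y x'| ≤ B * dist x x' ^ δ / (ε + dist x y) ^ ((n : ℝ) + δ)

/-- the constant -/
def BB (n : ℕ) (c : ℝ) : ℝ := 5 * 2 ^ n * c * 2 ^ (n + 1)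

theorem kt_smooth_aux {L : Rn n → Rn n → ℝ} {c δ ε : ℝ} (hc : 0 < c) (hδ : 0 < δ) (hδ1 : δ ≤ 1)
    (hε : 0 < ε) (hsize : ∀ x y, x ≠ y → |L x y| ≤ c / dist x y ^ n)
    (hsm : ∀ x x' y : Rn n, x ≠ y → dist x x' ≤ dist x y / 2 →
      |L x y - L x' y| ≤ c * dist x x' ^ δ / dist x y ^ ((n : ℝ) + δ))
    (x x' y : Rn n) (h : dist x x' ≤ (ε + dist x y) / 4) :
    |kt L ε x y - kt L ε x' y|
      ≤ BB n c * dist x x' ^ δ / (ε + dist x y) ^ ((n : ℝ) + δ) := by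
  set r := dist x y with hr
  set t := dist x x' with ht
  have ht0 : 0 ≤ t := dist_nonneg
  have hr0 : 0 ≤ r := dist_nonneg
  have hnδ : 0 ≤ (n : ℝ) + δ := by positivity
  -- comparison of denominators
  have hden : ∀ m : ℝ, 0 < m → ε + r ≤ 2 * m →
      1 / m ^ ((n : ℝ) + δ) ≤ 2 ^ (n + 1) / (ε + r) ^ ((n : ℝ) + δ) := by
    intro m hm hle
    rw [div_le_div_iff₀ (by positivity) (by positivity), one_mul]
    calc (ε + r) ^ ((n : ℝ) + δ) ≤ (2 * m) ^ ((n : ℝ) + δ) := by gcongr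
      _ = 2 ^ ((n : ℝ) + δ) * m ^ ((n : ℝ) + δ) := by rw [Real.mul_rpow (by norm_num) hm.le]
      _ ≤ 2 ^ ((n + 1 : ℕ) : ℝ) * m ^ ((n : ℝ) + δ) := by
          gcongr
          · norm_num
          · push_cast; linarith
      _ = _ := by rw [Real.rpow_natCast]
  have hsplit : ∀ m : ℝ, 0 < m → m ^ ((n : ℝ) + δ) = m ^ n * m ^ δ := by
    intro m hm; rw [Real.rpow_add hm, Real.rpow_natCast]
  have htri : dist x' y ≤ t + r := by rw [ht, hr, dist_comm x x']; exact dist_triangle _ _ _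
  have htri' : r ≤ t + dist x' y := dist_triangle _ _ _
  rcases lt_or_ge r ε with hlt | hge
  · -- first kernel vanishes
    have e1 : kt L ε x y = 0 := by
      rw [kt, cut_of_nonpos, mul_zero]
      rw [sub_nonpos, div_le_one hε]; exact hlt.le
    rw [e1, zero_sub, abs_neg]
    have hmain : |kt L ε x' y| ≤ c * t ^ δ * (1 / ε ^ ((n : ℝ) + δ)) := by
      rcases le_or_gt (dist x' y) ε with h1 | h1
      · have : kt L ε x' y = 0 := by
          rw [kt, cut_of_nonpos, mul_zero]
          rw [sub_nonpos, div_le_one hε]; exact h1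
        rw [this, abs_zero]; positivity
      · have hne : x' ≠ y := by
          intro h; rw [h, dist_self] at h1; linarith
        have hte : t / ε ≤ 1 := by rw [div_le_one hε]; linarith
        rw [kt, abs_mul, abs_of_nonneg (cut_nonneg _)]
        calc |L x' y| * cut (dist x' y / ε - 1) ≤ (c / ε ^ n) * (t / ε) ^ δ := by
              gcongr
              · exact cut_nonneg _
              · exact (hsize _ _ hne).trans (by gcongr)
              · calc cut (dist x' y / ε - 1) ≤ t / ε := by
                      have := cut_lip (dist x' y / ε - 1) (r / ε - 1)
                      rw [cut_of_nonpos (t := r / ε - 1) (by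
                        rw [sub_nonpos, div_le_one hε]; exact hlt.le), sub_zero,
                        abs_of_nonneg (cut_nonneg _)] at this
                      refine this.trans ?_
                      rw [show dist x' y / ε - 1 - (r / ε - 1) = (dist x' y - r) / ε by ring,
                        abs_div, abs_of_pos hε]
                      gcongr
                      rw [abs_le]; constructor <;> linarith
                  _ = (t / ε) ^ (1 : ℝ) := (Real.rpow_one _).symm
                  _ ≤ (t / ε) ^ δ := Real.rpow_le_rpow_of_exponent_ge' (by positivity) hte hδ.le hδ1
          _ = c * t ^ δ * (1 / ε ^ ((n : ℝ) + δ)) := by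
              rw [Real.div_rpow ht0 hε.le, hsplit ε hε]; field_simp
    calc |kt L ε x' y| ≤ c * t ^ δ * (1 / ε ^ ((n : ℝ) + δ)) := hmain
      _ ≤ c * t ^ δ * (2 ^ (n + 1) / (ε + r) ^ ((n : ℝ) + δ)) := by
          have := hden ε hε (by linarith)
          exact mul_le_mul_of_nonneg_left this (by positivity)
      _ = (c * 2 ^ (n + 1)) * t ^ δ / (ε + r) ^ ((n : ℝ) + δ) := by ring
      _ ≤ BB n c * t ^ δ / (ε + r) ^ ((n : ℝ) + δ) := by
          gcongr
          unfold BB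
          have : (1 : ℝ) ≤ 2 ^ n := one_le_pow₀ (by norm_num)
          gcongr
          nlinarith
  · have hr1 : 0 < r := by linarith
    have hxy : x ≠ y := by intro h; rw [hr, h, dist_self] at hr1; exact lt_irrefl _ hr1
    have ht2 : t ≤ r / 2 := by linarith
    have hr' : r / 2 ≤ dist x' y := by linarith
    have hne : x' ≠ y := by intro h; rw [h, dist_self] at hr'; linarith
    have htr : t / r ≤ 1 := by rw [div_le_one hr1]; linarith
    have e : kt L ε x y - kt L ε x' y = (L x y - L x' y) * cut (dist x y / ε - 1)
        + L x' y * (cut (dist x y / ε - 1) - cut (dist x' y / ε - 1)) := by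
      unfold kt; ring
    have h2 : |cut (dist x y / ε - 1) - cut (dist x' y / ε - 1)| ≤ 4 * (t / r) ^ δ := by
      rcases le_or_gt (4 * ε) r with h4 | h4
      · rw [cut_of_one_le, cut_of_one_le, sub_self, abs_zero]
        · positivity
        · rw [le_sub_iff_add_le, le_div_iff₀ hε]; linarith
        · rw [le_sub_iff_add_le, le_div_iff₀ hε]; linarith
      · calc |cut (dist x y / ε - 1) - cut (dist x' y / ε - 1)| ≤ t / ε := by
              refine (cut_lip _ _).trans ?_
              rw [show dist x y / ε - 1 - (dist x' y / ε - 1) = (dist x y - dist x' y) / ε by ring,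
                        abs_div, abs_of_pos hε]
              gcongr
              rw [abs_le]; constructor <;> linarith
          _ ≤ t / (r / 4) := by gcongr; linarith
          _ = 4 * (t / r) := by field_simp
          _ = 4 * (t / r) ^ (1 : ℝ) := by rw [Real.rpow_one]
          _ ≤ 4 * (t / r) ^ δ := by
              have := Real.rpow_le_rpow_of_exponent_ge' (by positivity) htr hδ.le hδ1
              exact mul_le_mul_of_nonneg_left this (by norm_num)
    have h3 : |L x' y| ≤ 2 ^ n * c / r ^ n := by
      refine (hsize _ _ hne).trans ?_
      calc c / dist x' y ^ n ≤ c / (r / 2) ^ n := by gcongr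
        _ = _ := by rw [div_pow]; field_simp
    calc |kt L ε x y - kt L ε x' y|
        ≤ |L x y - L x' y| * |cut (dist x y / ε - 1)|
          + |L x' y| * |cut (dist x y / ε - 1) - cut (dist x' y / ε - 1)| := by
          rw [e, ← abs_mul, ← abs_mul]; exact abs_add_le _ _
      _ ≤ (c * t ^ δ / r ^ ((n : ℝ) + δ)) * 1 + (2 ^ n * c / r ^ n) * (4 * (t / r) ^ δ) := by
          gcongr
          · exact hsm _ _ _ hxy ht2
          · rw [abs_of_nonneg (cut_nonneg _)]; exact cut_le_one _
      _ = (c + 4 * 2 ^ n * c) * t ^ δ * (1 / r ^ ((n : ℝ) + δ)) := by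
          rw [hsplit r hr1, Real.div_rpow ht0 hr0]; field_simp
      _ ≤ (5 * 2 ^ n * c) * t ^ δ * (2 ^ (n + 1) / (ε + r) ^ ((n : ℝ) + δ)) := by
          have h8 := hden r hr1 (by linarith)
          refine mul_le_mul ?_ h8 (by positivity) (by positivity)
          refine mul_le_mul_of_nonneg_right ?_ (by positivity)
          have : (1 : ℝ) ≤ 2 ^ n := one_le_pow₀ (by norm_num)
          nlinarith
      _ = _ := by unfold BB; ring

theorem sk_kt {T : (Rn n → ℝ) → Rn n → ℝ} {K : Rn n → Rn n → ℝ} {c δ : ℝ}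
    (hT : IsCZO n T K c δ) {ε : ℝ} (hε : 0 < ε) : SK n (kt K ε) (BB n c) δ ε := by
  have hc := hT.c_pos
  refine ⟨by unfold BB; positivity, hε, hT.delta_pos, hT.delta_le_one, ?_, ?_, ?_⟩
  · intro x y
    rcases le_or_gt (dist x y) ε with h | h
    · rw [kt, cut_of_nonpos (by rw [sub_nonpos, div_le_one hε]; exact h), mul_zero, abs_zero]
      unfold BB; positivity
    · have hne : x ≠ y := by intro h'; rw [h', dist_self] at h; linarith
      have hd : 0 < dist x y := dist_pos.2 hne
      rw [kt, abs_mul, abs_of_nonneg (cut_nonneg _)]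
      calc |K x y| * cut (dist x y / ε - 1) ≤ (c / dist x y ^ n) * 1 := by
            gcongr
            · exact cut_nonneg _
            · exact hT.size _ _ hne
            · exact cut_le_one _
        _ ≤ c / ((ε + dist x y) / 2) ^ n := by
            rw [mul_one]; gcongr; linarith
        _ = 2 ^ n * c / (ε + dist x y) ^ n := by rw [div_pow]; field_simp
        _ ≤ BB n c / (ε + dist x y) ^ n := by
            gcongr
            unfold BB
            have : (1 : ℝ) ≤ 2 ^ (n + 1) := one_le_pow₀ (by norm_num)
            have h3 : 0 < 2 ^ n * c := by positivity
            nlinarith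
  · refine kt_smooth_aux hc hT.delta_pos hT.delta_le_one hε hT.size fun x x' y h h' => ?_
    exact le_trans (le_add_of_nonneg_right (abs_nonneg _)) (hT.smooth x x' y h h')
  · intro x x' y h
    have := kt_smooth_aux (L := fun x y => K y x) hc hT.delta_pos hT.delta_le_one hε
      (fun x y h => by rw [dist_comm]; exact hT.size _ _ h.symm)
      (fun x x' y h h' => le_trans (le_add_of_nonneg_left (abs_nonneg _)) (hT.smooth x x' y h h'))
      x x' y h
    simpa [kt, dist_comm] using this

theorem kt_eq (K : Rn n → Rn n → ℝ) {ε : ℝ} (hε : 0 < ε) {x y : Rn n} (h : 2 * ε ≤ dist x y) :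
    kt K ε x y = K x y := by
  rw [kt, cut_of_one_le, mul_one]
  rw [le_sub_iff_add_le, le_div_iff₀ hε]; linarith

theorem SK.continuous {k : Rn n → Rn n → ℝ} {B δ ε : ℝ} (h : SK n k B δ ε) :
    Continuous (Function.uncurry k) := by
  have hε := h.eps_pos
  rw [continuous_iff_continuousAt]
  rintro ⟨x, y⟩
  set M := B / ε ^ ((n : ℝ) + δ) with hM
  have hbound : ∀ t d : ℝ, 0 ≤ t → 0 ≤ d →
      B * t ^ δ / (ε + d) ^ ((n : ℝ) + δ) ≤ M * t ^ δ := by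
    intro t d ht hd
    have := h.B_pos
    have := h.delta_pos
    rw [hM, div_mul_eq_mul_div]
    gcongr; linarith
  rw [ContinuousAt, tendsto_iff_dist_tendsto_zero]
  have hlim : Tendsto (fun p : Rn n × Rn n => M * dist x p.1 ^ δ + M * dist y p.2 ^ δ)
      (𝓝 (x, y)) (𝓝 0) := by
    have hc : Continuous (fun p : Rn n × Rn n => M * dist x p.1 ^ δ + M * dist y p.2 ^ δ) := by
      have h0 := h.delta_pos.le
      refine ((continuous_const.mul ?_)).add ((continuous_const.mul ?_))
      · exact (continuous_const.dist continuous_fst).rpow_const fun _ => Or.inr h0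
      · exact (continuous_const.dist continuous_snd).rpow_const fun _ => Or.inr h0
    have := hc.tendsto (x, y)
    simpa [Real.zero_rpow h.delta_pos.ne'] using this
  refine squeeze_zero' (Eventually.of_forall fun _ => dist_nonneg) ?_ hlim
  have hU : Metric.ball (x, y) (ε / 4) ∈ 𝓝 (x, y) := Metric.ball_mem_nhds _ (by linarith)
  filter_upwards [hU] with p hp
  rw [Metric.mem_ball, Prod.dist_eq, max_lt_iff] at hp
  have h1 := h.sm1 x p.1 p.2 (by rw [dist_comm]; have := dist_nonneg (x := x) (y := p.2); linarith [hp.1])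
  have h2 := h.sm2 y p.2 x (by rw [dist_comm]; have := dist_nonneg (x := y) (y := x); linarith [hp.2])
  have h1' := h1.trans (hbound _ _ dist_nonneg dist_nonneg)
  have h2' := h2.trans (hbound _ _ dist_nonneg dist_nonneg)
  simp only [Function.uncurry, Real.dist_eq]
  rw [abs_sub_comm]
  calc |k x y - k p.1 p.2| = |(k x p.2 - k p.1 p.2) + (k x y - k x p.2)| := by ring_nf
    _ ≤ _ := (abs_add_le _ _).trans (add_le_add h1' h2')

def UU (k : Rn n → Rn n → ℝ) (f : Rn n → ℝ) (x : Rn n) : ℝ := ∫ y, k x y * f y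

theorem SK.cont_right {k : Rn n → Rn n → ℝ} {B δ ε : ℝ} (h : SK n k B δ ε) (x : Rn n) :
    Continuous (k x) := h.continuous.comp (Continuous.prodMk_right x)

theorem SK.bdd {k : Rn n → Rn n → ℝ} {B δ ε : ℝ} (h : SK n k B δ ε) (x y : Rn n) :
    |k x y| ≤ B / ε ^ n := by
  have := h.B_pos; have := h.eps_pos
  refine (h.size x y).trans ?_
  gcongr
  have := dist_nonneg (x := x) (y := y)
  linarith

theorem SK.integrable {k : Rn n → Rn n → ℝ} {B δ ε : ℝ} (h : SK n k B δ ε) {f : Rn n → ℝ}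
    (hf : Integrable f volume) (x : Rn n) : Integrable (fun y => k x y * f y) volume :=
  hf.bdd_mul (h.cont_right x).aestronglyMeasurable
    (Eventually.of_forall fun y => by simpa using h.bdd x y)

theorem SK.measurable_UU {k : Rn n → Rn n → ℝ} {B δ ε : ℝ} (h : SK n k B δ ε) {f : Rn n → ℝ}
    (hf : Measurable f) : Measurable (UU k f) := by
  have : StronglyMeasurable (Function.uncurry fun x y => k x y * f y) :=
    (h.continuous.measurable.mul (hf.comp measurable_snd)).stronglyMeasurable
  exact this.integral_prod_right.measurable

theorem SK.UU_add {k : Rn n → Rn n → ℝ} {B δ ε : ℝ} (h : SK n k B δ ε) {f g : Rn n → ℝ}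
    (hf : Integrable f volume) (hg : Integrable g volume) (x : Rn n) :
    UU k (fun y => f y + g y) x = UU k f x + UU k g x := by
  rw [UU, UU, UU, ← integral_add (h.integrable hf x) (h.integrable hg x)]
  simp [mul_add]

end SparseCZ

namespace SparseCZ
variable {n : ℕ}

/-- level set of the maximal function -/
def Om (h : Rn n → ℝ≥0∞) (l : ℝ) : Set (Rn n) :=
  {x | ∃ r : ℝ, 0 < r ∧ ENNReal.ofReal (l * r ^ n) < ∫⁻ y in Metric.ball x r, h y}

/-- volume of the unit ball -/
def vb (n : ℕ) : ℝ := (volume (Metric.ball (0 : Rn n) 1)).toReal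

theorem vb_nonneg : 0 ≤ vb n := ENNReal.toReal_nonneg

theorem vol_ball (x : Rn n) {r : ℝ} (hr : 0 ≤ r) :
    volume (Metric.closedBall x r) = ENNReal.ofReal (vb n * r ^ n) := by
  rw [Measure.addHaar_closedBall _ _ hr, vb, mul_comm, ENNReal.ofReal_mul ENNReal.toReal_nonneg,
    ENNReal.ofReal_toReal measure_ball_lt_top.ne]
  simp

theorem weak_max (hn : 0 < n) (h : Rn n → ℝ≥0∞) (hfin : ∫⁻ y, h y ≠ ⊤) {l : ℝ} (hl : 0 < l) :
    volume (Om h l) ≤ ENNReal.ofReal (5 ^ n * vb n / l) * ∫⁻ y, h y := by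
  set I := ∫⁻ y, h y with hI
  have hch : ∀ x : Rn n, ∃ r : ℝ, x ∈ Om h l →
      0 < r ∧ ENNReal.ofReal (l * r ^ n) < ∫⁻ y in Metric.ball x r, h y := by
    intro x
    by_cases hx : x ∈ Om h l
    · obtain ⟨r, hr⟩ := hx; exact ⟨r, fun _ => hr⟩
    · exact ⟨0, fun h' => absurd h' hx⟩
  choose r hr using hch
  have hbd : ∀ a ∈ Om h l, r a ≤ max 1 (I.toReal / l) := by
    intro a ha
    obtain ⟨h1, h2⟩ := hr a ha
    rcases le_or_gt (r a) 1 with h3 | h3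
    · exact le_max_of_le_left h3
    · refine le_max_of_le_right ?_
      have h4 : ENNReal.ofReal (l * r a ^ n) < I := h2.trans_le (setLIntegral_le_lintegral _ _)
      have h5 : l * r a ^ n < I.toReal := (ENNReal.ofReal_lt_iff_lt_toReal (by positivity) hfin).1 h4
      rw [le_div_iff₀ hl]
      have : r a ≤ r a ^ n := le_self_pow₀ h3.le hn.ne'
      nlinarith
  obtain ⟨u, hut, hdisj, hcov⟩ := Vitali.exists_disjoint_subfamily_covering_enlargement_closedBall
    (Om h l) id r _ hbd 5 (by norm_num)
  have hcount : u.Countable := by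
    refine hdisj.countable_of_nonempty_interior ?_
    intro a ha
    exact ⟨a, interior_mono Metric.ball_subset_closedBall
      (by rw [Metric.isOpen_ball.interior_eq]; exact Metric.mem_ball_self (hr a (hut ha)).1)⟩
  have hsub : Om h l ⊆ ⋃ b ∈ u, Metric.closedBall b (5 * r b) := by
    intro a ha
    obtain ⟨b, hb, hab⟩ := hcov a ha
    simp only [mem_iUnion]
    exact ⟨b, hb, hab (Metric.mem_closedBall_self (hr a ha).1.le)⟩
  calc volume (Om h l) ≤ volume (⋃ b ∈ u, Metric.closedBall b (5 * r b)) := measure_mono hsub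
    _ ≤ ∑' b : u, volume (Metric.closedBall (b : Rn n) (5 * r b)) := measure_biUnion_le _ hcount _
    _ ≤ ∑' b : u, ENNReal.ofReal (5 ^ n * vb n / l) * ∫⁻ y in Metric.closedBall (b : Rn n) (r b), h y := by
        refine ENNReal.tsum_le_tsum fun b => ?_
        obtain ⟨h1, h2⟩ := hr b (hut b.2)
        rw [vol_ball _ (by positivity)]
        have : vb n * (5 * r b) ^ n = 5 ^ n * vb n / l * (l * r b ^ n) := by
          field_simp
          ring
        rw [this, ENNReal.ofReal_mul (by have := vb_nonneg (n := n); positivity)]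
        gcongr
        exact h2.le.trans (lintegral_mono_set Metric.ball_subset_closedBall)
    _ = ENNReal.ofReal (5 ^ n * vb n / l) * ∫⁻ y in ⋃ b ∈ u, Metric.closedBall b (r b), h y := by
        have hdisj2 : u.PairwiseDisjoint fun a => Metric.closedBall a (r a) := hdisj
        rw [ENNReal.tsum_mul_left, lintegral_biUnion hcount
          (fun _ _ => Metric.isClosed_closedBall.measurableSet) hdisj2]
    _ ≤ _ := by
        gcongr
        exact setLIntegral_le_lintegral _ _

/-- constant in the annuli estimate -/
def CD (n : ℕ) (δ : ℝ) : ℝ := (2 : ℝ) ^ ((n : ℝ) + δ) * (1 - (2 : ℝ) ^ (-δ))⁻¹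

theorem two_pow_lt {δ : ℝ} (hδ : 0 < δ) : (2 : ℝ) ^ (-δ) < 1 :=
  Real.rpow_lt_one_of_one_lt_of_neg one_lt_two (by linarith)

theorem CD_pos {δ : ℝ} (hδ : 0 < δ) : 0 < CD n δ := by
  have := two_pow_lt hδ
  unfold CD
  have : 0 < (1 - (2 : ℝ) ^ (-δ)) := by linarith
  positivity

theorem annuli {δ : ℝ} (hδ : 0 < δ) {s l : ℝ} (hs : 0 < s) (hl : 0 ≤ l) {h : Rn n → ℝ≥0∞}
    (hm : Measurable h) (x : Rn n)
    (hb : ∀ r : ℝ, 0 < r → ∫⁻ y in Metric.ball x r, h y ≤ ENNReal.ofReal (l * r ^ n)) :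
    ∫⁻ y, ENNReal.ofReal (s ^ δ / (s + dist x y) ^ ((n : ℝ) + δ)) * h y
      ≤ ENNReal.ofReal (CD n δ * l) := by
  set q := (2 : ℝ) ^ (-δ) with hq
  have hq0 : 0 < q := by positivity
  have hq1 : q < 1 := two_pow_lt hδ
  set ck : ℕ → ℝ := fun k => (2 : ℝ) ^ ((n : ℝ) + δ) * q ^ k / (2 ^ k * s) ^ n with hck
  have hpt : ∀ y, ENNReal.ofReal (s ^ δ / (s + dist x y) ^ ((n : ℝ) + δ)) * h y
      ≤ ∑' k : ℕ, ENNReal.ofReal (ck k) * (Metric.ball x (2 ^ k * s)).indicator h y := by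
    intro y
    have hex : ∃ k : ℕ, dist x y < 2 ^ k * s := by
      obtain ⟨k, hk⟩ := pow_unbounded_of_one_lt (dist x y / s) one_lt_two
      exact ⟨k, by rwa [div_lt_iff₀ hs] at hk⟩
    classical
    have hk := Nat.find_spec hex
    have hmin := fun m => Nat.find_min (m := m) hex
    set k := Nat.find hex
    refine le_trans ?_ (ENNReal.le_tsum k)
    rw [indicator_of_mem (by rwa [Metric.mem_ball, dist_comm])]
    gcongr
    have hd : 2 ^ k * s / 2 ≤ s + dist x y := by
      rcases Nat.eq_zero_or_pos k with h0 | h0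
      · rw [h0]; have := dist_nonneg (x := x) (y := y); linarith
      · have := hmin (k - 1) (by omega)
        push Not at this
        have h2 : (2 : ℝ) ^ k = 2 * 2 ^ (k - 1) := by
          rw [← pow_succ']; congr 1; omega
        rw [h2]; linarith
    calc s ^ δ / (s + dist x y) ^ ((n : ℝ) + δ) ≤ s ^ δ / (2 ^ k * s / 2) ^ ((n : ℝ) + δ) := by
          gcongr
      _ = ck k := by
          simp only [hck]
          have e1 : q ^ k = ((2 : ℝ) ^ k) ^ (-δ) := by
            rw [hq, ← Real.rpow_natCast, ← Real.rpow_natCast, ← Real.rpow_mul (by norm_num),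
              ← Real.rpow_mul (by norm_num), mul_comm]
          rw [Real.div_rpow (by positivity) (by norm_num), Real.mul_rpow (by positivity) hs.le, e1,
            mul_pow, Real.rpow_neg (by positivity), Real.rpow_add (by positivity) (n:ℝ) δ,
            Real.rpow_add hs, Real.rpow_natCast, Real.rpow_natCast]
          field_simp
  calc ∫⁻ y, ENNReal.ofReal (s ^ δ / (s + dist x y) ^ ((n : ℝ) + δ)) * h y
      ≤ ∫⁻ y, ∑' k : ℕ, ENNReal.ofReal (ck k) * (Metric.ball x (2 ^ k * s)).indicator h y :=
        lintegral_mono hpt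
    _ = ∑' k : ℕ, ENNReal.ofReal (ck k) * ∫⁻ y in Metric.ball x (2 ^ k * s), h y := by
        rw [lintegral_tsum]
        · congr 1; ext k
          rw [lintegral_const_mul _ (hm.indicator Metric.isOpen_ball.measurableSet),
            lintegral_indicator Metric.isOpen_ball.measurableSet]
        · intro k
          exact ((hm.indicator Metric.isOpen_ball.measurableSet).const_mul _).aemeasurable
    _ ≤ ∑' k : ℕ, ENNReal.ofReal ((2 : ℝ) ^ ((n : ℝ) + δ) * l * q ^ k) := by
        refine ENNReal.tsum_le_tsum fun k => ?_
        refine (mul_le_mul_right (hb _ (by positivity)) _).trans ?_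
        rw [← ENNReal.ofReal_mul (by positivity)]
        refine ENNReal.ofReal_le_ofReal (le_of_eq ?_)
        simp only [hck]
        field_simp
    _ = ENNReal.ofReal (CD n δ * l) := by
        rw [← ENNReal.ofReal_tsum_of_nonneg (fun k => by positivity)
          ((summable_geometric_of_lt_one hq0.le hq1).mul_left _), tsum_mul_left,
          tsum_geometric_of_lt_one hq0.le hq1]
        congr 1
        rw [CD]; ring

theorem annuli_vol {δ : ℝ} (hδ : 0 < δ) {s : ℝ} (hs : 0 < s) (y : Rn n) :
    ∫⁻ x, ENNReal.ofReal (s ^ δ / (s + dist x y) ^ ((n : ℝ) + δ))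
      ≤ ENNReal.ofReal (CD n δ * vb n) := by
  have := annuli hδ hs (vb_nonneg (n := n)) (h := fun _ => 1) measurable_const y (by
    intro r hr
    rw [setLIntegral_one, ← vol_ball y hr.le]
    exact measure_mono Metric.ball_subset_closedBall)
  simpa [dist_comm] using this

end SparseCZ

namespace SparseCZ
variable {n : ℕ}

theorem lintegral_cs {α : Type*} [MeasurableSpace α] {μ : Measure α} {h : α → ℝ≥0∞}
    (hm : Measurable h) : (∫⁻ y, h y ∂μ) ^ 2 ≤ μ univ * ∫⁻ y, h y ^ 2 ∂μ := by
  have := ENNReal.lintegral_mul_le_Lp_mul_Lq μ (Real.HolderConjugate.two_two)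
    (f := fun _ => 1) (g := h) aemeasurable_const hm.aemeasurable
  simp only [Pi.mul_apply, one_mul, ENNReal.one_rpow, lintegral_const] at this
  calc (∫⁻ y, h y ∂μ) ^ 2 ≤ ((μ univ) ^ (1 / (2:ℝ)) * (∫⁻ y, h y ^ (2:ℝ) ∂μ) ^ (1 / (2:ℝ))) ^ 2 := by
        gcongr
    _ = _ := by
        rw [mul_pow, ← ENNReal.rpow_natCast, ← ENNReal.rpow_natCast, ← ENNReal.rpow_mul,
          ← ENNReal.rpow_mul]
        norm_num

theorem local_avg_l2 {h : Rn n → ℝ≥0∞} (hm : Measurable h) {r : ℝ} (hr : 0 ≤ r) :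
    ∫⁻ x, (∫⁻ y in Metric.closedBall x r, h y) ^ 2
      ≤ ENNReal.ofReal (vb n * r ^ n) ^ 2 * ∫⁻ y, h y ^ 2 := by
  set v := ENNReal.ofReal (vb n * r ^ n) with hv
  have hcl : MeasurableSet {p : Rn n × Rn n | dist p.1 p.2 ≤ r} :=
    (isClosed_le continuous_dist continuous_const).measurableSet
  have hms : Measurable (fun p : Rn n × Rn n =>
      {p : Rn n × Rn n | dist p.1 p.2 ≤ r}.indicator (fun p => h p.2 ^ 2) p) :=
    ((hm.comp measurable_snd).pow_const 2).indicator hcl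
  calc ∫⁻ x, (∫⁻ y in Metric.closedBall x r, h y) ^ 2
      ≤ ∫⁻ x, v * ∫⁻ y in Metric.closedBall x r, h y ^ 2 := by
        refine lintegral_mono fun x => ?_
        refine (lintegral_cs hm).trans ?_
        rw [Measure.restrict_apply_univ, vol_ball x hr]
    _ = ∫⁻ x, v * ∫⁻ y, {p : Rn n × Rn n | dist p.1 p.2 ≤ r}.indicator (fun p => h p.2 ^ 2) (x, y) := by
        refine lintegral_congr fun x => ?_
        rw [← lintegral_indicator Metric.isClosed_closedBall.measurableSet]
        congr 1
        refine lintegral_congr fun y => ?_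
        by_cases hxy : dist x y ≤ r
        · rw [indicator_of_mem (by rwa [Metric.mem_closedBall, dist_comm]), indicator_of_mem (by exact hxy)]
        · rw [indicator_of_notMem (by rwa [Metric.mem_closedBall, dist_comm]),
            indicator_of_notMem (by exact hxy)]
    _ = v * ∫⁻ y, ∫⁻ x, {p : Rn n × Rn n | dist p.1 p.2 ≤ r}.indicator (fun p => h p.2 ^ 2) (x, y) := by
        rw [lintegral_const_mul _ hms.lintegral_prod_right', lintegral_lintegral_swap hms.aemeasurable]
    _ = v * ∫⁻ y, v * h y ^ 2 := by
        congr 1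
        refine lintegral_congr fun y => ?_
        rw [mul_comm v, hv, ← vol_ball y hr, ← setLIntegral_const,
          ← lintegral_indicator Metric.isClosed_closedBall.measurableSet]
        refine lintegral_congr fun x => ?_
        by_cases hxy : dist x y ≤ r
        · rw [indicator_of_mem (by exact hxy), indicator_of_mem (by rwa [Metric.mem_closedBall])]
        · rw [indicator_of_notMem (by exact hxy), indicator_of_notMem (by rwa [Metric.mem_closedBall])]
    _ = _ := by
        rw [lintegral_const_mul _ (hm.pow_const 2), sq, mul_assoc]

theorem l2_sq {T : (Rn n → ℝ) → Rn n → ℝ} {A : ℝ≥0∞}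
    (hA : ∀ f, eLpNorm (T f) 2 volume ≤ A * eLpNorm f 2 volume) (f : Rn n → ℝ) :
    ∫⁻ x, ‖T f x‖ₑ ^ 2 ≤ A ^ 2 * ∫⁻ x, ‖f x‖ₑ ^ 2 := by
  have key : ∀ g : Rn n → ℝ, (eLpNorm g 2 volume) ^ 2 = ∫⁻ x, ‖g x‖ₑ ^ 2 := by
    intro g
    rw [eLpNorm_eq_eLpNorm' (by norm_num) (by norm_num), eLpNorm', ← ENNReal.rpow_natCast,
      ← ENNReal.rpow_mul]
    norm_num
  rw [← key, ← key, ← mul_pow]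
  gcongr
  exact hA f

/-- the core of a cube -/
def core (Q : Cube n) (t : ℝ) : Set (Rn n) := Q.toSet \ Metric.thickening t Q.toSetᶜ

theorem core_meas (Q : Cube n) (t : ℝ) : MeasurableSet (core Q t) :=
  Q.measurableSet.diff Metric.isOpen_thickening.measurableSet

theorem core_far {Q : Cube n} {t : ℝ} {x y : Rn n} (hx : x ∈ core Q t) (hy : y ∉ Q.toSet) :
    t ≤ dist x y := by
  by_contra h
  push Not at h
  exact hx.2 (Metric.mem_thickening_iff.2 ⟨y, hy, h⟩)

theorem enorm_add_sq (a b : ℝ) : ‖a + b‖ₑ ^ 2 ≤ 2 * ‖a‖ₑ ^ 2 + 2 * ‖b‖ₑ ^ 2 := by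
  simp only [Real.enorm_eq_ofReal_abs]
  rw [← ENNReal.ofReal_pow (abs_nonneg _), ← ENNReal.ofReal_pow (abs_nonneg _),
    ← ENNReal.ofReal_pow (abs_nonneg _)]
  rw [show (2 : ℝ≥0∞) = ENNReal.ofReal 2 by simp, ← ENNReal.ofReal_mul (by norm_num),
    ← ENNReal.ofReal_mul (by norm_num), ← ENNReal.ofReal_add (by positivity) (by positivity)]
  refine ENNReal.ofReal_le_ofReal ?_
  rw [sq_abs, sq_abs, sq_abs]
  nlinarith [sq_nonneg (a - b)]

theorem tsupp_of_vanish {f : Rn n → ℝ} {x : Rn n} {t : ℝ} (ht : 0 < t)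
    (h : ∀ y, dist x y < t → f y = 0) : x ∉ tsupport f := by
  rw [notMem_tsupport_iff_eventuallyEq]
  filter_upwards [Metric.ball_mem_nhds x ht] with y hy
  exact h y (by rwa [dist_comm])

theorem UU_congr {k k' : Rn n → Rn n → ℝ} {f f' : Rn n → ℝ} {x : Rn n}
    (h : ∀ y, k x y * f y = k' x y * f' y) : UU k f x = UU k' f' x := by
  unfold UU; congr 1; ext y; exact h y

open Classical in
/-- restriction of `f` to a family of cubes of level `j` -/
def fA (α : Fin n → ℝ) (j : ℤ) (f : Rn n → ℝ) (A : Finset (Cube n)) (y : Rn n) : ℝ :=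
  if gc α j y ∈ A then f y else 0

theorem meas_gc_eq (α : Fin n → ℝ) (j : ℤ) (Q : Cube n) : MeasurableSet {y | gc α j y = Q} := by
  by_cases h : ∃ z, gc α j z = Q
  · obtain ⟨z, rfl⟩ := h
    convert (gc α j z).measurableSet using 1
    ext y
    simp only [mem_ofPred_eq]
    constructor
    · intro h; rw [← h]; exact mem_gc _ _ _
    · exact gc_eq_of_mem
  · convert MeasurableSet.empty
    ext y
    simp only [mem_ofPred_eq, mem_empty_iff_false, iff_false]
    exact fun h' => h ⟨y, h'⟩

theorem meas_gc_mem (α : Fin n → ℝ) (j : ℤ) (A : Finset (Cube n)) :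
    MeasurableSet {y | gc α j y ∈ A} := by
  have : {y | gc α j y ∈ A} = ⋃ Q ∈ A, {y | gc α j y = Q} := by
    ext y; simp
  rw [this]
  exact Finset.measurableSet_biUnion _ fun Q _ => meas_gc_eq α j Q

theorem fA_eq (α : Fin n → ℝ) (j : ℤ) (f : Rn n → ℝ) (A : Finset (Cube n)) :
    fA α j f A = {y | gc α j y ∈ A}.indicator f := by
  classical
  ext y
  simp only [fA, indicator_apply, mem_ofPred_eq]

theorem fA_meas (α : Fin n → ℝ) (j : ℤ) {f : Rn n → ℝ} (hf : Measurable f)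
    (A : Finset (Cube n)) : Measurable (fA α j f A) := by
  rw [fA_eq]; exact hf.indicator (meas_gc_mem _ _ _)

theorem fA_int (α : Fin n → ℝ) (j : ℤ) {f : Rn n → ℝ} (hf : Integrable f volume)
    (A : Finset (Cube n)) : Integrable (fA α j f A) volume := by
  rw [fA_eq]; exact hf.indicator (meas_gc_mem _ _ _)

theorem fA_le (α : Fin n → ℝ) (j : ℤ) (f : Rn n → ℝ) (A : Finset (Cube n)) (y : Rn n) :
    ‖fA α j f A y‖ₑ ≤ ‖f y‖ₑ := by
  rw [fA]; split_ifs <;> simp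

end SparseCZ

namespace SparseCZ
variable {n : ℕ}

open Classical in
theorem pow_V {ι : Type*} (E : Finset ι) (G : Finset ι → ℝ) (V : ℝ)
    (h : ∀ B ⊆ E, V = G B + G (E \ B)) :
    (2 : ℝ≥0∞) ^ E.card * ‖V‖ₑ ^ 2 ≤ 4 * ∑ B ∈ E.powerset, ‖G B‖ₑ ^ 2 := by
  have h1 : ∑ B ∈ E.powerset, ‖V‖ₑ ^ 2 ≤
      ∑ B ∈ E.powerset, (2 * ‖G B‖ₑ ^ 2 + 2 * ‖G (E \ B)‖ₑ ^ 2) := by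
    refine Finset.sum_le_sum fun B hB => ?_
    rw [h B (Finset.mem_powerset.1 hB)]
    exact enorm_add_sq _ _
  have h2 : ∑ B ∈ E.powerset, ‖G (E \ B)‖ₑ ^ 2 = ∑ B ∈ E.powerset, ‖G B‖ₑ ^ 2 := by
    refine Finset.sum_nbij' (fun B => E \ B) (fun B => E \ B) ?_ ?_ ?_ ?_ ?_
    · intro B _; simp
    · intro B _; simp
    · intro B hB; simpa using Finset.mem_powerset.1 hB
    · intro B hB; simpa using Finset.mem_powerset.1 hB
    · intro B _; rfl
  rw [Finset.sum_add_distrib, ← Finset.mul_sum, ← Finset.mul_sum, h2, ← add_mul,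
    Finset.sum_const, Finset.card_powerset, nsmul_eq_mul] at h1
  norm_num at h1
  exact h1

open Classical in
theorem fA_add (α : Fin n → ℝ) (j : ℤ) (f : Rn n → ℝ) {E B : Finset (Cube n)} (hB : B ⊆ E) :
    fA α j f E = fun y => fA α j f B y + fA α j f (E \ B) y := by
  ext y
  simp only [fA, Finset.mem_sdiff]
  by_cases h1 : gc α j y ∈ B
  · simp [h1, hB h1]
  · simp [h1]

open Classical in
theorem l2_core {T : (Rn n → ℝ) → Rn n → ℝ} {K : Rn n → Rn n → ℝ} {c δ : ℝ}
    (hT : IsCZO n T K c δ) {A0 : ℝ≥0∞}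
    (hA : ∀ f, eLpNorm (T f) 2 volume ≤ A0 * eLpNorm f 2 volume) (j : ℤ) (α : Fin n → ℝ)
    {f : Rn n → ℝ} (hfm : Measurable f) (hfi : Integrable f volume) (ι : Finset (Cube n))
    (hι : ∀ Q ∈ ι, ∃ z, Q = gc α j z) :
    ∑ i ∈ ι, ∫⁻ x in core i (2 ^ j / 6), ‖UU (kt K (2 ^ j / 12)) (fA α j f (ι.erase i)) x‖ₑ ^ 2
      ≤ 8 * A0 ^ 2 * ∫⁻ x, ‖f x‖ₑ ^ 2 := by
  have hε : (0 : ℝ) < 2 ^ j / 12 := by positivity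
  have hk := sk_kt hT hε
  set k := kt K (2 ^ j / 12) with hkdef
  set G : Finset (Cube n) → Rn n → ℝ := fun B => UU k (fA α j f B) with hG
  have hGm : ∀ B, Measurable fun x => ‖G B x‖ₑ ^ 2 := fun B =>
    (hk.measurable_UU (fA_meas α j hfm B)).enorm.pow_const 2
  have hGT : ∀ B, ∀ i ∈ ι, i ∉ B → ∀ x ∈ core i (2 ^ j / 6), G B x = T (fA α j f B) x := by
    intro B i hi hiB x hx
    obtain ⟨z, rfl⟩ := hι i hi
    have hv : ∀ y, dist x y < 2 ^ j / 6 → fA α j f B y = 0 := by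
      intro y hy
      have : y ∈ (gc α j z).toSet := by
        by_contra h
        exact absurd (core_far hx h) (by linarith)
      rw [fA, if_neg]
      rwa [gc_eq_of_mem this]
    rw [hT.repr _ (fA_int α j hfi B) x (tsupp_of_vanish (by positivity) hv)]
    simp only [hG, UU]
    congr 1
    ext y
    rcases lt_or_ge (dist x y) (2 ^ j / 6) with h | h
    · rw [hv y h, mul_zero, mul_zero]
    · rw [hkdef, kt_eq K hε (by linarith)]
  have hstep : ∀ i ∈ ι, (2 : ℝ≥0∞) ^ (ι.card - 1) *
      ∫⁻ x in core i (2 ^ j / 6), ‖G (ι.erase i) x‖ₑ ^ 2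
      ≤ 4 * ∑ B ∈ (ι.erase i).powerset, ∫⁻ x in core i (2 ^ j / 6), ‖G B x‖ₑ ^ 2 := by
    intro i hi
    rw [← lintegral_const_mul _ (hGm _), ← lintegral_finsetSum _ (fun B _ => hGm B),
      ← lintegral_const_mul _ (Finset.measurable_sum _ fun B _ => hGm B)]
    refine lintegral_mono fun x => ?_
    rw [← Finset.card_erase_of_mem hi]
    refine pow_V _ (fun B => G B x) _ ?_
    intro B hB
    simp only [hG]
    rw [← hk.UU_add (fA_int α j hfi B) (fA_int α j hfi _), ← fA_add α j f hB]
  have hB : ∀ B ∈ ι.powerset, ∑ i ∈ ι \ B, ∫⁻ x in core i (2 ^ j / 6), ‖G B x‖ₑ ^ 2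
      ≤ A0 ^ 2 * ∫⁻ x, ‖f x‖ₑ ^ 2 := by
    intro B _
    have hd : ((ι \ B : Finset (Cube n)) : Set (Cube n)).PairwiseDisjoint
        (fun i => core i (2 ^ j / 6)) := by
      intro i hi i' hi' hne
      rw [Function.onFun, Set.disjoint_left]
      intro x hx hx'
      have hi := Finset.mem_sdiff.1 (Finset.mem_coe.1 hi)
      have hi' := Finset.mem_sdiff.1 (Finset.mem_coe.1 hi')
      obtain ⟨z, rfl⟩ := hι i hi.1
      obtain ⟨z', rfl⟩ := hι i' hi'.1
      exact hne ((gc_eq_of_mem hx.1).symm.trans (gc_eq_of_mem hx'.1))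
    rw [← lintegral_biUnion_finset hd (fun i _ => core_meas i _)]
    calc ∫⁻ x in ⋃ i ∈ ι \ B, core i (2 ^ j / 6), ‖G B x‖ₑ ^ 2
        ≤ ∫⁻ x in ⋃ i ∈ ι \ B, core i (2 ^ j / 6), ‖T (fA α j f B) x‖ₑ ^ 2 := by
          refine setLIntegral_mono' (Finset.measurableSet_biUnion _ fun i _ => core_meas i _) ?_
          intro x hx
          simp only [mem_iUnion] at hx
          obtain ⟨i, hi, hx⟩ := hx
          have hi := Finset.mem_sdiff.1 hi
          rw [hGT B i hi.1 hi.2 x hx]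
      _ ≤ ∫⁻ x, ‖T (fA α j f B) x‖ₑ ^ 2 := setLIntegral_le_lintegral _ _
      _ ≤ A0 ^ 2 * ∫⁻ x, ‖fA α j f B x‖ₑ ^ 2 := l2_sq hA _
      _ ≤ _ := by
          gcongr with x
          exact fA_le α j f B x
  have hsum : ∑ i ∈ ι, ∑ B ∈ (ι.erase i).powerset, ∫⁻ x in core i (2 ^ j / 6), ‖G B x‖ₑ ^ 2
      = ∑ B ∈ ι.powerset, ∑ i ∈ ι \ B, ∫⁻ x in core i (2 ^ j / 6), ‖G B x‖ₑ ^ 2 := by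
    refine Finset.sum_comm' ?_
    intro i B
    simp only [Finset.mem_powerset, Finset.mem_sdiff, Finset.subset_erase]
    tauto
  rcases ι.eq_empty_or_nonempty with h0 | hne
  · rw [h0]; simp
  have hcard : ι.card = ι.card - 1 + 1 := by have := hne.card_pos; omega
  have hfin : (2 : ℝ≥0∞) ^ (ι.card - 1) *
      ∑ i ∈ ι, ∫⁻ x in core i (2 ^ j / 6), ‖G (ι.erase i) x‖ₑ ^ 2
      ≤ (2 : ℝ≥0∞) ^ (ι.card - 1) * (8 * A0 ^ 2 * ∫⁻ x, ‖f x‖ₑ ^ 2) := by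
    rw [Finset.mul_sum]
    refine (Finset.sum_le_sum hstep).trans ?_
    rw [← Finset.mul_sum, hsum]
    calc 4 * ∑ B ∈ ι.powerset, ∑ i ∈ ι \ B, ∫⁻ x in core i (2 ^ j / 6), ‖G B x‖ₑ ^ 2
        ≤ 4 * ∑ B ∈ ι.powerset, A0 ^ 2 * ∫⁻ x, ‖f x‖ₑ ^ 2 := by
          gcongr with B hB'
          exact hB B hB'
      _ = _ := by
          rw [Finset.sum_const, Finset.card_powerset, nsmul_eq_mul]
          push_cast
          conv_lhs => rw [hcard, pow_succ]
          ring
  rwa [ENNReal.mul_le_mul_iff_right (by positivity) (by finiteness)] at hfin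

end SparseCZ

namespace SparseCZ
variable {n : ℕ}

theorem core_disj {α : Fin n → ℝ} {j : ℤ} {t : ℝ} {ι : Finset (Cube n)}
    (hι : ∀ Q ∈ ι, ∃ z, Q = gc α j z) :
    (ι : Set (Cube n)).PairwiseDisjoint (fun i => core i t) := by
  intro i hi i' hi' hne
  rw [Function.onFun, Set.disjoint_left]
  intro x hx hx'
  obtain ⟨z, rfl⟩ := hι i (Finset.mem_coe.1 hi)
  obtain ⟨z', rfl⟩ := hι i' (Finset.mem_coe.1 hi')
  exact hne ((gc_eq_of_mem hx.1).symm.trans (gc_eq_of_mem hx'.1))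

def B1 (n : ℕ) (c : ℝ) : ℝ := BB n c + BB n c * 12 ^ n

open Classical in
theorem diff_bound {T : (Rn n → ℝ) → Rn n → ℝ} {K : Rn n → Rn n → ℝ} {c δ : ℝ}
    (hT : IsCZO n T K c δ) (j : ℤ) (α : Fin n → ℝ)
    {f : Rn n → ℝ} (hfi : Integrable f volume) {R : ℝ} (hR : ∀ y, R < ‖y‖ → f y = 0)
    (ι : Finset (Cube n)) (hι : ∀ Q ∈ ι, ∃ z, Q = gc α j z)
    (hι2 : ∀ y, ‖y‖ ≤ R → gc α j y ∈ ι) (i : Cube n) (hi : i ∈ ι) (x : Rn n)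
    (hx : x ∈ core i (2 ^ j / 6)) :
    ‖UU (kt K (2 ^ j)) f x‖ₑ ^ 2 ≤
      2 * ‖UU (kt K (2 ^ j / 12)) (fA α j f (ι.erase i)) x‖ₑ ^ 2 +
      2 * (ENNReal.ofReal (B1 n c / (2 ^ j) ^ n) *
        ∫⁻ y in Metric.closedBall x ((n + 2) * 2 ^ j), ‖f y‖ₑ) ^ 2 := by
  have hε : (0 : ℝ) < 2 ^ j := by positivity
  have hε' : (0 : ℝ) < 2 ^ j / 12 := by positivity
  have hk := sk_kt hT hε
  have hk' := sk_kt hT hε'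
  have hB := hk.B_pos
  set ε : ℝ := 2 ^ j with hεdef
  have hfA := fA_int α j hfi (ι.erase i)
  set g := fA α j f (ι.erase i) with hg
  have hD : ‖UU (kt K ε) f x - UU (kt K (ε / 12)) g x‖ₑ ≤
      ENNReal.ofReal (B1 n c / ε ^ n) * ∫⁻ y in Metric.closedBall x ((n + 2) * ε), ‖f y‖ₑ := by
    rw [UU, UU, ← integral_sub (hk.integrable hfi x) (hk'.integrable hfA x)]
    refine (enorm_integral_le_lintegral_enorm _).trans ?_
    rw [← lintegral_const_mul' _ _ ENNReal.ofReal_ne_top,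
      ← lintegral_indicator Metric.isClosed_closedBall.measurableSet]
    refine lintegral_mono fun y => ?_
    by_cases hy : dist x y ≤ (n + 2) * ε
    · rw [indicator_of_mem (by rwa [Metric.mem_closedBall, dist_comm])]
      rw [Real.enorm_eq_ofReal_abs, Real.enorm_eq_ofReal_abs,
        ← ENNReal.ofReal_mul (by unfold B1; positivity)]
      refine ENNReal.ofReal_le_ofReal ?_
      have h1 := hk.bdd x y
      have h2 := hk'.bdd x y
      have h3 : |g y| ≤ |f y| := by
        rw [hg, fA]; split_ifs <;> simp
      calc |kt K ε x y * f y - kt K (ε / 12) x y * g y|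
          ≤ |kt K ε x y * f y| + |kt K (ε / 12) x y * g y| := abs_sub _ _
        _ ≤ BB n c / ε ^ n * |f y| + BB n c / (ε / 12) ^ n * |f y| := by
            rw [abs_mul, abs_mul]; gcongr
        _ = B1 n c / ε ^ n * |f y| := by
            rw [B1, div_pow]; field_simp
    · rw [indicator_of_notMem (by rwa [Metric.mem_closedBall, dist_comm])]
      push Not at hy
      rcases lt_or_ge R ‖y‖ with h | h
      · have : g y = 0 := by rw [hg, fA, hR y h]; simp
        rw [this, hR y h]; simp
      · have hyi : gc α j y ≠ i := by
          intro h'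
          have hmem : y ∈ i.toSet := by rw [← h']; exact mem_gc _ _ _
          have := i.dist_le hx.1 hmem
          obtain ⟨z, rfl⟩ := hι i hi
          rw [gc_side] at this
          nlinarith
        have : g y = f y := by
          rw [hg, fA, if_pos (Finset.mem_erase.2 ⟨hyi, hι2 y h⟩)]
        have hn0 : (0 : ℝ) ≤ n := Nat.cast_nonneg n
        rw [this, kt_eq K hε (by nlinarith), kt_eq K hε' (by nlinarith)]
        simp
  have := enorm_add_sq (UU (kt K (ε / 12)) g x) (UU (kt K ε) f x - UU (kt K (ε / 12)) g x)
  rw [add_sub_cancel] at this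
  refine this.trans ?_
  gcongr

theorem l2_unif {T : (Rn n → ℝ) → Rn n → ℝ} {K : Rn n → Rn n → ℝ} {c δ : ℝ}
    (hT : IsCZO n T K c δ) : ∃ C : ℝ, 0 < C ∧ ∀ (j : ℤ) (f : Rn n → ℝ), Measurable f →
      Integrable f volume → ∀ R : ℝ, (∀ y, R < ‖y‖ → f y = 0) →
      ∫⁻ x, ‖UU (kt K (2 ^ j)) f x‖ₑ ^ 2 ≤ ENNReal.ofReal C * ∫⁻ x, ‖f x‖ₑ ^ 2 := by
  classical
  obtain ⟨A0, hA0, hA⟩ := hT.l2_bounded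
  have hc := hT.c_pos
  set W : ℝ≥0∞ := 16 * A0 ^ 2 + 2 * ENNReal.ofReal (B1 n c * (vb n * (n + 2) ^ n)) ^ 2 with hW
  have hWt : W ≠ ⊤ := by rw [hW]; finiteness
  set Z : ℝ≥0∞ := (Fintype.card (Fin n → Bool) : ℝ≥0∞) * W with hZ
  have hZt : Z ≠ ⊤ := by rw [hZ]; finiteness
  refine ⟨Z.toReal + 1, by positivity, ?_⟩
  intro j f hfm hfi R hR
  have hε : (0 : ℝ) < 2 ^ j := by positivity
  have hk := sk_kt hT hε
  have hk' := sk_kt hT (ε := 2 ^ j / 12) (by positivity)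
  set I := ∫⁻ x, ‖f x‖ₑ ^ 2 with hI
  have hUm : Measurable fun x => ‖UU (kt K (2 ^ j)) f x‖ₑ ^ 2 :=
    (hk.measurable_UU hfm).enorm.pow_const 2
  have hbound : ∀ m : ℕ, ∫⁻ x in Metric.closedBall 0 (m : ℝ), ‖UU (kt K (2 ^ j)) f x‖ₑ ^ 2
      ≤ Z * I := by
    intro m
    set R' := max R m
    set ι : (Fin n → Bool) → Finset (Cube n) := fun a => (finite_gc (shiftB a) j R').toFinset
    have hι : ∀ a, ∀ Q ∈ ι a, ∃ z, Q = gc (shiftB a) j z := by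
      intro a Q hQ
      obtain ⟨z, -, hz⟩ := (Set.Finite.mem_toFinset _).1 hQ
      exact ⟨z, hz⟩
    have hι3 : ∀ a y, ‖y‖ ≤ R' → gc (shiftB a) j y ∈ ι a := by
      intro a y hy
      exact (Set.Finite.mem_toFinset _).2 ⟨y, hy, rfl⟩
    set S : (Fin n → Bool) → Set (Rn n) := fun a => ⋃ i ∈ ι a, core i (2 ^ j / 6)
    have hcov : Metric.closedBall (0 : Rn n) (m : ℝ) ⊆ ⋃ a, S a := by
      intro x hx
      obtain ⟨a, ha⟩ := one_third j x
      have hx' : ‖x‖ ≤ R' := by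
        rw [mem_closedBall_zero_iff] at hx; exact hx.trans (le_max_right _ _)
      refine mem_iUnion.2 ⟨a, ?_⟩
      simp only [S, mem_iUnion]
      refine ⟨gc (shiftB a) j x, hι3 a x hx', mem_gc _ _ _, ?_⟩
      intro hth
      obtain ⟨y, hy, hxy⟩ := Metric.mem_thickening_iff.1 hth
      exact hy (ha y hxy)
    have hSa : ∀ a, ∫⁻ x in S a, ‖UU (kt K (2 ^ j)) f x‖ₑ ^ 2 ≤ W * I := by
      intro a
      have hloc : Measurable fun x => 2 * (ENNReal.ofReal (B1 n c / (2 ^ j) ^ n) *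
        ∫⁻ y in Metric.closedBall x ((n + 2) * 2 ^ j), ‖f y‖ₑ) ^ 2 := by
        have hcl : MeasurableSet {p : Rn n × Rn n | dist p.1 p.2 ≤ (n + 2) * 2 ^ j} :=
          (isClosed_le continuous_dist continuous_const).measurableSet
        have hms : Measurable (fun p : Rn n × Rn n =>
            {p : Rn n × Rn n | dist p.1 p.2 ≤ (n + 2) * 2 ^ j}.indicator (fun p => ‖f p.2‖ₑ) p) :=
          (hfm.comp measurable_snd).enorm.indicator hcl
        have h2 := hms.lintegral_prod_right' (ν := (volume : Measure (Rn n)))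
        have h3 : (fun x => ∫⁻ y in Metric.closedBall x ((n + 2) * 2 ^ j), ‖f y‖ₑ) =
            fun x => ∫⁻ y, {p : Rn n × Rn n | dist p.1 p.2 ≤ (n + 2) * 2 ^ j}.indicator
              (fun p => ‖f p.2‖ₑ) (x, y) := by
          ext x
          rw [← lintegral_indicator Metric.isClosed_closedBall.measurableSet]
          refine lintegral_congr fun y => ?_
          by_cases hxy : dist x y ≤ (n + 2) * 2 ^ j
          · rw [indicator_of_mem (by rwa [Metric.mem_closedBall, dist_comm]),
              indicator_of_mem (by exact hxy)]
          · rw [indicator_of_notMem (by rwa [Metric.mem_closedBall, dist_comm]),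
              indicator_of_notMem (by exact hxy)]
        have h4 : Measurable fun x => ∫⁻ y in Metric.closedBall x ((n + 2) * 2 ^ j), ‖f y‖ₑ := by
          rw [h3]; exact h2
        exact ((h4.const_mul _).pow_const 2).const_mul 2
      have hd := core_disj (t := 2 ^ j / 6) (hι a)
      have hcm : ∀ i ∈ ι a, MeasurableSet (core i (2 ^ j / 6)) := fun i _ => core_meas i _
      rw [lintegral_biUnion_finset hd hcm]
      calc ∑ i ∈ ι a, ∫⁻ x in core i (2 ^ j / 6), ‖UU (kt K (2 ^ j)) f x‖ₑ ^ 2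
          ≤ ∑ i ∈ ι a, ∫⁻ x in core i (2 ^ j / 6),
            (2 * ‖UU (kt K (2 ^ j / 12)) (fA (shiftB a) j f ((ι a).erase i)) x‖ₑ ^ 2 +
              2 * (ENNReal.ofReal (B1 n c / (2 ^ j) ^ n) *
                ∫⁻ y in Metric.closedBall x ((n + 2) * 2 ^ j), ‖f y‖ₑ) ^ 2) := by
            refine Finset.sum_le_sum fun i hi => ?_
            refine setLIntegral_mono' (core_meas i _) fun x hx => ?_
            exact diff_bound hT j _ hfi hR (ι a) (hι a)
              (fun y hy => hι3 a y (hy.trans (le_max_left _ _))) i hi x hx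
        _ = 2 * ∑ i ∈ ι a, (∫⁻ x in core i (2 ^ j / 6),
              ‖UU (kt K (2 ^ j / 12)) (fA (shiftB a) j f ((ι a).erase i)) x‖ₑ ^ 2) +
            ∑ i ∈ ι a, ∫⁻ x in core i (2 ^ j / 6),
              2 * (ENNReal.ofReal (B1 n c / (2 ^ j) ^ n) *
                ∫⁻ y in Metric.closedBall x ((n + 2) * 2 ^ j), ‖f y‖ₑ) ^ 2 := by
            rw [Finset.mul_sum, ← Finset.sum_add_distrib]
            refine Finset.sum_congr rfl fun i _ => ?_
            rw [lintegral_add_right _ hloc, lintegral_const_mul']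
            finiteness
        _ ≤ 2 * (8 * A0 ^ 2 * I) + ∫⁻ x, 2 * (ENNReal.ofReal (B1 n c / (2 ^ j) ^ n) *
                ∫⁻ y in Metric.closedBall x ((n + 2) * 2 ^ j), ‖f y‖ₑ) ^ 2 := by
            rw [← lintegral_biUnion_finset hd hcm]
            refine add_le_add ?_ (setLIntegral_le_lintegral _ _)
            refine mul_le_mul_right ?_ _
            exact l2_core hT hA j _ hfm hfi (ι a) (hι a)
        _ ≤ 2 * (8 * A0 ^ 2 * I) + 2 * (ENNReal.ofReal (B1 n c / (2 ^ j) ^ n) ^ 2 *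
              (ENNReal.ofReal (vb n * ((n + 2) * 2 ^ j) ^ n) ^ 2 * I)) := by
            gcongr
            rw [lintegral_const_mul' _ _ (by finiteness)]
            gcongr
            simp only [mul_pow]
            rw [lintegral_const_mul' _ _ (by finiteness)]
            gcongr
            simp only [← mul_pow]
            exact local_avg_l2 hfm.enorm (by positivity)
        _ = W * I := by
            have hv := vb_nonneg (n := n)
            have : ENNReal.ofReal (B1 n c / (2 ^ j) ^ n) *
                ENNReal.ofReal (vb n * ((n + 2) * 2 ^ j) ^ n) =
                ENNReal.ofReal (B1 n c * (vb n * (n + 2) ^ n)) := by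
              rw [← ENNReal.ofReal_mul (by have := hk.B_pos; unfold B1; positivity)]
              congr 1
              rw [mul_pow]
              field_simp
            rw [hW, ← this]
            ring
    calc ∫⁻ x in Metric.closedBall 0 (m : ℝ), ‖UU (kt K (2 ^ j)) f x‖ₑ ^ 2
        ≤ ∫⁻ x in ⋃ a, S a, ‖UU (kt K (2 ^ j)) f x‖ₑ ^ 2 := lintegral_mono_set hcov
      _ ≤ ∑' a, ∫⁻ x in S a, ‖UU (kt K (2 ^ j)) f x‖ₑ ^ 2 := lintegral_iUnion_le _ _
      _ ≤ ∑' a : Fin n → Bool, W * I := ENNReal.tsum_le_tsum hSa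
      _ = Z * I := by
          rw [tsum_fintype, Finset.sum_const, Finset.card_univ, nsmul_eq_mul, hZ, mul_assoc]
  have hlim : ∫⁻ x, ‖UU (kt K (2 ^ j)) f x‖ₑ ^ 2 ≤ Z * I := by
    have hc := (aecover_closedBall (μ := (volume : Measure (Rn n))) (x := 0)
      (tendsto_natCast_atTop_atTop (R := ℝ))).lintegral_tendsto_of_countably_generated
      hUm.aemeasurable
    exact le_of_tendsto' hc hbound
  refine hlim.trans ?_
  gcongr
  exact (ENNReal.ofReal_toReal hZt).symm.le.trans (ENNReal.ofReal_le_ofReal (by linarith))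

end SparseCZ

namespace SparseCZ
variable {n : ℕ}

theorem grid_countable (α : Fin n → ℝ) : (grid α).Countable := by
  have : grid α ⊆ ⋃ k : ℤ, ⋃ R : ℕ, {Q : Cube n | ∃ x : Rn n, ‖x‖ ≤ (R : ℝ) ∧ Q = gc α k x} := by
    rintro Q ⟨k, x, rfl⟩
    obtain ⟨R, hR⟩ := exists_nat_ge ‖x‖
    exact mem_iUnion.2 ⟨k, mem_iUnion.2 ⟨R, x, hR, rfl⟩⟩
  exact (countable_iUnion fun k => countable_iUnion fun R : ℕ =>
    (finite_gc α k R).countable).mono this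

theorem gc_eq_of_le {α : Fin n → ℝ} (hα : Adm α) {k k' : ℤ} (h : k ≤ k') {y z : Rn n}
    (hz : z ∈ (gc α k y).toSet) : gc α k' z = gc α k' y :=
  gc_eq_of_mem (gc_subset hα h y hz)

theorem exists_stop {α : Fin n → ℝ} (hα : Adm α) (Bad : Cube n → Prop) {m0 m1 : ℤ}
    (hm : m0 ≤ m1) : ∃ J : Rn n → ℤ, ∀ y, m0 ≤ J y ∧ J y ≤ m1 ∧
      (J y = m0 ∨ Bad (gc α (J y) y)) ∧ (∀ k, J y < k → k ≤ m1 → ¬ Bad (gc α k y)) ∧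
      (∀ z ∈ (gc α (J y) y).toSet, J z = J y) := by
  classical
  have hne : ∀ y : Rn n, ((Finset.Icc m0 m1).filter fun k => k = m0 ∨ Bad (gc α k y)).Nonempty :=
    fun y => ⟨m0, by simp [hm]⟩
  set J : Rn n → ℤ := fun y =>
    ((Finset.Icc m0 m1).filter fun k => k = m0 ∨ Bad (gc α k y)).max' (hne y) with hJ
  have hmem : ∀ y, (m0 ≤ J y ∧ J y ≤ m1) ∧ (J y = m0 ∨ Bad (gc α (J y) y)) := by
    intro y
    have := Finset.max'_mem _ (hne y)
    rw [Finset.mem_filter, Finset.mem_Icc] at this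
    exact this
  have hle : ∀ y k, m0 ≤ k → k ≤ m1 → (k = m0 ∨ Bad (gc α k y)) → k ≤ J y := by
    intro y k h1 h2 h3
    exact Finset.le_max' _ _ (by rw [Finset.mem_filter, Finset.mem_Icc]; exact ⟨⟨h1, h2⟩, h3⟩)
  refine ⟨J, fun y => ⟨(hmem y).1.1, (hmem y).1.2, (hmem y).2, ?_, ?_⟩⟩
  · intro k hk hk1 hb
    have := hle y k ((hmem y).1.1.trans hk.le) hk1 (Or.inr hb)
    omega
  · intro z hz
    have h1 : J y ≤ J z := by
      refine hle z _ (hmem y).1.1 (hmem y).1.2 ?_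
      rw [gc_eq_of_mem hz]; exact (hmem y).2
    refine le_antisymm ?_ h1
    refine hle y _ (hmem z).1.1 (hmem z).1.2 ?_
    rw [← gc_eq_of_le hα h1 hz]; exact (hmem z).2

/-- partition map into cubes -/
structure PM (P : Rn n → Cube n) : Prop where
  mem : ∀ y, y ∈ (P y).toSet
  eq : ∀ y z, z ∈ (P y).toSet → P z = P y
  cnt : (range P).Countable

theorem PM.meas {P : Rn n → Cube n} (hP : PM P) {β : Type*} [MeasurableSpace β] (Φ : Cube n → β) :
    Measurable fun y => Φ (P y) := by
  intro s _
  have : (fun y => Φ (P y)) ⁻¹' s = ⋃ Q ∈ {Q | Q ∈ range P ∧ Φ Q ∈ s}, Q.toSet := by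
    ext y
    simp only [mem_preimage, mem_iUnion]
    constructor
    · intro h; exact ⟨P y, ⟨⟨y, rfl⟩, h⟩, hP.mem y⟩
    · rintro ⟨Q, ⟨⟨z, rfl⟩, h⟩, hy⟩
      rwa [hP.eq z y hy]
  rw [this]
  exact MeasurableSet.biUnion (hP.cnt.mono fun Q hQ => hQ.1) fun Q _ => Q.measurableSet

theorem PM.disj {P : Rn n → Cube n} (hP : PM P) :
    (range P).PairwiseDisjoint fun Q => Q.toSet := by
  rintro _ ⟨z, rfl⟩ _ ⟨w, rfl⟩ hne
  rw [Function.onFun, Set.disjoint_left]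
  intro x hx hx'
  exact hne ((hP.eq z x hx).symm.trans (hP.eq w x hx'))

theorem PM.univ {P : Rn n → Cube n} (hP : PM P) : ⋃ Q ∈ range P, Q.toSet = univ := by
  refine eq_univ_of_forall fun y => ?_
  exact mem_biUnion ⟨y, rfl⟩ (hP.mem y)

theorem PM.lint {P : Rn n → Cube n} (hP : PM P) (G : Rn n → ℝ≥0∞) :
    ∫⁻ y, G y = ∑' Q : range P, ∫⁻ y in Q.1.toSet, G y := by
  rw [← setLIntegral_univ, ← hP.univ, lintegral_biUnion hP.cnt (fun Q _ => Q.measurableSet) hP.disj]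

theorem PM.int_zero {P : Rn n → Cube n} (hP : PM P) {G : Rn n → ℝ} (hG : Integrable G volume)
    (h0 : ∀ y, ∫ z in (P y).toSet, G z = 0) : ∫ z, G z = 0 := by
  have := hP.cnt.to_subtype
  have hs := hasSum_integral_iUnion (f := G) (μ := volume) (s := fun Q : range P => Q.1.toSet)
    (fun Q => Q.1.measurableSet) (by
      intro Q Q' hne
      exact hP.disj Q.2 Q'.2 (fun h => hne (Subtype.ext h))) hG.integrableOn
  rw [← biUnion_eq_iUnion (s := range P) (t := fun Q _ => Q.toSet), hP.univ, setIntegral_univ] at hs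
  refine hs.unique ?_
  convert hasSum_zero with Q
  obtain ⟨Q, y, rfl⟩ := Q
  exact h0 y

/-- average over the partition -/
def gP (P : Rn n → Cube n) (h : Rn n → ℝ) (y : Rn n) : ℝ :=
  (∫ z in (P y).toSet, h z) / (P y).side ^ n

theorem PM.gP_meas {P : Rn n → Cube n} (hP : PM P) (h : Rn n → ℝ) : Measurable (gP P h) :=
  hP.meas fun Q => (∫ z in Q.toSet, h z) / Q.side ^ n

theorem gP_abs_le (P : Rn n → Cube n) (h : Rn n → ℝ) (y : Rn n) :
    ‖gP P h y‖ₑ ≤ ENNReal.ofReal (((P y).side ^ n)⁻¹) * ∫⁻ z in (P y).toSet, ‖h z‖ₑ := by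
  have := (P y).side_pos
  rw [gP, div_eq_inv_mul, enorm_mul, Real.enorm_eq_ofReal_abs (_⁻¹), abs_of_pos (by positivity)]
  gcongr
  exact enorm_integral_le_lintegral_enorm _

theorem PM.gP_l1 {P : Rn n → Cube n} (hP : PM P) (h : Rn n → ℝ) :
    ∫⁻ y, ‖gP P h y‖ₑ ≤ ∫⁻ y, ‖h y‖ₑ := by
  rw [hP.lint, hP.lint]
  refine ENNReal.tsum_le_tsum ?_
  rintro ⟨_, y, rfl⟩
  have hs := (P y).side_pos
  calc ∫⁻ z in (P y).toSet, ‖gP P h z‖ₑ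
      ≤ ∫⁻ z in (P y).toSet, ENNReal.ofReal (((P y).side ^ n)⁻¹) *
          ∫⁻ z in (P y).toSet, ‖h z‖ₑ := by
        refine setLIntegral_mono' (P y).measurableSet fun z hz => ?_
        have := gP_abs_le P h z
        rwa [hP.eq y z hz] at this
    _ = _ := by
        rw [setLIntegral_const, Cube.volume_eq, mul_comm, ← mul_assoc,
          ← ENNReal.ofReal_mul (by positivity), mul_inv_cancel₀ (by positivity)]
        simp

theorem PM.gP_int {P : Rn n → Cube n} (hP : PM P) {h : Rn n → ℝ} (hh : Integrable h volume) :
    Integrable (gP P h) volume :=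
  ⟨(hP.gP_meas h).aestronglyMeasurable, (hP.gP_l1 h).trans_lt hh.2⟩

theorem PM.mean_zero {P : Rn n → Cube n} (hP : PM P) {h : Rn n → ℝ} (hh : Integrable h volume)
    (y : Rn n) : ∫ z in (P y).toSet, (h z - gP P h z) = 0 := by
  have hs := (P y).side_pos
  rw [integral_sub hh.integrableOn (hP.gP_int hh).integrableOn]
  have : ∫ z in (P y).toSet, gP P h z = ∫ z in (P y).toSet, gP P h y := by
    refine setIntegral_congr_fun (P y).measurableSet fun z hz => ?_
    simp only [gP, hP.eq y z hz]
  rw [this, setIntegral_const, measureReal_def, Cube.volume_eq, ENNReal.toReal_ofReal (by positivity),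
    smul_eq_mul, gP, mul_div_cancel₀ _ (by positivity), sub_self]

end SparseCZ

namespace SparseCZ
variable {n : ℕ}

theorem cz_stop (hn : 0 < n) {h : Rn n → ℝ} (hh : Integrable h volume) {l : ℝ} (hl : 0 < l) (j : ℤ) :
    ∃ P : Rn n → Cube n, PM P ∧ (∃ S : ℝ, ∀ y, (P y).side ≤ S) ∧
      (∀ y, ∫⁻ z in (P y).toSet, ‖h z‖ₑ ≤ ENNReal.ofReal (2 ^ n * l * (P y).side ^ n)) ∧
      (∀ y, n * (P y).side ≤ 2 ^ j / 4 ∨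
        ENNReal.ofReal (l * (P y).side ^ n) < ∫⁻ z in (P y).toSet, ‖h z‖ₑ) := by
  set I := ∫⁻ z, ‖h z‖ₑ with hI
  have hIt : I ≠ ⊤ := hh.2.ne
  obtain ⟨N, hN⟩ := pow_unbounded_of_one_lt (I.toReal / l) (one_lt_two (α := ℝ))
  rw [div_lt_iff₀ hl] at hN
  set m0 : ℤ := j - (n + 2 : ℕ) with hm0
  have hm0b : (n : ℝ) * 2 ^ m0 ≤ 2 ^ j / 4 := by
    rw [hm0, zpow_sub₀ (by norm_num), zpow_natCast, pow_add]
    have : (n : ℝ) ≤ 2 ^ n := by exact_mod_cast n.lt_two_pow_self.le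
    have h2 : (0 : ℝ) < 2 ^ j := by positivity
    rw [mul_div_assoc', div_le_div_iff₀ (by positivity) (by norm_num)]
    nlinarith
  set m1 : ℤ := max m0 N with hm1
  have hbig : ∀ k : ℤ, m1 ≤ k → I ≤ ENNReal.ofReal (l * (2 ^ k) ^ n) := by
    intro k hk
    have hkN : (N : ℤ) ≤ k := (le_max_right _ _).trans hk
    rw [← ENNReal.ofReal_toReal hIt]
    refine ENNReal.ofReal_le_ofReal ?_
    have h1 : (2 : ℝ) ^ N ≤ 2 ^ k := by
      rw [← zpow_natCast]; exact zpow_le_zpow_right₀ (by norm_num) hkN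
    have h3 : (1 : ℝ) ≤ 2 ^ N := one_le_pow₀ (by norm_num)
    have h2 : (2 : ℝ) ^ k ≤ (2 ^ k) ^ n := le_self_pow₀ (h3.trans h1) hn.ne'
    nlinarith
  set Bad : Cube n → Prop := fun Q => ENNReal.ofReal (l * Q.side ^ n) < ∫⁻ z in Q.toSet, ‖h z‖ₑ
    with hBad
  obtain ⟨J, hJ⟩ := exists_stop (adm_a0 (n := n)) Bad (le_max_left m0 (N : ℤ))
  refine ⟨fun y => gc a0 (J y) y, ⟨fun y => mem_gc _ _ _, ?_, ?_⟩, ⟨2 ^ m1, ?_⟩, ?_, ?_⟩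
  · intro y z hz
    rw [(hJ y).2.2.2.2 z hz]
    exact gc_eq_of_mem hz
  · refine (grid_countable (a0 : Fin n → ℝ)).mono ?_
    rintro _ ⟨y, rfl⟩
    exact ⟨_, _, rfl⟩
  · intro y
    simp only [gc_side]
    exact zpow_le_zpow_right₀ (by norm_num) (hJ y).2.1
  · intro y
    have hsub := gc_subset_succ (adm_a0 (n := n)) (J y) y
    have hnb : ∫⁻ z in (gc a0 (J y + 1) y).toSet, ‖h z‖ₑ ≤
        ENNReal.ofReal (l * (2 ^ (J y + 1)) ^ n) := by
      rcases lt_or_ge (J y) m1 with h1 | h1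
      · have := (hJ y).2.2.2.1 (J y + 1) (by omega) (by omega)
        simpa [hBad, gc_side] using this
      · exact (setLIntegral_le_lintegral _ _).trans (hbig _ (by omega))
    refine (lintegral_mono_set hsub).trans (hnb.trans (le_of_eq ?_))
    rw [gc_side, zpow_add_one₀ (by norm_num), mul_pow]
    congr 1; ring
  · intro y
    rcases (hJ y).2.2.1 with h1 | h1
    · left; simp only [gc_side]; rw [h1]; exact hm0b
    · right; exact h1

theorem cz_bad (hn : 0 < n) {k : Rn n → Rn n → ℝ} {B δ ε : ℝ} (hk : SK n k B δ ε)
    {P : Rn n → Cube n} (hP : PM P) {h : Rn n → ℝ} (hh : Integrable h volume) (x : Rn n)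
    (hx : ∀ y, n * (P y).side ≤ (ε + dist x y) / 4) :
    ‖UU k (fun y => h y - gP P h y) x‖ₑ ≤
      ∫⁻ y, ENNReal.ofReal (B * 2 ^ ((n : ℝ) + δ)) *
        ENNReal.ofReal ((n * (P y).side) ^ δ / (n * (P y).side + dist x y) ^ ((n : ℝ) + δ)) *
          ‖h y - gP P h y‖ₑ := by
  have hB := hk.B_pos
  have hε := hk.eps_pos
  have hδ := hk.delta_pos
  have hb : Integrable (fun y => h y - gP P h y) volume := hh.sub (hP.gP_int hh)
  set b := fun y => h y - gP P h y with hbdef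
  have hcm : Measurable fun y => k x ((P y).pt) := hP.meas fun Q => k x Q.pt
  have hci : Integrable (fun y => k x ((P y).pt) * b y) volume :=
    hb.bdd_mul (c := B / ε ^ n) hcm.aestronglyMeasurable
      (Eventually.of_forall fun y => by simpa using hk.bdd x _)
  have h0 : ∫ y, k x ((P y).pt) * b y = 0 := by
    refine hP.int_zero hci fun y => ?_
    have : ∫ z in (P y).toSet, k x ((P z).pt) * b z = ∫ z in (P y).toSet, k x ((P y).pt) * b z := by
      refine setIntegral_congr_fun (P y).measurableSet fun z hz => ?_
      simp only [hP.eq y z hz]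
    rw [this, integral_const_mul, hP.mean_zero hh y, mul_zero]
  have h1 : UU k b x = ∫ y, (k x y * b y - k x ((P y).pt) * b y) := by
    rw [integral_sub (hk.integrable hb x) hci, h0, sub_zero, UU]
  rw [h1]
  refine (enorm_integral_le_lintegral_enorm _).trans (lintegral_mono fun y => ?_)
  rw [← sub_mul, enorm_mul]
  gcongr
  have hs : 0 < n * (P y).side := mul_pos (by exact_mod_cast hn) (P y).side_pos
  set s := n * (P y).side
  have hd : 0 ≤ dist x y := dist_nonneg
  rw [Real.enorm_eq_ofReal_abs, ← ENNReal.ofReal_mul (by positivity)]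
  refine ENNReal.ofReal_le_ofReal ?_
  have hdc : dist y (P y).pt ≤ s := (P y).dist_le (hP.mem y) (P y).pt_mem
  have := hk.sm2 y (P y).pt x (hdc.trans (by rw [dist_comm y x]; exact hx y))
  refine this.trans ?_
  rw [dist_comm y x]
  have hsx := hx y
  calc B * dist y (P y).pt ^ δ / (ε + dist x y) ^ ((n : ℝ) + δ)
      ≤ B * s ^ δ / ((s + dist x y) / 2) ^ ((n : ℝ) + δ) := by
        have : (s + dist x y) / 2 ≤ ε + dist x y := by linarith
        gcongr
    _ = _ := by
        rw [Real.div_rpow (by positivity) (by norm_num)]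
        field_simp

end SparseCZ

namespace SparseCZ
variable {n : ℕ}

theorem cheb {g : Rn n → ℝ≥0∞} (hg : Measurable g) {l : ℝ} (hl : 0 < l) {C : ℝ≥0∞}
    (h : ∫⁻ x, g x ≤ C) : volume {x | ENNReal.ofReal l ≤ g x} ≤ C / ENNReal.ofReal l := by
  refine (meas_ge_le_lintegral_div hg.aemeasurable (by simpa using hl) (by finiteness)).trans ?_
  gcongr

theorem not_Om {h : Rn n → ℝ≥0∞} {l : ℝ} {x : Rn n} (hx : x ∉ Om h l) {r : ℝ} (hr : 0 < r) :
    ∫⁻ y in Metric.ball x r, h y ≤ ENNReal.ofReal (l * r ^ n) := by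
  by_contra hc
  push Not at hc
  exact hx ⟨r, hr, hc⟩

theorem weak11 {T : (Rn n → ℝ) → Rn n → ℝ} {K : Rn n → Rn n → ℝ} {c δ : ℝ}
    (hT : IsCZO n T K c δ) (hn : 0 < n) : ∃ C : ℝ, 0 < C ∧ ∀ (j : ℤ) (h : Rn n → ℝ), Measurable h →
      Integrable h volume → ∀ R : ℝ, (∀ y, R < ‖y‖ → h y = 0) → ∀ l : ℝ, 0 < l →
      volume {x | l < |UU (kt K (2 ^ j)) h x|} ≤ ENNReal.ofReal (C / l) * ∫⁻ x, ‖h x‖ₑ := by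
  obtain ⟨C2, hC2, hL2⟩ := l2_unif hT
  have hδ := hT.delta_pos
  have hv := vb_nonneg (n := n)
  have hCD := CD_pos (n := n) hδ
  have hBB : 0 < BB n c := (sk_kt hT one_pos).B_pos
  have hnR : (0 : ℝ) < n := by exact_mod_cast hn
  set D1 : ℝ := 4 * C2 * 2 ^ n with hD1
  set D2 : ℝ := 5 ^ n * vb n * (6 * n) ^ n with hD2
  set D3 : ℝ := 4 * (BB n c * 2 ^ ((n : ℝ) + δ) * (CD n δ * vb n)) with hD3
  have hD1' : 0 < D1 := by positivity
  have hD2' : 0 ≤ D2 := by positivity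
  have hD3' : 0 ≤ D3 := by positivity
  refine ⟨D1 + D2 + D3, by positivity, ?_⟩
  intro j h hm hi R hR l hl
  have hε : (0 : ℝ) < 2 ^ j := by positivity
  have hk := sk_kt hT hε
  set k := kt K (2 ^ j) with hkdef
  obtain ⟨P, hP, ⟨S, hS⟩, hPa, hPb⟩ := cz_stop hn hi hl j
  set I := ∫⁻ x, ‖h x‖ₑ with hI
  have hIt : I ≠ ⊤ := hi.2.ne
  set g := gP P h with hg
  have hgm : Measurable g := hP.gP_meas h
  have hgi : Integrable g volume := hP.gP_int hi
  set b := fun y => h y - g y with hbdef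
  have hbm : Measurable b := hm.sub hgm
  have hbi : Integrable b volume := hi.sub hgi
  have hgb : ∀ y, ‖g y‖ₑ ≤ ENNReal.ofReal (2 ^ n * l) := by
    intro y
    have hs := (P y).side_pos
    refine (gP_abs_le P h y).trans ?_
    refine (mul_le_mul_right (hPa y) _).trans ?_
    rw [← ENNReal.ofReal_mul (by positivity)]
    refine ENNReal.ofReal_le_ofReal (le_of_eq ?_)
    field_simp
  have hgs : ∀ y, R + n * S < ‖y‖ → g y = 0 := by
    intro y hy
    have hz : ∀ z ∈ (P y).toSet, h z = 0 := by
      intro z hz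
      refine hR z ?_
      have h1 := (P y).dist_le (hP.mem y) hz
      have h2 : ‖y‖ ≤ ‖z‖ + dist y z := by
        rw [dist_eq_norm]; simpa using norm_add_le z (y - z)
      have := mul_le_mul_of_nonneg_left (hS y) hnR.le
      linarith
    rw [hg, gP, setIntegral_eq_zero_of_forall_eq_zero hz, zero_div]
  have hbl : ∫⁻ y, ‖b y‖ₑ ≤ 2 * I := by
    calc ∫⁻ y, ‖b y‖ₑ ≤ ∫⁻ y, (‖h y‖ₑ + ‖g y‖ₑ) := lintegral_mono fun y => enorm_sub_le
      _ = I + ∫⁻ y, ‖g y‖ₑ := lintegral_add_left hm.enorm _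
      _ ≤ I + I := by gcongr; exact hP.gP_l1 h
      _ = 2 * I := (two_mul I).symm
  -- good part
  have hgood : volume {x | ENNReal.ofReal ((l / 2) ^ 2) ≤ ‖UU k g x‖ₑ ^ 2}
      ≤ ENNReal.ofReal (D1 / l) * I := by
    have h1 : ∫⁻ x, ‖UU k g x‖ₑ ^ 2 ≤ ENNReal.ofReal (C2 * (2 ^ n * l)) * I := by
      refine (hL2 j g hgm hgi _ hgs).trans ?_
      rw [ENNReal.ofReal_mul hC2.le, mul_assoc]
      gcongr
      calc ∫⁻ x, ‖g x‖ₑ ^ 2 ≤ ∫⁻ x, ENNReal.ofReal (2 ^ n * l) * ‖g x‖ₑ := by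
            refine lintegral_mono fun x => ?_
            rw [sq]
            exact mul_le_mul_left (hgb x) _
        _ = ENNReal.ofReal (2 ^ n * l) * ∫⁻ x, ‖g x‖ₑ := lintegral_const_mul _ hgm.enorm
        _ ≤ _ := by gcongr; exact hP.gP_l1 h
    refine (cheb ((hk.measurable_UU hgm).enorm.pow_const 2) (by positivity) h1).trans (le_of_eq ?_)
    rw [mul_comm, mul_div_assoc, ← ENNReal.ofReal_div_of_pos (by positivity), mul_comm]
    congr 2
    rw [hD1]; field_simp; ring
  -- exceptional set
  set l' : ℝ := l / (6 * n) ^ n with hl'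
  have hl'p : 0 < l' := by positivity
  have hOm : volume (Om (fun y => ‖h y‖ₑ) l') ≤ ENNReal.ofReal (D2 / l) * I := by
    refine (weak_max hn _ hIt hl'p).trans (le_of_eq ?_)
    congr 2
    rw [hl', hD2]; field_simp
  have hfar : ∀ x ∉ Om (fun y => ‖h y‖ₑ) l', ∀ y, n * (P y).side ≤ (2 ^ j + dist x y) / 4 := by
    intro x hx y
    have hd : 0 ≤ dist x y := dist_nonneg
    rcases hPb y with h1 | h1
    · linarith
    · by_contra hc
      push Not at hc
      have hs : 0 < n * (P y).side := mul_pos hnR (P y).side_pos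
      have hsp := (P y).side_pos
      have hsub : (P y).toSet ⊆ Metric.ball x (6 * (n * (P y).side)) := by
        intro z hz
        rw [Metric.mem_ball, dist_comm]
        have h2 := dist_triangle x y z
        have h3 := (P y).dist_le (hP.mem y) hz
        linarith
      have h4 := (lintegral_mono_set hsub).trans (not_Om hx (r := 6 * (n * (P y).side)) (by positivity))
      refine absurd (h1.trans_le h4) (not_lt.2 (le_of_eq ?_))
      congr 1
      rw [hl', ← mul_assoc, mul_pow]
      field_simp
      rw [mul_pow, mul_pow]
  -- bad part
  set H : Rn n → ℝ≥0∞ := fun x => ∫⁻ y, ENNReal.ofReal (BB n c * 2 ^ ((n : ℝ) + δ)) *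
        ENNReal.ofReal ((n * (P y).side) ^ δ / (n * (P y).side + dist x y) ^ ((n : ℝ) + δ)) *
          ‖b y‖ₑ with hH
  have hjm : Measurable (fun p : Rn n × Rn n => ENNReal.ofReal (BB n c * 2 ^ ((n : ℝ) + δ)) *
        ENNReal.ofReal ((n * (P p.2).side) ^ δ / (n * (P p.2).side + dist p.1 p.2) ^ ((n : ℝ) + δ)) *
          ‖b p.2‖ₑ) := by
    have hsm : Measurable fun p : Rn n × Rn n => n * (P p.2).side :=
      ((hP.meas fun Q => n * Q.side).comp measurable_snd)
    have hdm : Measurable fun p : Rn n × Rn n => dist p.1 p.2 := continuous_dist.measurable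
    exact ((((hsm.pow_const δ).div ((hsm.add hdm).pow_const _)).ennreal_ofReal).const_mul _).mul
      (hbm.comp measurable_snd).enorm
  have hHm : Measurable H := hjm.lintegral_prod_right' (ν := (volume : Measure (Rn n)))
  have hHi : ∫⁻ x, H x ≤ ENNReal.ofReal (D3 / 2) * I := by
    simp only [hH]
    rw [lintegral_lintegral_swap hjm.aemeasurable]
    calc ∫⁻ y, ∫⁻ x, ENNReal.ofReal (BB n c * 2 ^ ((n : ℝ) + δ)) *
        ENNReal.ofReal ((n * (P y).side) ^ δ / (n * (P y).side + dist x y) ^ ((n : ℝ) + δ)) * ‖b y‖ₑ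
        ≤ ∫⁻ y, ENNReal.ofReal (BB n c * 2 ^ ((n : ℝ) + δ)) * ENNReal.ofReal (CD n δ * vb n) * ‖b y‖ₑ := by
          refine lintegral_mono fun y => ?_
          rw [lintegral_mul_const' _ _ (by finiteness), lintegral_const_mul' _ _ (by finiteness)]
          gcongr
          exact annuli_vol hδ (mul_pos hnR (P y).side_pos) y
      _ = ENNReal.ofReal (BB n c * 2 ^ ((n : ℝ) + δ)) * ENNReal.ofReal (CD n δ * vb n) *
            ∫⁻ y, ‖b y‖ₑ := lintegral_const_mul _ hbm.enorm
      _ ≤ ENNReal.ofReal (BB n c * 2 ^ ((n : ℝ) + δ)) * ENNReal.ofReal (CD n δ * vb n) * (2 * I) := by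
          gcongr
      _ = _ := by
          rw [← ENNReal.ofReal_mul (by positivity), ← mul_assoc,
            show (2 : ℝ≥0∞) = ENNReal.ofReal 2 by simp, ← ENNReal.ofReal_mul (by positivity)]
          congr 2
          rw [hD3]; ring
  have hbad : volume {x | ENNReal.ofReal (l / 2) ≤ H x} ≤ ENNReal.ofReal (D3 / l) * I := by
    refine (cheb hHm (by positivity) hHi).trans (le_of_eq ?_)
    rw [mul_comm, mul_div_assoc, ← ENNReal.ofReal_div_of_pos (by positivity), mul_comm]
    congr 2
    field_simp
  have hsub : {x | l < |UU k h x|} ⊆ ({x | ENNReal.ofReal ((l / 2) ^ 2) ≤ ‖UU k g x‖ₑ ^ 2} ∪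
      Om (fun y => ‖h y‖ₑ) l') ∪ {x | ENNReal.ofReal (l / 2) ≤ H x} := by
    intro x hx
    rw [mem_ofPred_eq] at hx
    have hadd : UU k h x = UU k g x + UU k b x := by
      rw [← hk.UU_add hgi hbi]
      congr 1; ext y; simp [hbdef]
    rcases le_or_gt (l / 2) |UU k g x| with h1 | h1
    · left; left
      rw [mem_ofPred_eq, Real.enorm_eq_ofReal_abs, ← ENNReal.ofReal_pow (abs_nonneg _)]
      gcongr
    · by_cases hxO : x ∈ Om (fun y => ‖h y‖ₑ) l'
      · left; right; exact hxO
      · right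
        have h2 : l / 2 ≤ |UU k b x| := by
          have := abs_add_le (UU k g x) (UU k b x)
          rw [← hadd] at this
          linarith
        have h3 := cz_bad hn hk hP hi x (hfar x hxO)
        rw [mem_ofPred_eq]
        refine le_trans ?_ h3
        rw [Real.enorm_eq_ofReal_abs]
        exact ENNReal.ofReal_le_ofReal h2
  refine (measure_mono hsub).trans ((measure_union_le _ _).trans ?_)
  refine (add_le_add ((measure_union_le _ _).trans (add_le_add hgood hOm)) hbad).trans (le_of_eq ?_)
  rw [← add_mul, ← add_mul, ← ENNReal.ofReal_add (by positivity) (by positivity),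
    ← ENNReal.ofReal_add (by positivity) (by positivity), ← add_div, ← add_div]

end SparseCZ

namespace SparseCZ
variable {n : ℕ}

/-- dilation parameter -/
def LL (n : ℕ) : ℝ := 6 * n + 8

theorem LL_pos : 0 < LL n := by unfold LL; positivity

/-- dilated cube, as a ball -/
def tl (Q : Cube n) : Set (Rn n) := Metric.ball Q.pt (LL n * Q.side)

theorem tl_meas (Q : Cube n) : MeasurableSet (tl Q) := Metric.isOpen_ball.measurableSet

theorem tl_mono {P Q : Cube n} (h : P.pt ∈ Q.toSet) (hs : 2 * P.side ≤ Q.side) : tl P ⊆ tl Q := by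
  intro y hy
  have h1 := Q.dist_le h Q.pt_mem
  rw [tl, Metric.mem_ball] at hy ⊢
  have h2 := dist_triangle y P.pt Q.pt
  have h3 : LL n * (2 * P.side) ≤ LL n * Q.side := mul_le_mul_of_nonneg_left hs LL_pos.le
  have h4 := Q.side_pos
  have h5 : (0 : ℝ) ≤ n := Nat.cast_nonneg n
  have h6 : n * Q.side ≤ LL n * Q.side / 2 := by unfold LL; nlinarith
  linarith

theorem tl_far {P : Cube n} {x y : Rn n} (hx : x ∈ P.toSet) (hy : y ∉ tl P) :
    (5 * n + 8) * P.side ≤ dist x y := by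
  rw [tl, Metric.mem_ball, not_lt] at hy
  have h1 := P.dist_le hx P.pt_mem
  have h2 := dist_triangle y x P.pt
  rw [dist_comm y x] at h2
  unfold LL at hy
  linarith

theorem tl_near {P : Cube n} {x : Rn n} (hx : x ∈ P.toSet) :
    tl P ⊆ Metric.ball x ((LL n + n) * P.side) := by
  intro y hy
  rw [tl, Metric.mem_ball] at hy
  rw [Metric.mem_ball]
  have h1 := P.dist_le hx P.pt_mem
  have h2 := dist_triangle y P.pt x
  rw [dist_comm P.pt x] at h2
  linarith

open Classical in
/-- kernel truncated at `r` -/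
def kr (K : Rn n → Rn n → ℝ) (r : ℝ) (x y : Rn n) : ℝ := if r < dist x y then K x y else 0

theorem kr_le {T : (Rn n → ℝ) → Rn n → ℝ} {K : Rn n → Rn n → ℝ} {c δ : ℝ}
    (hT : IsCZO n T K c δ) {r : ℝ} (hr : 0 < r) (x y : Rn n) : |kr K r x y| ≤ c / r ^ n := by
  have hc := hT.c_pos
  unfold kr
  split_ifs with h
  · refine (hT.size x y ?_).trans ?_
    · intro h'; rw [h', dist_self] at h; linarith
    · gcongr
  · rw [abs_zero]; positivity

theorem kr_meas {T : (Rn n → ℝ) → Rn n → ℝ} {K : Rn n → Rn n → ℝ} {c δ : ℝ}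
    (hT : IsCZO n T K c δ) {r : ℝ} (hr : 0 < r) (x : Rn n) : Measurable (kr K r x) := by
  have h2 : 0 < r / 2 := by positivity
  have : kr K r x = {y | r < dist x y}.indicator (kt K (r / 2) x) := by
    ext y
    by_cases h : r < dist x y
    · rw [indicator_of_mem (by exact h), kr, if_pos h, kt_eq K h2 (by linarith)]
    · rw [indicator_of_notMem (by exact h), kr, if_neg h]
  rw [this]
  refine ((sk_kt hT h2).cont_right x).measurable.indicator ?_
  exact (isOpen_lt continuous_const (continuous_const.dist continuous_id)).measurableSet

theorem kr_int {T : (Rn n → ℝ) → Rn n → ℝ} {K : Rn n → Rn n → ℝ} {c δ : ℝ}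
    (hT : IsCZO n T K c δ) {r : ℝ} (hr : 0 < r) {h : Rn n → ℝ} (hh : Integrable h volume)
    (x : Rn n) : Integrable (fun y => kr K r x y * h y) volume :=
  hh.bdd_mul (kr_meas hT hr x).aestronglyMeasurable
    (Eventually.of_forall fun y => by simpa using kr_le hT hr x y)

theorem kr_UU_le {T : (Rn n → ℝ) → Rn n → ℝ} {K : Rn n → Rn n → ℝ} {c δ : ℝ}
    (hT : IsCZO n T K c δ) {r : ℝ} (hr : 0 < r) (h : Rn n → ℝ) (x : Rn n) :
    ‖UU (kr K r) h x‖ₑ ≤ ENNReal.ofReal (c / r ^ n) * ∫⁻ y, ‖h y‖ₑ := by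
  rw [UU]
  refine (enorm_integral_le_lintegral_enorm _).trans ?_
  rw [← lintegral_const_mul' _ _ ENNReal.ofReal_ne_top]
  refine lintegral_mono fun y => ?_
  rw [enorm_mul]
  gcongr
  rw [Real.enorm_eq_ofReal_abs]
  exact ENNReal.ofReal_le_ofReal (kr_le hT hr x y)

theorem kr_UU_split {T : (Rn n → ℝ) → Rn n → ℝ} {K : Rn n → Rn n → ℝ} {c δ : ℝ}
    (hT : IsCZO n T K c δ) {r : ℝ} (hr : 0 < r) {h : Rn n → ℝ} (hh : Integrable h volume)
    {s : Set (Rn n)} (hs : MeasurableSet s) (x : Rn n) :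
    UU (kr K r) h x = UU (kr K r) (s.indicator h) x + UU (kr K r) (sᶜ.indicator h) x := by
  rw [UU, UU, UU, ← integral_add (kr_int hT hr (hh.indicator hs) x)
    (kr_int hT hr (hh.indicator hs.compl) x)]
  congr 1; ext y
  rw [← mul_add, ← Pi.add_apply, indicator_self_add_compl]

theorem SK.UU_split {k : Rn n → Rn n → ℝ} {B δ ε : ℝ} (hk : SK n k B δ ε) {h : Rn n → ℝ}
    (hh : Integrable h volume) {s : Set (Rn n)} (hs : MeasurableSet s) (x : Rn n) :
    UU k h x = UU k (s.indicator h) x + UU k (sᶜ.indicator h) x := by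
  rw [← hk.UU_add (hh.indicator hs) (hh.indicator hs.compl)]
  congr 1; ext y
  rw [← Pi.add_apply, indicator_self_add_compl]

theorem lint_ind (s : Set (Rn n)) (hs : MeasurableSet s) (h : Rn n → ℝ) :
    ∫⁻ y, ‖s.indicator h y‖ₑ = ∫⁻ y in s, ‖h y‖ₑ := by
  rw [← lintegral_indicator hs]
  refine lintegral_congr fun y => ?_
  rw [enorm_indicator_eq_indicator_enorm]

theorem cotlar {T : (Rn n → ℝ) → Rn n → ℝ} {K : Rn n → Rn n → ℝ} {c δ : ℝ}
    (hT : IsCZO n T K c δ) (hn : 0 < n) : ∃ C : ℝ, 0 < C ∧ ∀ (j0 : ℤ) (h : Rn n → ℝ),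
      Measurable h → Integrable h volume → ∀ R : ℝ, (∀ y, R < ‖y‖ → h y = 0) → ∀ l : ℝ, 0 < l →
      ∀ (E : Set (Rn n)) (P : Cube n), 2 ^ j0 ≤ P.side →
      (∀ x ∈ P.toSet, x ∉ E → |UU (kt K (2 ^ j0)) h x| ≤ l ∧ x ∉ Om (fun y => ‖h y‖ₑ) l) →
      volume (P.toSet ∩ E) ≤ volume P.toSet / 2 →
      (∫⁻ y in tl P, ‖h y‖ₑ ≤ ENNReal.ofReal (C * l * P.side ^ n)) ∧
      ∀ x ∈ P.toSet, ∀ r : ℝ, P.side ≤ r → r < 2 * P.side → |UU (kr K r) h x| ≤ C * l := by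
  obtain ⟨Cw, hCw, hweak⟩ := weak11 hT hn
  have hc := hT.c_pos
  have hδ := hT.delta_pos
  have hnR : (0 : ℝ) < n := by exact_mod_cast hn
  have hCD := CD_pos (n := n) hδ
  have hBB : 0 < BB n c := (sk_kt hT one_pos).B_pos
  have hLp := LL_pos (n := n)
  set M : ℝ := (LL n + n) ^ n with hM
  have hMp : 0 < M := by positivity
  set C2 : ℝ := 4 * Cw * M with hC2
  have hC2p : 0 < C2 := by positivity
  set C3 : ℝ := BB n c * 2 ^ ((n : ℝ) + δ) * CD n δ with hC3
  have hC3p : 0 < C3 := by positivity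
  refine ⟨M + (c * M + (1 + C2 + C3)), by positivity, ?_⟩
  intro j0 h hm hi R hR l hl E P hPs hE hvol
  have hε : (0 : ℝ) < 2 ^ j0 := by positivity
  have hk := sk_kt hT hε
  set k := kt K (2 ^ j0) with hkdef
  have hs := P.side_pos
  have hvP : volume P.toSet = ENNReal.ofReal (P.side ^ n) := P.volume_eq
  have hvP0 : volume P.toSet ≠ 0 := by rw [hvP]; simp; positivity
  have hvPt : volume P.toSet ≠ ⊤ := by rw [hvP]; finiteness
  -- a point outside E
  have hx2 : ∃ x ∈ P.toSet, x ∉ E := by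
    by_contra hcon
    push Not at hcon
    rw [inter_eq_left.2 hcon] at hvol
    exact absurd hvol (not_le.2 (ENNReal.half_lt_self hvP0 hvPt))
  have hloc : ∀ x ∈ P.toSet, x ∉ E →
      ∫⁻ y in tl P, ‖h y‖ₑ ≤ ENNReal.ofReal (M * l * P.side ^ n) := by
    intro x hxP hxE
    refine (lintegral_mono_set (tl_near hxP)).trans ((not_Om (hE x hxP hxE).2 (by positivity)).trans
      (le_of_eq ?_))
    rw [mul_pow, hM]; congr 1; ring
  obtain ⟨x2, hx2P, hx2E⟩ := hx2
  have hloc2 := hloc x2 hx2P hx2E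
  refine ⟨hloc2.trans (ENNReal.ofReal_le_ofReal ?_), ?_⟩
  · gcongr
    have : 0 < c * M + (1 + C2 + C3) := by positivity
    linarith
  -- a better point
  have htm := tl_meas P
  have hi1 := hi.indicator htm
  have hi2 := hi.indicator htm.compl
  have hx1 : ∃ x ∈ P.toSet, x ∉ E ∧ |UU k ((tl P).indicator h) x| ≤ C2 * l := by
    by_contra hcon
    push Not at hcon
    have hsub : P.toSet ⊆ (P.toSet ∩ E) ∪ {x | C2 * l < |UU k ((tl P).indicator h) x|} := by
      intro x hx
      by_cases hxE : x ∈ E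
      · left; exact ⟨hx, hxE⟩
      · right; exact hcon x hx hxE
    have hw := hweak j0 _ (hm.indicator htm) hi1 R (by
      intro y hy
      rw [indicator_apply_eq_zero]
      intro _; exact hR y hy) (C2 * l) (by positivity)
    rw [lint_ind _ htm] at hw
    have hw2 : volume {x | C2 * l < |UU k ((tl P).indicator h) x|} ≤ volume P.toSet / 4 := by
      refine hw.trans ((mul_le_mul_right hloc2 _).trans (le_of_eq ?_))
      rw [← ENNReal.ofReal_mul (by positivity), hvP,
        show (4 : ℝ≥0∞) = ENNReal.ofReal 4 by simp, ← ENNReal.ofReal_div_of_pos (by norm_num)]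
      congr 1
      rw [hC2]; field_simp
    have hfin := (measure_mono hsub).trans ((measure_union_le _ _).trans (add_le_add hvol hw2))
    rw [hvP, show (4 : ℝ≥0∞) = ENNReal.ofReal 4 by simp, show (2 : ℝ≥0∞) = ENNReal.ofReal 2 by simp,
      ← ENNReal.ofReal_div_of_pos (by norm_num), ← ENNReal.ofReal_div_of_pos (by norm_num),
      ← ENNReal.ofReal_add (by positivity) (by positivity),
      ENNReal.ofReal_le_ofReal_iff (by positivity)] at hfin
    have : 0 < P.side ^ n := by positivity
    linarith
  obtain ⟨x', hx'P, hx'E, hx'U⟩ := hx1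
  obtain ⟨hU, hOm⟩ := hE x' hx'P hx'E
  intro x hx r hr1 hr2
  have hrp : 0 < r := hs.trans_le hr1
  -- local part
  have hA : |UU (kr K r) ((tl P).indicator h) x| ≤ c * M * l := by
    have h1 := kr_UU_le hT hrp ((tl P).indicator h) x
    rw [lint_ind _ htm] at h1
    have h2 := h1.trans (mul_le_mul_right hloc2 _)
    rw [← ENNReal.ofReal_mul (by positivity), Real.enorm_eq_ofReal_abs,
      ENNReal.ofReal_le_ofReal_iff (by positivity)] at h2
    refine h2.trans ?_
    calc c / r ^ n * (M * l * P.side ^ n) ≤ c / P.side ^ n * (M * l * P.side ^ n) := by gcongr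
      _ = c * M * l := by field_simp
  -- far part
  have hfar : UU (kr K r) ((tl P)ᶜ.indicator h) x = UU k ((tl P)ᶜ.indicator h) x := by
    refine UU_congr fun y => ?_
    by_cases hy : y ∈ tl P
    · rw [indicator_of_notMem (by simpa using hy)]; simp
    · have hd := tl_far hx hy
      have h5 : (8 : ℝ) * P.side ≤ (5 * n + 8) * P.side := by gcongr; linarith
      rw [hkdef, kt_eq K hε (by linarith), kr, if_pos (by linarith)]
  have hU' : |UU k ((tl P)ᶜ.indicator h) x'| ≤ l + C2 * l := by
    have h1 := hk.UU_split hi htm x'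
    have h2 : UU k ((tl P)ᶜ.indicator h) x' = UU k h x' - UU k ((tl P).indicator h) x' := by
      linarith
    rw [h2]
    exact (abs_sub _ _).trans (add_le_add hU hx'U)
  have hdiff : |UU k ((tl P)ᶜ.indicator h) x - UU k ((tl P)ᶜ.indicator h) x'| ≤ C3 * l := by
    have hsn : 0 < n * P.side := by positivity
    rw [UU, UU, ← integral_sub (hk.integrable hi2 x) (hk.integrable hi2 x')]
    have h1 := enorm_integral_le_lintegral_enorm (μ := volume) (fun y =>
      k x y * (tl P)ᶜ.indicator h y - k x' y * (tl P)ᶜ.indicator h y)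
    have h2 : ∫⁻ y, ‖k x y * (tl P)ᶜ.indicator h y - k x' y * (tl P)ᶜ.indicator h y‖ₑ ≤
        ∫⁻ y, ENNReal.ofReal (BB n c * 2 ^ ((n : ℝ) + δ)) *
          (ENNReal.ofReal ((n * P.side) ^ δ / (n * P.side + dist x' y) ^ ((n : ℝ) + δ)) * ‖h y‖ₑ) := by
      refine lintegral_mono fun y => ?_
      by_cases hy : y ∈ tl P
      · rw [indicator_of_notMem (by simpa using hy)]; simp
      · rw [indicator_of_mem (by simpa using hy), ← sub_mul, enorm_mul, ← mul_assoc]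
        gcongr
        have hd := tl_far hx'P hy
        have hd0 : 0 ≤ dist x' y := dist_nonneg
        have hxx := P.dist_le hx'P hx
        rw [← ENNReal.ofReal_mul (by positivity), Real.enorm_eq_ofReal_abs]
        refine ENNReal.ofReal_le_ofReal ?_
        have hsd : n * P.side ≤ dist x' y / 4 := by nlinarith
        rw [abs_sub_comm]
        refine (hk.sm1 x' x y (by linarith)).trans ?_
        calc BB n c * dist x' x ^ δ / (2 ^ j0 + dist x' y) ^ ((n : ℝ) + δ)
            ≤ BB n c * (n * P.side) ^ δ / ((n * P.side + dist x' y) / 2) ^ ((n : ℝ) + δ) := by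
              have : (n * P.side + dist x' y) / 2 ≤ 2 ^ j0 + dist x' y := by linarith
              gcongr
          _ = _ := by
              rw [Real.div_rpow (by positivity) (by norm_num)]
              field_simp
    have h3 := annuli hδ hsn hl.le hm.enorm x' (fun ρ hρ => not_Om hOm hρ)
    rw [lintegral_const_mul' _ _ (by finiteness)] at h2
    have h4 := (h1.trans h2).trans (mul_le_mul_right h3 _)
    rw [← ENNReal.ofReal_mul (by positivity), Real.enorm_eq_ofReal_abs,
      ENNReal.ofReal_le_ofReal_iff (by positivity)] at h4
    refine h4.trans (le_of_eq ?_)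
    rw [hC3]; ring
  rw [kr_UU_split hT hrp hi htm x, hfar]
  have h6 := abs_add_le (UU (kr K r) ((tl P).indicator h) x) (UU k ((tl P)ᶜ.indicator h) x)
  have h7 := abs_add_le (UU k ((tl P)ᶜ.indicator h) x - UU k ((tl P)ᶜ.indicator h) x')
    (UU k ((tl P)ᶜ.indicator h) x')
  rw [sub_add_cancel] at h7
  nlinarith [mul_pos hMp hl]

end SparseCZ

namespace SparseCZ
variable {n : ℕ}

theorem norm_le_of_mem_gc {α : _} {k : ℤ} {z x : Rn n} (hx : x ∈ (gc α k z).toSet) :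
    ‖x‖ ≤ ‖z‖ + n * 2 ^ k := by
  have h1 := Cube.dist_le _ hx (mem_gc α k z)
  rw [gc_side] at h1
  have h2 : ‖x‖ ≤ dist x z + ‖z‖ := by
    have := norm_le_norm_add_norm_sub z x
    rw [dist_eq_norm]; rw [norm_sub_rev] at this; linarith
  linarith

theorem bad_family {α : _} (hα : Adm (n := n) α) (E : Set (Rn n)) {m0 m1 : ℤ} (hm : m0 ≤ m1)
    (z : Rn n) :
    ∃ (J : Rn n → ℤ) (F : Finset (Cube n)),
      (∀ P ∈ F, ∃ y ∈ (gc α (m1+1) z).toSet, ∃ k, m0 ≤ k ∧ k ≤ m1 ∧ P = gc α k y) ∧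
      (∀ x ∈ (gc α (m1+1) z).toSet, m0 ≤ J x ∧ J x ≤ m1 ∧
        (∀ k, J x < k → k ≤ m1 →
          volume ((gc α k x).toSet ∩ E) ≤ volume (gc α k x).toSet / 2) ∧
        (gc α (J x) x ∈ F ∨ (J x = m0 ∧
          volume ((gc α m0 x).toSet ∩ E) ≤ volume (gc α m0 x).toSet / 2))) ∧
      (F : Set (Cube n)).PairwiseDisjoint Cube.toSet ∧
      ∑ P ∈ F, volume P.toSet ≤ 2 * volume E := by
  obtain ⟨J, hJ⟩ := exists_stop hα (fun P => volume P.toSet / 2 < volume (P.toSet ∩ E)) hm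
  set B : Set (Cube n) := {P | ∃ y ∈ (gc α (m1+1) z).toSet, P = gc α (J y) y ∧
    volume P.toSet / 2 < volume (P.toSet ∩ E)} with hB
  have hfin : B.Finite := by
    refine Set.Finite.subset ((Set.finite_Icc m0 m1).biUnion
      (fun k _ => finite_gc α k (‖z‖ + n * 2 ^ (m1+1)))) ?_
    rintro P ⟨y, hy, rfl, -⟩
    simp only [mem_iUnion]
    exact ⟨J y, ⟨(hJ y).1, (hJ y).2.1⟩, y, norm_le_of_mem_gc hy, rfl⟩
  have hdis : B.PairwiseDisjoint Cube.toSet := by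
    rintro P ⟨y, hy, rfl, -⟩ P' ⟨y', hy', rfl, -⟩ hne
    rw [Function.onFun, Set.disjoint_left]
    intro w hw hw'
    apply hne
    rw [← gc_eq_of_mem hw, ← gc_eq_of_mem hw', ← (hJ y).2.2.2.2 w hw, ← (hJ y').2.2.2.2 w hw']
  refine ⟨J, hfin.toFinset, ?_, ?_, ?_, ?_⟩
  · intro P hP
    rw [hfin.mem_toFinset] at hP
    obtain ⟨y, hy, rfl, -⟩ := hP
    exact ⟨y, hy, J y, (hJ y).1, (hJ y).2.1, rfl⟩
  · intro x hx
    obtain ⟨h1, h2, h3, h4, h5⟩ := hJ x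
    refine ⟨h1, h2, fun k hk hk' => not_lt.1 (h4 k hk hk'), ?_⟩
    by_cases hb : volume (gc α (J x) x).toSet / 2 < volume ((gc α (J x) x).toSet ∩ E)
    · left
      rw [hfin.mem_toFinset]
      exact ⟨x, hx, rfl, hb⟩
    · right
      have : J x = m0 := h3.resolve_right hb
      refine ⟨this, ?_⟩
      rw [this] at hb
      exact not_lt.1 hb
  · rw [hfin.coe_toFinset]; exact hdis
  · have hd2 : Set.PairwiseDisjoint (hfin.toFinset : Set (Cube n)) Cube.toSet := by
      rw [hfin.coe_toFinset]; exact hdis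
    calc ∑ P ∈ hfin.toFinset, volume P.toSet
        ≤ ∑ P ∈ hfin.toFinset, 2 * (volume.restrict E) P.toSet := by
          refine Finset.sum_le_sum fun P hP => ?_
          rw [hfin.mem_toFinset] at hP
          obtain ⟨y, hy, -, hb⟩ := hP
          rw [Measure.restrict_apply P.measurableSet]
          rw [mul_comm]
          exact (ENNReal.div_le_iff_le_mul (Or.inl (by simp)) (Or.inl (by simp))).1 hb.le
      _ = 2 * (volume.restrict E) (⋃ P ∈ hfin.toFinset, P.toSet) := by
          rw [measure_biUnion_finset hd2 (fun P _ => P.measurableSet), Finset.mul_sum]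
      _ ≤ 2 * volume E := by
          refine (mul_le_mul_right ((measure_mono (subset_univ _)).trans (Measure.restrict_apply_univ E).le) _)

/-- dilated average -/
def aP (f : Rn n → ℝ) (P : Cube n) : ℝ≥0∞ :=
  ENNReal.ofReal ((P.side ^ n)⁻¹) * ∫⁻ y in tl P, ‖f y‖ₑ

theorem kr_UU_aP {T : (Rn n → ℝ) → Rn n → ℝ} {K : Rn n → Rn n → ℝ} {c δ : ℝ}
    (hT : IsCZO n T K c δ) (f : Rn n → ℝ) {Q : Cube n} {r : ℝ} (hr : Q.side ≤ r) (x : Rn n) :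
    ‖UU (kr K r) ((tl Q).indicator f) x‖ₑ ≤ ENNReal.ofReal c * aP f Q := by
  have hs := Q.side_pos
  refine (kr_UU_le hT (hs.trans_le hr) _ x).trans ?_
  rw [lint_ind _ (tl_meas Q), aP, ← mul_assoc, ← ENNReal.ofReal_mul hT.c_pos.le, div_eq_mul_inv]
  have := hT.c_pos
  gcongr

theorem exists_scale {r : ℝ} (hr : 0 < r) : ∃ k : ℤ, (2:ℝ) ^ k ≤ r ∧ r < 2 ^ (k+1) := by
  obtain ⟨k, hk⟩ := exists_mem_Ico_zpow hr (one_lt_two)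
  exact ⟨k, hk.1, hk.2⟩

theorem UU_far {K : Rn n → Rn n → ℝ} {P : Cube n} {x : Rn n} (hx : x ∈ P.toSet)
    {r : ℝ} (hr : r ≤ 2 * P.side) (h : Rn n → ℝ) :
    UU (kr K r) ((tl P)ᶜ.indicator h) x = UU (kr K (2 * P.side)) ((tl P)ᶜ.indicator h) x := by
  unfold UU
  congr 1
  ext y
  by_cases hy : y ∈ tl P
  · simp [hy]
  · have := tl_far hx hy
    have hs := P.side_pos
    have h2 : 2 * P.side < dist x y := by
      have : (0:ℝ) ≤ n := by positivity
      nlinarith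
    rw [kr, kr, if_pos h2, if_pos (by linarith)]
end SparseCZ

namespace SparseCZ
variable {n : ℕ}

theorem one_step {T : (Rn n → ℝ) → Rn n → ℝ} {K : Rn n → Rn n → ℝ} {c δ : ℝ}
    (hT : IsCZO n T K c δ) (hn : 0 < n) : ∃ C : ℝ, c ≤ C ∧ ∀ (j0 m1 : ℤ), j0 ≤ m1 →
      ∀ (f : Rn n → ℝ), Measurable f → Integrable f volume → ∀ z : Rn n,
      ∃ F : Finset (Cube n),
        (∀ P ∈ F, ∃ y ∈ (gc a0 (m1+1) z).toSet, ∃ k, j0 ≤ k ∧ k ≤ m1 ∧ P = gc a0 k y) ∧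
        (F : Set (Cube n)).PairwiseDisjoint Cube.toSet ∧
        ∑ P ∈ F, volume P.toSet ≤ volume (gc a0 (m1+1) z).toSet / 2 ∧
        ∀ x ∈ (gc a0 (m1+1) z).toSet, ∀ r : ℝ, 2 ^ j0 ≤ r →
          ‖UU (kr K r) ((tl (gc a0 (m1+1) z)).indicator f) x‖ₑ
            ≤ ENNReal.ofReal C * aP f (gc a0 (m1+1) z) ∨
          ∃ P ∈ F, x ∈ P.toSet ∧ ‖UU (kr K r) ((tl (gc a0 (m1+1) z)).indicator f) x‖ₑ
            ≤ ENNReal.ofReal C * aP f (gc a0 (m1+1) z) +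
              ‖UU (kr K r) ((tl P).indicator f) x‖ₑ := by
  obtain ⟨Cw, hCw, hweak⟩ := weak11 hT hn
  obtain ⟨Cc, hCc, hcot⟩ := cotlar hT hn
  have hc := hT.c_pos
  have hvb : 0 ≤ vb n := vb_nonneg
  set C1 : ℝ := 4 * (Cw + 5 ^ n * vb n) with hC1
  have hC1p : 0 < C1 := by positivity
  set G : ℝ := c + Cc * C1 with hG
  have hGp : 0 < G := by positivity
  set C : ℝ := G + (c + c * (Cc * C1)) with hCdef
  refine ⟨C, by have : 0 < Cc * C1 := by positivity
                have : 0 < c * (Cc * C1) := by positivity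
                linarith, ?_⟩
  intro j0 m1 hjm f hfm hfi z
  set Q := gc a0 (m1+1) z with hQ
  set h := (tl Q).indicator f with hh
  have hQs : Q.side = 2 ^ (m1+1) := gc_side _ _ _
  have hQp := Q.side_pos
  have hhm : Measurable h := hfm.indicator (tl_meas Q)
  have hhi : Integrable h volume := hfi.indicator (tl_meas Q)
  set A : ℝ := (∫⁻ y in tl Q, ‖f y‖ₑ).toReal with hA
  have hAfin : ∫⁻ y in tl Q, ‖f y‖ₑ ≠ ⊤ :=
    ((setLIntegral_le_lintegral _ _).trans_lt hfi.2).ne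
  have hAe : ∫⁻ y in tl Q, ‖f y‖ₑ = ENNReal.ofReal A := (ENNReal.ofReal_toReal hAfin).symm
  have hA0 : 0 ≤ A := ENNReal.toReal_nonneg
  have hhA : ∫⁻ y, ‖h y‖ₑ = ENNReal.ofReal A := by rw [hh, lint_ind _ (tl_meas Q), hAe]
  have hCge : G ≤ C := by rw [hCdef]; linarith [show 0 < c * (Cc * C1) by positivity]
  rcases hA0.eq_or_lt with hAz | hApos
  · refine ⟨∅, by simp, by simp, by simp, fun x hx r hr => Or.inl ?_⟩
    have hr0 : 0 < r := lt_of_lt_of_le (by positivity) hr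
    refine (kr_UU_le hT hr0 _ x).trans ?_
    rw [hhA, ← hAz]; simp
  set l : ℝ := C1 * A / Q.side ^ n with hl
  have hlp : 0 < l := by positivity
  set E : Set (Rn n) := {x | l < |UU (kt K (2 ^ j0)) h x|} ∪ Om (fun y => ‖h y‖ₑ) l with hE
  have hsupp : ∀ y, ‖Q.pt‖ + LL n * Q.side < ‖y‖ → h y = 0 := by
    intro y hy
    refine indicator_of_notMem ?_ _
    intro hy'
    rw [tl, Metric.mem_ball, dist_eq_norm] at hy'
    have := norm_le_norm_add_norm_sub Q.pt y
    rw [norm_sub_rev] at this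
    linarith
  have hEv : volume E ≤ volume Q.toSet / 4 := by
    refine (measure_union_le _ _).trans ?_
    have e1 := hweak j0 h hhm hhi _ hsupp l hlp
    have e2 := weak_max hn (fun y => ‖h y‖ₑ) (by rw [hhA]; simp) hlp
    refine (add_le_add e1 e2).trans ?_
    rw [hhA, Cube.volume_eq, ← ENNReal.ofReal_mul (by positivity),
      ← ENNReal.ofReal_mul (by positivity), ← ENNReal.ofReal_add (by positivity) (by positivity),
      show (4:ℝ≥0∞) = ENNReal.ofReal 4 by simp, ← ENNReal.ofReal_div_of_pos (by norm_num)]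
    apply ENNReal.ofReal_le_ofReal
    apply le_of_eq
    rw [hl]
    have : Cw + 5 ^ n * vb n = C1 / 4 := by rw [hC1]; ring
    rw [show Cw / (C1 * A / Q.side ^ n) * A + 5 ^ n * vb n / (C1 * A / Q.side ^ n) * A
      = (Cw + 5 ^ n * vb n) / (C1 * A / Q.side ^ n) * A by ring, this]
    field_simp
  have hEout : ∀ x, x ∉ E → |UU (kt K (2 ^ j0)) h x| ≤ l ∧ x ∉ Om (fun y => ‖h y‖ₑ) l := by
    intro x hx
    rw [hE, mem_union, not_or] at hx
    exact ⟨not_lt.1 hx.1, hx.2⟩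
  obtain ⟨J, F, hF1, hF2, hF3, hF4⟩ := bad_family adm_a0 E hjm z
  have haP : aP f Q = ENNReal.ofReal (A / Q.side ^ n) := by
    rw [aP, hAe, ← ENNReal.ofReal_mul (by positivity)]
    congr 1; ring
  have hlaP : ∀ t : ℝ, 0 ≤ t → ENNReal.ofReal (t * l) = ENNReal.ofReal (t * C1) * aP f Q := by
    intro t ht
    rw [haP, ← ENNReal.ofReal_mul (by positivity), hl]; congr 1; ring
  -- good scales
  have good : ∀ x ∈ Q.toSet, ∀ k : ℤ, j0 ≤ k →
      (k ≤ m1 → volume ((gc a0 k x).toSet ∩ E) ≤ volume (gc a0 k x).toSet / 2) →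
      ∀ r : ℝ, 2 ^ k ≤ r → r < 2 ^ (k+1) →
      ‖UU (kr K r) h x‖ₑ ≤ ENNReal.ofReal G * aP f Q := by
    intro x hx k hk hgood r hr1 hr2
    rcases le_or_gt k m1 with hkm | hkm
    · have h3 := (hcot j0 h hhm hhi _ hsupp l hlp E (gc a0 k x)
        (by rw [gc_side]; exact zpow_le_zpow_right₀ (by norm_num) hk)
        (fun y _ hy => hEout y hy) (hgood hkm)).2 x (mem_gc _ _ _) r (by rw [gc_side]; exact hr1)
        (by rw [gc_side]; rw [zpow_add_one₀ (by norm_num)] at hr2; linarith)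
      rw [← Real.norm_eq_abs, ← ofReal_norm] at *
      refine (ENNReal.ofReal_le_ofReal h3).trans ?_
      rw [hlaP _ hCc.le]
      gcongr
      rw [hG]; linarith
    · refine (kr_UU_aP hT f (Q := Q) (r := r) ?_ x).trans ?_
      · rw [hQs]
        refine le_trans (zpow_le_zpow_right₀ (by norm_num) ?_) hr1
        omega
      · gcongr
        rw [hG]; linarith [show 0 < Cc * C1 by positivity]
  refine ⟨F, hF1, hF3, ?_, ?_⟩
  · refine hF4.trans ?_
    refine (mul_le_mul_right hEv 2).trans (le_of_eq ?_)
    rw [Cube.volume_eq, show (4:ℝ≥0∞) = ENNReal.ofReal 4 by simp,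
      ← ENNReal.ofReal_div_of_pos (by norm_num), show (2:ℝ≥0∞) = ENNReal.ofReal 2 by simp,
      ← ENNReal.ofReal_div_of_pos (by norm_num), ← ENNReal.ofReal_mul (by norm_num)]
    congr 1; ring
  intro x hx r hr
  have hr0 : 0 < r := lt_of_lt_of_le (by positivity) hr
  obtain ⟨k, hk1, hk2⟩ := exists_scale hr0
  have hjk : j0 ≤ k := by
    by_contra hcon
    have : (2:ℝ) ^ (k+1) ≤ 2 ^ j0 := zpow_le_zpow_right₀ (by norm_num) (by omega)
    linarith
  obtain ⟨hJ1, hJ2, hJ3, hJ4⟩ := hF2 x hx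
  have wrap : ‖UU (kr K r) h x‖ₑ ≤ ENNReal.ofReal G * aP f Q →
      ‖UU (kr K r) h x‖ₑ ≤ ENNReal.ofReal C * aP f Q := fun h' => h'.trans (by gcongr)
  rcases lt_or_ge (J x) k with hJk | hJk
  · exact Or.inl (wrap (good x hx k hjk (hJ3 k hJk) r hk1 hk2))
  rcases hJ4 with hmem | ⟨hJ0, hg⟩
  swap
  · have : k = j0 := by omega
    subst this
    exact Or.inl (wrap (good x hx k hjk (fun _ => hg) r hk1 hk2))
  right
  set P := gc a0 (J x) x with hP
  have hPs : P.side = 2 ^ (J x) := gc_side _ _ _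
  have hxP : x ∈ P.toSet := mem_gc _ _ _
  refine ⟨P, hmem, hxP, ?_⟩
  have hPQ : P.toSet ⊆ Q.toSet := by
    rw [hQ, ← gc_eq_of_mem hx]
    exact gc_subset adm_a0 (by omega) x
  have htPQ : tl P ⊆ tl Q := by
    refine tl_mono (hPQ P.pt_mem) ?_
    rw [hPs, hQs, zpow_add_one₀ (by norm_num), mul_comm]
    gcongr
    · norm_num
  have hPh : (tl P).indicator h = (tl P).indicator f := by
    rw [hh, indicator_indicator, inter_eq_left.2 htPQ]
  have hr' : 2 * P.side = 2 ^ (J x + 1) := by rw [hPs, zpow_add_one₀ (by norm_num)]; ring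
  have hPp := P.side_pos
  have hr2 : r ≤ 2 * P.side := by
    rw [hr']
    exact hk2.le.trans (zpow_le_zpow_right₀ (by norm_num) (by omega))
  have s1 := kr_UU_split hT hr0 hhi (tl_meas P) x
  have s2 := kr_UU_split hT (r := 2 * P.side) (by positivity) hhi (tl_meas P) x
  rw [hPh] at s1 s2
  rw [UU_far hxP hr2] at s1
  have s3 : UU (kr K r) h x = (UU (kr K (2 * P.side)) h x -
      UU (kr K (2 * P.side)) ((tl P).indicator f) x) + UU (kr K r) ((tl P).indicator f) x := by
    rw [s1, s2]; ring
  rw [s3]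
  refine (enorm_add_le _ _).trans ?_
  refine add_le_add ?_ le_rfl
  refine (enorm_sub_le).trans ?_
  rw [hCdef, ENNReal.ofReal_add hGp.le (by positivity), add_mul]
  refine add_le_add ?_ ?_
  · rw [hr']
    refine good x hx (J x + 1) (by omega) (hJ3 (J x + 1) (by omega)) _ le_rfl ?_
    exact zpow_lt_zpow_right₀ (by norm_num) (by omega)
  · refine (kr_UU_le hT (by positivity) _ x).trans ?_
    rw [lint_ind _ (tl_meas P)]
    have hPI : ∫⁻ y in tl P, ‖f y‖ₑ ≤
        ENNReal.ofReal ((2 * P.side) ^ n) * (ENNReal.ofReal (1 + Cc * C1) * aP f Q) := by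
      rcases hJ2.lt_or_eq with hlt | heq
      · have h3 := (hcot j0 h hhm hhi _ hsupp l hlp E (gc a0 (J x + 1) x)
          (by rw [gc_side]; exact zpow_le_zpow_right₀ (by norm_num) (by omega))
          (fun y _ hy => hEout y hy) (hJ3 (J x + 1) (by omega) (by omega))).1
        rw [gc_side, ← hr'] at h3
        have htt : tl P ⊆ tl (gc a0 (J x + 1) x) := by
          refine tl_mono (gc_subset adm_a0 (by omega) x P.pt_mem) ?_
          rw [hr']; exact (gc_side _ _ _).ge
        calc ∫⁻ y in tl P, ‖f y‖ₑ = ∫⁻ y in tl P, ‖h y‖ₑ := by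
              refine setLIntegral_congr_fun (tl_meas P) fun y hy => ?_
              simp only [hh, indicator_of_mem (htPQ hy)]
          _ ≤ _ := lintegral_mono_set htt
          _ ≤ _ := h3
          _ = ENNReal.ofReal ((2 * P.side) ^ n) * ENNReal.ofReal (Cc * l) := by
              rw [← ENNReal.ofReal_mul (by positivity)]; congr 1; ring
          _ ≤ _ := by
              rw [hlaP _ hCc.le]
              gcongr
              linarith
      · rw [hr', heq, ← hQs, haP, ← ENNReal.ofReal_mul (by positivity),
          ← ENNReal.ofReal_mul (by positivity)]
        refine (lintegral_mono_set htPQ).trans ?_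
        rw [hAe]
        apply ENNReal.ofReal_le_ofReal
        have : Q.side ^ n * ((1 + Cc * C1) * (A / Q.side ^ n)) = (1 + Cc * C1) * A := by
          field_simp
        rw [this]
        have : 0 < Cc * C1 * A := by positivity
        linarith
    refine (mul_le_mul_right hPI _).trans (le_of_eq ?_)
    rw [← mul_assoc, ← mul_assoc, ← ENNReal.ofReal_mul (by positivity),
      ← ENNReal.ofReal_mul (by positivity)]
    congr 2
    field_simp
end SparseCZ

namespace SparseCZ
variable {n : ℕ}

theorem sum_biUnion_le_sum {ι κ : Type*} [DecidableEq κ] (s : Finset ι) (t : ι → Finset κ)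
    (g : κ → ℝ≥0∞) : ∑ b ∈ s.biUnion t, g b ≤ ∑ a ∈ s, ∑ b ∈ t a, g b := by
  classical
  induction s using Finset.induction_on with
  | empty => simp
  | insert a s ha ih =>
    rw [Finset.biUnion_insert, Finset.sum_insert ha]
    have : ∑ b ∈ t a ∪ s.biUnion t, g b ≤ ∑ b ∈ t a, g b + ∑ b ∈ s.biUnion t, g b := by
      rw [← Finset.sum_union_inter]; exact le_self_add
    exact this.trans (add_le_add le_rfl ih)

open Classical in
theorem sparse_dom {T : (Rn n → ℝ) → Rn n → ℝ} {K : Rn n → Rn n → ℝ} {c δ : ℝ}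
    (hT : IsCZO n T K c δ) (hn : 0 < n) : ∃ C : ℝ, 0 < C ∧ ∀ (j0 : ℤ) (f : Rn n → ℝ),
      Measurable f → Integrable f volume → ∀ (d : ℕ) (z : Rn n),
      ∃ F : Finset (Cube n),
        (∀ P ∈ F, ∃ y ∈ (gc a0 (j0+d) z).toSet, ∃ k, j0 ≤ k ∧ k ≤ j0 + d ∧ P = gc a0 k y) ∧
        (∀ x ∈ (gc a0 (j0+d) z).toSet, ∀ r : ℝ, 2 ^ j0 ≤ r →
          ‖UU (kr K r) ((tl (gc a0 (j0+d) z)).indicator f) x‖ₑ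
            ≤ ENNReal.ofReal C * ∑ P ∈ F, P.toSet.indicator (fun _ => aP f P) x) ∧
        (∀ R : Set (Rn n), MeasurableSet R →
          ∑ P ∈ F, (if P.toSet ⊆ R then volume P.toSet else 0)
            ≤ 2 * volume (R ∩ (gc a0 (j0+d) z).toSet)) := by
  obtain ⟨C, hcC, hstep⟩ := one_step hT hn
  have hc := hT.c_pos
  refine ⟨C, by linarith, ?_⟩
  intro j0 f hfm hfi d
  induction d using Nat.strong_induction_on with
  | _ d ih =>
  intro z
  rcases Nat.eq_zero_or_pos d with rfl | hd
  · refine ⟨{gc a0 (j0+(0:ℕ)) z}, ?_, ?_, ?_⟩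
    · intro P hP
      rw [Finset.mem_singleton] at hP
      exact ⟨z, mem_gc _ _ _, j0 + (0:ℕ), by simp, by simp, hP⟩
    · intro x hx r hr
      rw [Finset.sum_singleton, indicator_of_mem hx]
      refine (kr_UU_aP hT f (by rw [gc_side]; simpa using hr) x).trans ?_
      gcongr
    · intro R hR
      rw [Finset.sum_singleton]
      split_ifs with h
      · rw [inter_eq_right.2 h, two_mul]; exact le_self_add
      · simp
  · obtain ⟨e, rfl⟩ : ∃ e, d = e + 1 := ⟨d - 1, by omega⟩
    obtain ⟨B, hB1, hB2, hB3, hB4⟩ := hstep j0 (j0 + e) (by omega) f hfm hfi z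
    have hlev : j0 + ((e + 1 : ℕ) : ℤ) = j0 + e + 1 := by push_cast; ring
    rw [hlev]
    set Q := gc a0 (j0 + e + 1) z with hQ
    have hQs : Q.side = 2 ^ (j0 + e + 1) := gc_side _ _ _
    have hPex : ∀ P : Cube n, ∃ F : Finset (Cube n), P ∈ B →
        (∀ P' ∈ F, ∃ y ∈ P.toSet, ∃ k, j0 ≤ k ∧ k ≤ j0 + e ∧ P' = gc a0 k y) ∧
        (∀ x ∈ P.toSet, ∀ r : ℝ, 2 ^ j0 ≤ r →
          ‖UU (kr K r) ((tl P).indicator f) x‖ₑ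
            ≤ ENNReal.ofReal C * ∑ P ∈ F, P.toSet.indicator (fun _ => aP f P) x) ∧
        (∀ R : Set (Rn n), MeasurableSet R →
          ∑ P ∈ F, (if P.toSet ⊆ R then volume P.toSet else 0)
            ≤ 2 * volume (R ∩ P.toSet)) := by
      intro P
      by_cases hP : P ∈ B
      · obtain ⟨y, hy, k, hk1, hk2, rfl⟩ := hB1 P hP
        obtain ⟨F, h1, h2, h3⟩ := ih (k - j0).toNat (by omega) y
        have hk : j0 + ((k - j0).toNat : ℤ) = k := by omega
        rw [hk] at h1 h2 h3
        refine ⟨F, fun _ => ⟨?_, h2, h3⟩⟩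
        intro P' hP'
        obtain ⟨w, hw, k', a, b, e⟩ := h1 P' hP'
        exact ⟨w, hw, k', a, by omega, e⟩
      · exact ⟨∅, fun h => absurd h hP⟩
    choose FF hFF using hPex
    have hsub : ∀ P ∈ B, P.toSet ⊆ Q.toSet := by
      intro P hP
      obtain ⟨y, hy, k, hk1, hk2, rfl⟩ := hB1 P hP
      rw [hQ, ← gc_eq_of_mem hy]
      exact gc_subset adm_a0 (by omega) y
    have hQn : Q ∉ B.biUnion FF := by
      intro hmem
      rw [Finset.mem_biUnion] at hmem
      obtain ⟨P, hP, hQP⟩ := hmem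
      obtain ⟨y, hy, k, hk1, hk2, hk3⟩ := (hFF P hP).1 Q hQP
      have : Q.side = 2 ^ k := by rw [hk3]; exact gc_side _ _ _
      rw [hQs] at this
      have := two_zpow_inj this
      omega
    refine ⟨insert Q (B.biUnion FF), ?_, ?_, ?_⟩
    · intro P hP
      rw [Finset.mem_insert, Finset.mem_biUnion] at hP
      rcases hP with rfl | ⟨P', hP', hP⟩
      · exact ⟨z, mem_gc _ _ _, j0 + e + 1, by omega, le_rfl, rfl⟩
      · obtain ⟨y, hy, k, hk1, hk2, hk3⟩ := (hFF P' hP').1 P hP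
        exact ⟨y, hsub P' hP' hy, k, hk1, by omega, hk3⟩
    · intro x hx r hr
      rw [Finset.sum_insert hQn, indicator_of_mem hx, mul_add]
      rcases hB4 x hx r hr with h | ⟨P, hP, hxP, h⟩
      · exact h.trans le_self_add
      · refine h.trans (add_le_add le_rfl ?_)
        refine ((hFF P hP).2.1 x hxP r hr).trans ?_
        gcongr
        exact Finset.subset_biUnion_of_mem FF hP
    · intro R hR
      rw [Finset.sum_insert hQn]
      have hsum : ∑ P ∈ B.biUnion FF, (if P.toSet ⊆ R then volume P.toSet else 0)
          ≤ ∑ P ∈ B, 2 * volume (R ∩ P.toSet) :=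
        (sum_biUnion_le_sum _ _ _).trans (Finset.sum_le_sum fun P hP => (hFF P hP).2.2 R hR)
      refine (add_le_add le_rfl hsum).trans ?_
      rw [← Finset.mul_sum]
      split_ifs with h
      · rw [inter_eq_right.2 h, two_mul (volume Q.toSet)]
        refine add_le_add le_rfl ?_
        have : ∑ P ∈ B, volume (R ∩ P.toSet) ≤ volume Q.toSet / 2 :=
          (Finset.sum_le_sum fun P _ => measure_mono inter_subset_right).trans hB3
        refine (mul_le_mul_right this 2).trans ?_
        rw [ENNReal.mul_div_cancel (by simp) (by simp)]
      · rw [zero_add]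
        refine mul_le_mul_right ?_ 2
        rw [← measure_biUnion_finset (fun P hP P' hP' hne =>
          (hB2 hP hP' hne).mono inter_subset_right inter_subset_right)
          (fun P _ => hR.inter P.measurableSet)]
        refine measure_mono (iUnion₂_subset fun P hP => ?_)
        exact inter_subset_inter_right _ (hsub P hP)
end SparseCZ

namespace SparseCZ
variable {n : ℕ}

theorem sum_image_le_sum {ι κ : Type*} [DecidableEq κ] (s : Finset ι) (t : ι → κ)
    (g : κ → ℝ≥0∞) : ∑ b ∈ s.image t, g b ≤ ∑ a ∈ s, g (t a) := by
  classical
  rw [← Finset.biUnion_singleton]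
  refine (sum_biUnion_le_sum _ _ _).trans (le_of_eq ?_)
  simp

theorem toSet_subset_tl (P : Cube n) : P.toSet ⊆ tl P := by
  intro y hy
  rw [tl, Metric.mem_ball]
  have h1 := Cube.dist_le P hy P.pt_mem
  have := P.side_pos
  have h2 : (0:ℝ) ≤ n := by positivity
  unfold LL
  nlinarith [mul_nonneg h2 this.le]

theorem exists_big (m : ℕ) (hm : 6 * LL n ≤ 2 ^ m) {P : Cube n} {k : ℤ} (hk : P.side = 2 ^ k) :
    ∃ (a : Fin n → Bool) (R : Cube n), R ∈ grid (shiftB a) ∧ R.side = 2 ^ m * P.side ∧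
      tl P ⊆ R.toSet := by
  obtain ⟨a, ha⟩ := one_third (k + m) P.pt
  refine ⟨a, gc (shiftB a) (k+m) P.pt, ⟨_, _, rfl⟩, ?_, ?_⟩
  · rw [gc_side, hk, zpow_add₀ (by norm_num), zpow_natCast, mul_comm]
  · intro y hy
    apply ha
    rw [tl, Metric.mem_ball, dist_comm] at hy
    refine hy.trans_le ?_
    rw [zpow_add₀ (by norm_num), zpow_natCast, hk]
    have : (0:ℝ) < 2 ^ k := by positivity
    nlinarith

theorem aP_le (m : ℕ) (f : Rn n → ℝ) {P R : Cube n} (hs : R.side = 2 ^ m * P.side)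
    (hsub : tl P ⊆ R.toSet) :
    aP f P ≤ (2 ^ (m * n) : ℕ) * avgE R.toSet (fun y => ENNReal.ofReal |f y|) := by
  have hp := P.side_pos
  have e : ∀ y, ENNReal.ofReal |f y| = ‖f y‖ₑ := fun y => by
    rw [← Real.norm_eq_abs, ofReal_norm]
  simp_rw [e]
  rw [aP, avgE, ← mul_assoc, Cube.volume_eq, hs, ← ENNReal.ofReal_inv_of_pos (by positivity),
    ← ENNReal.ofReal_natCast, ← ENNReal.ofReal_mul (by positivity)]
  refine mul_le_mul' (le_of_eq ?_) (lintegral_mono_set hsub)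
  congr 1
  push_cast
  rw [mul_pow, ← pow_mul]
  field_simp

open Classical in
theorem transfer (n : ℕ) : ∃ (N M : ℕ), ∀ (f : Rn n → ℝ) (F : Finset (Cube n)),
    (∀ P ∈ F, ∃ k y, P = gc a0 k y) →
    (∀ R : Set (Rn n), MeasurableSet R →
      ∑ P ∈ F, (if P.toSet ⊆ R then volume P.toSet else 0) ≤ 2 * volume R) →
    ∃ S : (Fin n → Bool) → ℕ → Set (Cube n),
      (∀ a i, S a i ⊆ grid (shiftB a) ∧ IsSparse (S a i)) ∧
      ∀ x, ∑ P ∈ F, P.toSet.indicator (fun _ => aP f P) x ≤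
        M * ∑ a, ∑ i ∈ Finset.range N, sparseOp (S a i) (fun y => ENNReal.ofReal |f y|) x := by
  obtain ⟨m, hm⟩ : ∃ m : ℕ, 6 * LL n ≤ 2 ^ m := by
    obtain ⟨m, hm⟩ := pow_unbounded_of_one_lt (6 * LL n) (one_lt_two (α := ℝ))
    exact ⟨m, hm.le⟩
  set M : ℕ := 2 ^ (m * n) with hM
  have hMp : 0 < M := by positivity
  refine ⟨2 * (2 * M), M, ?_⟩
  intro f F hF hC
  have hex : ∀ P : Cube n, ∃ (a : Fin n → Bool) (R : Cube n), P ∈ F →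
      R ∈ grid (shiftB a) ∧ R.side = 2 ^ m * P.side ∧ tl P ⊆ R.toSet := by
    intro P
    by_cases hP : P ∈ F
    · obtain ⟨k, y, rfl⟩ := hF P hP
      obtain ⟨a, R, h⟩ := exists_big m hm (P := gc a0 k y) (gc_side _ _ _)
      exact ⟨a, R, fun _ => h⟩
    · exact ⟨fun _ => true, P, fun h => absurd h hP⟩
  choose A R hAR using hex
  set G : (Fin n → Bool) → Finset (Cube n) := fun a => (F.filter fun P => A P = a).image R with hG
  have hGg : ∀ a, ∀ R' ∈ G a, R' ∈ grid (shiftB a) := by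
    intro a R' hR'
    simp only [hG, Finset.mem_image, Finset.mem_filter] at hR'
    obtain ⟨P, ⟨hP, rfl⟩, rfl⟩ := hR'
    exact (hAR P hP).1
  refine ⟨fun a i => cls (G a) (2 * (2 * M)) i, ?_, ?_⟩
  · intro a i
    refine ⟨fun R' hR' => hGg a R' hR'.1, ?_⟩
    refine isSparse_cls (adm_shiftB a) (hGg a) (2 * M) (by positivity) ?_ i
    intro R0 hR0
    calc ∑ R' ∈ G a, (if R'.toSet ⊆ R0.toSet then volume R'.toSet else 0)
        ≤ ∑ P ∈ F.filter (fun P => A P = a),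
          (if (R P).toSet ⊆ R0.toSet then volume (R P).toSet else 0) := sum_image_le_sum _ _ _
      _ ≤ ∑ P ∈ F, (if (R P).toSet ⊆ R0.toSet then volume (R P).toSet else 0) :=
          Finset.sum_le_sum_of_subset (Finset.filter_subset _ _)
      _ ≤ ∑ P ∈ F, M * (if P.toSet ⊆ R0.toSet then volume P.toSet else 0) := by
          refine Finset.sum_le_sum fun P hP => ?_
          obtain ⟨h1, h2, h3⟩ := hAR P hP
          split_ifs with h4 h5
          · rw [Cube.volume_eq, Cube.volume_eq, h2, ← ENNReal.ofReal_natCast,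
              ← ENNReal.ofReal_mul (by positivity)]
            apply le_of_eq
            congr 1
            rw [hM]; push_cast
            rw [mul_pow, ← pow_mul]
          · exact absurd (((toSet_subset_tl P).trans h3).trans h4) h5
          · simp
          · simp
      _ = M * ∑ P ∈ F, (if P.toSet ⊆ R0.toSet then volume P.toSet else 0) := by
          rw [Finset.mul_sum]
      _ ≤ M * (2 * volume R0.toSet) := by
          exact mul_le_mul_right (hC _ R0.measurableSet) _
      _ = ((2 * M : ℕ) : ℝ≥0∞) * volume R0.toSet := by push_cast; ring
  · intro x
    set g : Cube n → ℝ≥0∞ :=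
      fun Q => Q.toSet.indicator (fun _ => avgE Q.toSet (fun y => ENNReal.ofReal |f y|)) x with hg
    have key : ∀ a, ∑ P ∈ F.filter (fun P => A P = a), P.toSet.indicator (fun _ => aP f P) x
        ≤ M * ∑ Q ∈ G a, g Q := by
      intro a
      set Fx := (F.filter fun P => A P = a).filter fun P => x ∈ P.toSet with hFx
      have hinj : Set.InjOn R Fx := by
        intro P hP P' hP' hRR
        simp only [hFx, Finset.coe_filter, Finset.mem_filter, mem_ofPred_eq] at hP hP'
        obtain ⟨⟨hPF, -⟩, hxP⟩ := hP
        obtain ⟨⟨hPF', -⟩, hxP'⟩ := hP'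
        have e1 := (hAR P hPF).2.1
        have e2 := (hAR P' hPF').2.1
        rw [hRR, e2] at e1
        have e3 : P'.side = P.side := by
          have : (0:ℝ) < 2 ^ m := by positivity
          exact mul_left_cancel₀ this.ne' e1
        obtain ⟨k, y, hk⟩ := hF P hPF
        obtain ⟨k', y', hk'⟩ := hF P' hPF'
        have hs : P.side = 2 ^ k := by rw [hk]; exact gc_side _ _ _
        rw [grid_eq (α := a0) ⟨k, y, hk⟩ hs hxP, grid_eq (α := a0) ⟨k', y', hk'⟩ (e3.trans hs) hxP']
      calc ∑ P ∈ F.filter (fun P => A P = a), P.toSet.indicator (fun _ => aP f P) x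
          = ∑ P ∈ Fx, aP f P := by
            rw [hFx, Finset.sum_filter (fun P : Cube n => x ∈ P.toSet)]
            refine Finset.sum_congr rfl fun P _ => ?_
            rw [indicator_apply]
        _ ≤ ∑ P ∈ Fx, M * g (R P) := by
            refine Finset.sum_le_sum fun P hP => ?_
            simp only [hFx, Finset.mem_filter] at hP
            obtain ⟨h1, h2, h3⟩ := hAR P hP.1.1
            have hx : x ∈ (R P).toSet := h3 (toSet_subset_tl P hP.2)
            simp only [hg]
            rw [indicator_of_mem hx]
            exact aP_le m f h2 h3
        _ = M * ∑ Q ∈ Fx.image R, g Q := by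
            rw [Finset.sum_image hinj, Finset.mul_sum]
        _ ≤ M * ∑ Q ∈ G a, g Q := by
            refine mul_le_mul_right (Finset.sum_le_sum_of_subset ?_) _
            exact Finset.image_subset_image (Finset.filter_subset _ _)
    rw [← Finset.sum_fiberwise_of_maps_to (s := F) (t := Finset.univ) (g := A)
      (fun _ _ => Finset.mem_univ _), Finset.mul_sum]
    refine Finset.sum_le_sum fun a _ => (key a).trans ?_
    exact mul_le_mul_right (sum_le_cls _ _ (by positivity) _ x) _
end SparseCZ

namespace SparseCZ
variable {n : ℕ}

theorem trunc_eq {T : (Rn n → ℝ) → Rn n → ℝ} {K : Rn n → Rn n → ℝ} {c δ : ℝ}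
    (hT : IsCZO n T K c δ) {f : Rn n → ℝ} (hfi : Integrable f volume) {a b k : ℝ} (ha : 0 < a)
    (hab : a < b) {x : Rn n} (hx : ‖x‖ + b ≤ k) :
    ∫ y in {y | a < dist x y ∧ dist x y < b}, K x y * f y =
      UU (kr K a) ((Metric.ball 0 k).indicator f) x -
        UU (kr K b) ((Metric.ball 0 k).indicator f) x := by
  set g := (Metric.ball (0 : Rn n) k).indicator f with hg
  have hgi : Integrable g volume := hfi.indicator Metric.isOpen_ball.measurableSet
  have hms : MeasurableSet {y : Rn n | a < dist x y ∧ dist x y < b} := by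
    have h1 : MeasurableSet {y : Rn n | a < dist x y} :=
      measurableSet_lt measurable_const (by fun_prop)
    have h2 : MeasurableSet {y : Rn n | dist x y < b} :=
      measurableSet_lt (by fun_prop) measurable_const
    exact h1.inter h2
  unfold UU
  rw [← integral_sub (kr_int hT ha hgi x) (kr_int hT (ha.trans hab) hgi x),
    ← integral_indicator hms]
  refine integral_congr_ae ?_
  have hsph : ∀ᵐ y ∂(volume : Measure (Rn n)), y ∉ Metric.sphere x b := by
    rw [ae_iff]
    simp only [not_not]
    exact Measure.addHaar_sphere_of_ne_zero volume x (ha.trans hab).ne'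
  filter_upwards [hsph] with y hy
  rw [Metric.mem_sphere, dist_comm] at hy
  rw [indicator_apply]
  simp only [mem_ofPred_eq, kr]
  by_cases h1 : a < dist x y
  · rcases lt_or_gt_of_ne hy with h2 | h2
    · rw [if_pos ⟨h1, h2⟩, if_pos h1, if_neg (by linarith)]
      have : y ∈ Metric.ball (0 : Rn n) k := by
        rw [mem_ball_zero_iff]
        have := norm_le_norm_add_norm_sub x y
        rw [← dist_eq_norm] at this
        linarith
      rw [hg, indicator_of_mem this]; ring
    · rw [if_neg (by rintro ⟨_, h3⟩; linarith), if_pos h1, if_pos h2]; ring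
  · rw [if_neg (by rintro ⟨h3, _⟩; exact h1 h3), if_neg h1, if_neg (by linarith)]; ring

/-- truncated maximal function, restricted ranges -/
def gk (K : Rn n → Rn n → ℝ) (f : Rn n → ℝ) (k : ℕ) (x : Rn n) : ℝ≥0∞ :=
  ⨆ (e : ℝ × ℝ) (_ : ((2:ℝ) ^ k)⁻¹ ≤ e.1 ∧ e.1 < e.2 ∧ ‖x‖ + e.2 ≤ k),
    ENNReal.ofReal |∫ y in {y | e.1 < dist x y ∧ dist x y < e.2}, K x y * f y|

theorem gk_mono (K : Rn n → Rn n → ℝ) (f : Rn n → ℝ) : Monotone (gk K f) := by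
  intro k k' hk x
  refine iSup_le fun e => iSup_le fun he => ?_
  refine le_iSup₂_of_le e ⟨le_trans ?_ he.1, he.2.1, he.2.2.trans (by exact_mod_cast hk)⟩ le_rfl
  gcongr
  norm_num

theorem maxTrunc_le (K : Rn n → Rn n → ℝ) (f : Rn n → ℝ) (x : Rn n) :
    ENNReal.ofReal |maxTrunc K f x| ≤ ⨆ k, gk K f k x := by
  by_cases htop : ⨆ k, gk K f k x = ⊤
  · rw [htop]; exact le_top
  have h0 : 0 ≤ maxTrunc K f x := Real.iSup_nonneg fun e => abs_nonneg _
  rw [abs_of_nonneg h0]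
  refine ENNReal.ofReal_le_of_le_toReal ?_
  refine Real.iSup_le (fun e => ?_) ENNReal.toReal_nonneg
  obtain ⟨⟨a, b⟩, ha, hab⟩ := e
  simp only at ha hab ⊢
  obtain ⟨k, hk⟩ := exists_nat_ge (max (1 / a) (‖x‖ + b))
  have h1 : 1 / a ≤ k := (le_max_left _ _).trans hk
  have h2 : ‖x‖ + b ≤ k := (le_max_right _ _).trans hk
  have h3 : (k : ℝ) ≤ 2 ^ k := by exact_mod_cast Nat.lt_two_pow_self.le
  have h4 : ((2:ℝ) ^ k)⁻¹ ≤ a := by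
    rw [inv_le_comm₀ (by positivity) ha, ← one_div]
    linarith
  rw [← ENNReal.ofReal_le_iff_le_toReal htop]
  refine le_iSup_of_le k ?_
  exact le_iSup₂_of_le (f := fun (e : ℝ × ℝ)
    (_ : ((2:ℝ) ^ k)⁻¹ ≤ e.1 ∧ e.1 < e.2 ∧ ‖x‖ + e.2 ≤ k) =>
    ENNReal.ofReal |∫ y in {y | e.1 < dist x y ∧ dist x y < e.2}, K x y * f y|) (a, b)
    ⟨h4, hab, h2⟩ le_rfl

theorem stage {T : (Rn n → ℝ) → Rn n → ℝ} {K : Rn n → Rn n → ℝ} {c δ : ℝ}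
    (hT : IsCZO n T K c δ) (hn : 0 < n) : ∃ (N : ℕ) (C : ℝ≥0), ∀ f : Rn n → ℝ, Measurable f →
      Integrable f volume → ∀ k : ℕ, ∃ S : (Fin n → Bool) → ℕ → Set (Cube n),
      (∀ a i, S a i ⊆ grid (shiftB a) ∧ IsSparse (S a i)) ∧
      ∀ x, gk K f k x ≤
        C * ∑ a, ∑ i ∈ Finset.range N, sparseOp (S a i) (fun y => ENNReal.ofReal |f y|) x := by
  classical
  obtain ⟨C0, hC0, hdom⟩ := sparse_dom hT hn
  obtain ⟨N, M, htr⟩ := transfer n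
  refine ⟨N, 2 * C0.toNNReal * M, ?_⟩
  intro f hfm hfi k
  set g := (Metric.ball (0 : Rn n) k).indicator f with hg
  have hgm : Measurable g := hfm.indicator Metric.isOpen_ball.measurableSet
  have hgi : Integrable g volume := hfi.indicator Metric.isOpen_ball.measurableSet
  obtain ⟨F, hF1, hF2, hF3⟩ := hdom (-(k:ℤ)) g hgm hgi (2 * k + 3) 0
  have hlev : -(k:ℤ) + ((2 * k + 3 : ℕ) : ℤ) = ((k + 3 : ℕ) : ℤ) := by push_cast; ring
  rw [hlev] at hF1 hF2 hF3
  set Q := gc a0 ((k + 3 : ℕ) : ℤ) (0 : Rn n) with hQ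
  have hball : ∀ y : Rn n, ‖y‖ ≤ k → y ∈ Q.toSet := by
    intro y hy
    refine ball_subset_gc_a0 _ y ?_
    have h3 : (k : ℝ) < 2 ^ k := by exact_mod_cast Nat.lt_two_pow_self
    rw [zpow_natCast, pow_add]
    have : (0:ℝ) ≤ k := by positivity
    linarith
  have hgQ : (tl Q).indicator g = g := by
    rw [hg, indicator_indicator]
    congr 1
    refine inter_eq_right.2 fun y hy => toSet_subset_tl Q (hball y ?_)
    exact (mem_ball_zero_iff.1 hy).le
  rw [hgQ] at hF2
  obtain ⟨S, hS1, hS2⟩ := htr f F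
    (fun P hP => by obtain ⟨y, -, k, -, -, h⟩ := hF1 P hP; exact ⟨k, y, h⟩)
    (fun R hR => (hF3 R hR).trans (mul_le_mul_right (measure_mono inter_subset_left) _))
  refine ⟨S, hS1, fun x => ?_⟩
  refine iSup_le fun e => iSup_le fun he => ?_
  obtain ⟨h1, h2, h3⟩ := he
  have ha : 0 < e.1 := lt_of_lt_of_le (by positivity) h1
  have hxQ : x ∈ Q.toSet := hball x (by linarith)
  have hle : ∀ P : Cube n, aP g P ≤ aP f P := by
    intro P
    unfold aP
    refine mul_le_mul_right (lintegral_mono fun y => ?_) _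
    rw [hg, enorm_indicator_eq_indicator_enorm]
    exact indicator_le_self _ _ _
  have hsc : (2:ℝ) ^ (-(k:ℤ)) ≤ e.1 := by rw [zpow_neg, zpow_natCast]; exact h1
  have hr : ∀ r : ℝ, e.1 ≤ r → ‖UU (kr K r) g x‖ₑ ≤ ENNReal.ofReal C0 *
      (M * ∑ a, ∑ i ∈ Finset.range N, sparseOp (S a i) (fun y => ENNReal.ofReal |f y|) x) := by
    intro r hr
    refine (hF2 x hxQ r (hsc.trans hr)).trans (mul_le_mul_right (le_trans ?_ (hS2 x)) _)
    refine Finset.sum_le_sum fun P _ => ?_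
    exact indicator_le_indicator (hle P)
  rw [trunc_eq hT hfi ha h2 h3, ← Real.norm_eq_abs, ofReal_norm]
  refine enorm_sub_le.trans ((add_le_add (hr e.1 le_rfl) (hr e.2 h2.le)).trans (le_of_eq ?_))
  rw [← two_mul]
  push_cast
  rw [ENNReal.ofReal]
  ring

theorem rho_sum (X : BFS n) {ι : Type*} (s : Finset ι) (g : ι → Rn n → ℝ≥0∞) :
    X.ρ (fun x => ∑ i ∈ s, g i x) ≤ ∑ i ∈ s, X.ρ (g i) := by
  classical
  induction s using Finset.induction_on with
  | empty =>
    simp only [Finset.sum_empty, nonpos_iff_eq_zero]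
    rw [X.zero_iff]
    rfl
  | insert a s ha ih =>
    simp only [Finset.sum_insert ha]
    exact (X.add_le _ _).trans (add_le_add le_rfl ih)

theorem main_meas {T : (Rn n → ℝ) → Rn n → ℝ} {K : Rn n → Rn n → ℝ} {c δ : ℝ}
    (hT : IsCZO n T K c δ) (hn : 0 < n) : ∃ C : ℝ≥0∞, C ≠ ⊤ ∧
      ∀ (X : BFS n) (f : Rn n → ℝ), Measurable f → Integrable f volume →
        X.ρ (fun x => ENNReal.ofReal |maxTrunc K f x|) ≤
          C * ⨆ (D : Set (Cube n)) (_ : IsDyadicGrid D)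
                (S : Set (Cube n)) (_ : S ⊆ D) (_ : IsSparse S),
              X.ρ (sparseOp S fun y => ENNReal.ofReal |f y|) := by
  obtain ⟨N, C, hst⟩ := stage hT hn
  refine ⟨C * (Fintype.card (Fin n → Bool) * N : ℕ), by finiteness, ?_⟩
  intro X f hfm hfi
  set U := ⨆ (D : Set (Cube n)) (_ : IsDyadicGrid D)
                (S : Set (Cube n)) (_ : S ⊆ D) (_ : IsSparse S),
              X.ρ (sparseOp S fun y => ENNReal.ofReal |f y|) with hU
  have hUle : ∀ (D S : Set (Cube n)), IsDyadicGrid D → S ⊆ D → IsSparse S →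
      X.ρ (sparseOp S fun y => ENNReal.ofReal |f y|) ≤ U := by
    intro D S hD hS hSp
    exact le_iSup_of_le D (le_iSup_of_le hD (le_iSup_of_le S (le_iSup_of_le hS
      (le_iSup_of_le hSp le_rfl))))
  refine (X.mono _ _ (Eventually.of_forall fun x => maxTrunc_le K f x)).trans ?_
  rw [X.fatou _ (gk_mono K f)]
  refine iSup_le fun k => ?_
  obtain ⟨S, hS1, hS2⟩ := hst f hfm hfi k
  refine (X.mono _ _ (Eventually.of_forall hS2)).trans ?_
  rw [X.smul_eq, mul_assoc]
  refine mul_le_mul_right ?_ _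
  refine (rho_sum X _ _).trans ?_
  calc ∑ a, X.ρ (fun x => ∑ i ∈ Finset.range N,
        sparseOp (S a i) (fun y => ENNReal.ofReal |f y|) x)
      ≤ ∑ a : Fin n → Bool, ∑ i ∈ Finset.range N, U := by
        refine Finset.sum_le_sum fun a _ => (rho_sum X _ _).trans ?_
        refine Finset.sum_le_sum fun i _ => ?_
        exact hUle (grid (shiftB a)) (S a i) (isDyadicGrid_grid (adm_shiftB a)) (hS1 a i).1
          (hS1 a i).2
    _ = ((Fintype.card (Fin n → Bool) * N : ℕ) : ℝ≥0∞) * U := by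
        rw [Finset.sum_const, Finset.sum_const, Finset.card_range, Finset.card_univ, nsmul_eq_mul,
          nsmul_eq_mul]
        push_cast; ring

theorem maxTrunc_congr (K : Rn n → Rn n → ℝ) {f g : Rn n → ℝ} (h : f =ᵐ[volume] g) :
    maxTrunc K f = maxTrunc K g := by
  ext x
  unfold maxTrunc
  congr 1
  ext e
  congr 1
  refine integral_congr_ae (ae_restrict_of_ae ?_)
  filter_upwards [h] with y hy
  rw [hy]

theorem sparseOp_congr (S : Set (Cube n)) {f g : Rn n → ℝ} (h : f =ᵐ[volume] g) :
    (sparseOp S fun y => ENNReal.ofReal |f y|) = sparseOp S fun y => ENNReal.ofReal |g y| := by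
  have : ∀ Q : Cube n, avgE Q.toSet (fun y => ENNReal.ofReal |f y|)
      = avgE Q.toSet (fun y => ENNReal.ofReal |g y|) := by
    intro Q
    unfold avgE
    congr 1
    refine lintegral_congr_ae (ae_restrict_of_ae ?_)
    filter_upwards [h] with y hy
    rw [hy]
  ext x
  unfold sparseOp
  simp_rw [this]

theorem maxTrunc_zero (hn : n = 0) (K : Rn n → Rn n → ℝ) (f : Rn n → ℝ) (x : Rn n) :
    maxTrunc K f x = 0 := by
  subst hn
  unfold maxTrunc
  have : ∀ e : {e : ℝ × ℝ // 0 < e.1 ∧ e.1 < e.2},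
      |∫ y in {y | e.1.1 < dist x y ∧ dist x y < e.1.2}, K x y * f y| = 0 := by
    intro e
    have he : {y : Rn 0 | e.1.1 < dist x y ∧ dist x y < e.1.2} = ∅ := by
      ext y
      rw [Subsingleton.elim y x]
      simp only [mem_ofPred_eq, dist_self, mem_empty_iff_false, iff_false]
      rintro ⟨h, -⟩
      exact absurd h (not_lt.2 e.2.1.le)
    rw [he]; simp
  simp [this]

theorem main_all {T : (Rn n → ℝ) → Rn n → ℝ} {K : Rn n → Rn n → ℝ} {c δ : ℝ}
    (hT : IsCZO n T K c δ) : ∃ C : ℝ≥0∞, C ≠ ⊤ ∧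
      ∀ (X : BFS n) (f : Rn n → ℝ), Integrable f volume →
        X.ρ (fun x => ENNReal.ofReal |maxTrunc K f x|) ≤
          C * ⨆ (D : Set (Cube n)) (_ : IsDyadicGrid D)
                (S : Set (Cube n)) (_ : S ⊆ D) (_ : IsSparse S),
              X.ρ (sparseOp S fun y => ENNReal.ofReal |f y|) := by
  rcases Nat.eq_zero_or_pos n with hn | hn
  · refine ⟨0, by simp, fun X f _ => ?_⟩
    have : X.ρ (fun x => ENNReal.ofReal |maxTrunc K f x|) = 0 := by
      rw [X.zero_iff]
      refine Eventually.of_forall fun x => ?_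
      simp [maxTrunc_zero hn K f x]
    rw [this]; simp
  · obtain ⟨C, hC, h⟩ := main_meas hT hn
    refine ⟨C, hC, fun X f hf => ?_⟩
    have hae : f =ᵐ[volume] hf.1.mk f := hf.1.ae_eq_mk
    have h2 := h X (hf.1.mk f) hf.1.stronglyMeasurable_mk.measurable (hf.congr hae)
    simp_rw [sparseOp_congr _ hae, maxTrunc_congr K hae]
    exact h2
end SparseCZ

open SparseCZ in
/-- `‖T**f‖_X ≤ C sup_{D,S} ‖A_{D,S}|f|‖_X` for Banach function spaces. -/
theorem stmt3 (n : ℕ) (T : (Rn n → ℝ) → Rn n → ℝ) (K : Rn n → Rn n → ℝ) (c δ : ℝ)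
    (hT : IsCZO n T K c δ) :
    ∃ C : ℝ≥0∞, C ≠ ⊤ ∧
      ∀ (X : BFS n) (f : Rn n → ℝ), Integrable f volume →
        X.ρ (fun x => ENNReal.ofReal |maxTrunc K f x|) ≤
          C * ⨆ (D : Set (Cube n)) (_ : IsDyadicGrid D)
                (S : Set (Cube n)) (_ : S ⊆ D) (_ : IsSparse S),
              X.ρ (sparseOp S fun y => ENNReal.ofReal |f y|) := by
  exact main_all hT
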